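/- Let D̂ = ℝ × (0, κ), let ŵ_γ(z, φ) = min(φ, κ−φ)^γ, let 1 < p < ∞, and let γ ∈ (−1, 2p−1) with γ ≠ p−1. Suppose u ∈ L¹_loc(D̂) is such that u and its weak derivatives ∂_z u, ∂_z² u, ∂_φ u, ∂_φ² u all exist and belong to L^p(D̂, ŵ_γ dz dφ). Then the mixed weak derivative ∂_z ∂_φ u exists, belongs to L^p(D̂, ŵ_γ dz dφ), and there is a finite constant C, independent of u, such that ‖∂_z ∂_φ u‖_{L^p(D̂, ŵ_γ)} ≤ C ( ‖u‖_{L^p(D̂, ŵ_γ)} + ‖∂_z u‖_{L^p(D̂, ŵ_γ)} + ‖∂_z² u‖_{L^p(D̂, ŵ_γ)} + ‖∂_φ u‖_{L^p(D̂, ŵ_γ)} + ‖∂_φ² u‖_{L^p(D̂, ŵ_γ)} ). -/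

import Mathlib

open MeasureTheory Set Real
open scoped ENNReal

noncomputable section

/-- The planar angular domain with opening angle `κ`, as a subset of `ℝ × ℝ`. -/
def D2 (κ : ℝ) : Set (ℝ × ℝ) :=
  {x | ∃ r φ : ℝ, 0 < r ∧ 0 < φ ∧ φ < κ ∧ x = (r * Real.cos φ, r * Real.sin φ)}

/-- Partial derivative in the first variable. -/
def pd1 (f : ℝ × ℝ → ℂ) : ℝ × ℝ → ℂ := fun x => deriv (fun s => f (s, x.2)) x.1

/-- Partial derivative in the second variable. -/
def pd2 (f : ℝ × ℝ → ℂ) : ℝ × ℝ → ℂ := fun x => deriv (fun s => f (x.1, s)) x.2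

/-- Iterated partial derivative `∂_{x₁}^{α₁} ∂_{x₂}^{α₂} f` for a multi-index `α`. -/
def pdMix (α : ℕ × ℕ) (f : ℝ × ℝ → ℂ) : ℝ × ℝ → ℂ := pd1^[α.1] (pd2^[α.2] f)

/-- The Euler-coordinate parametrization `(z, φ) ↦ (eᶻ cos φ, eᶻ sin φ)`. -/
def eulerMap (p : ℝ × ℝ) : ℝ × ℝ := (Real.exp p.1 * Real.cos p.2, Real.exp p.1 * Real.sin p.2)

/-- The strip `ℝ × (0, κ)`. -/
def strip (κ : ℝ) : Set (ℝ × ℝ) := {p | 0 < p.2 ∧ p.2 < κ}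

/-- `g` is the `α`-th weak derivative of `u` on the open set `U`. -/
def HasWeakDerivOn (U : Set (ℝ × ℝ)) (α : ℕ × ℕ) (u g : ℝ × ℝ → ℂ) : Prop :=
  ∀ φ : ℝ × ℝ → ℂ, ContDiff ℝ (⊤ : ℕ∞) φ → HasCompactSupport φ → tsupport φ ⊆ U →
    ∫ x in U, u x * pdMix α φ x = (-1 : ℂ) ^ (α.1 + α.2) * ∫ x in U, g x * φ x

/-- The weighted `Lᵖ(D̂, ŵ_γ)`-norm (to the strip `ℝ × (0, κ)`), valued in `[0, ∞]`. -/
def stripNorm (κ p γ : ℝ) (h : ℝ × ℝ → ℂ) : ℝ≥0∞ :=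
  (∫⁻ q in strip κ, ENNReal.ofReal (‖h q‖ ^ p * min q.2 (κ - q.2) ^ γ)) ^ (1 / p)

/-- Jensen's inequality for weighted integrals. -/
lemma jensen_lint {α : Type*} [MeasurableSpace α] (μ : Measure α) {q : ℝ} (hq : 1 < q)
    {c F : α → ℝ≥0∞} (hc : AEMeasurable c μ) (hF : AEMeasurable F μ) :
    (∫⁻ x, c x * F x ∂μ) ^ q ≤ (∫⁻ x, c x ∂μ) ^ (q - 1) * ∫⁻ x, c x * F x ^ q ∂μ := by
  have hpq : (Real.conjExponent q).HolderConjugate q := (Real.HolderConjugate.conjExponent hq).symm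
  set p := Real.conjExponent q with hp
  have hp0 : 0 < p := hpq.pos
  have hq0 : 0 < q := by linarith
  have hsum : p⁻¹ + q⁻¹ = 1 := hpq.inv_add_inv_eq_one
  have h := ENNReal.lintegral_mul_le_Lp_mul_Lq μ hpq (f := fun x => c x ^ (1/p))
    (g := fun x => c x ^ (1/q) * F x) (hc.pow_const _) ((hc.pow_const _).mul hF)
  have e1 : ∀ x, ((fun x => c x ^ (1/p)) * fun x => c x ^ (1/q) * F x) x = c x * F x := by
    intro x
    simp only [Pi.mul_apply]
    rw [← mul_assoc, ← ENNReal.rpow_add_of_nonneg _ _ (by positivity) (by positivity)]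
    rw [one_div, one_div, hsum, ENNReal.rpow_one]
  simp only [e1] at h
  have e2 : ∀ x, (c x ^ (1/p)) ^ p = c x := by
    intro x
    rw [← ENNReal.rpow_mul, one_div, inv_mul_cancel₀ hp0.ne', ENNReal.rpow_one]
  have e3 : ∀ x, (c x ^ (1/q) * F x) ^ q = c x * F x ^ q := by
    intro x
    rw [ENNReal.mul_rpow_of_nonneg _ _ hq0.le, ← ENNReal.rpow_mul, one_div,
      inv_mul_cancel₀ hq0.ne', ENNReal.rpow_one]
  simp only [e2, e3] at h
  calc _ ≤ ((∫⁻ x, c x ∂μ) ^ (1/p) * (∫⁻ x, c x * F x ^ q ∂μ) ^ (1/q)) ^ q := by gcongr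
    _ = _ := by
      rw [ENNReal.mul_rpow_of_nonneg _ _ hq0.le, ← ENNReal.rpow_mul, ← ENNReal.rpow_mul]
      have : 1 / q * q = 1 := by field_simp
      rw [this, ENNReal.rpow_one]
      congr 2
      have : 1/p = 1 - 1/q := by rw [one_div, one_div]; linarith
      rw [this]; field_simp

lemma pich_ineq {q : ℝ} (hq : 1 < q) (hq2 : q ≤ 2) :
    ∃ A B : ℝ, 0 ≤ A ∧ 0 ≤ B ∧ ∀ w : ℂ, 0 ≤ w.re →
      |w.im| ^ q ≤ A * w.re ^ q - B * ((w ^ (q : ℂ)).re) := by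
  -- threshold angle
  set θ₀ : ℝ := (π / (2 * q) + π / 2) / 2 with hθ₀
  have hpi := Real.pi_pos
  have h1 : π / (2 * q) < π / 2 := by
    apply div_lt_div_of_pos_left hpi (by norm_num) (by linarith)
  have h2 : π / (2 * q) < θ₀ := by rw [hθ₀]; linarith
  have h3 : θ₀ < π / 2 := by rw [hθ₀]; linarith
  have h0 : 0 < θ₀ := lt_trans (by positivity) h2
  have hqθ : π / 2 < q * θ₀ := by
    have : q * (π / (2 * q)) < q * θ₀ := by gcongr
    have e : q * (π / (2 * q)) = π / 2 := by field_simp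
    linarith
  have hqθ' : q * θ₀ < π := by nlinarith
  have hc : Real.cos (q * θ₀) < 0 := Real.cos_neg_of_pi_div_two_lt_of_lt hqθ (by linarith)
  have hcθ : 0 < Real.cos θ₀ := Real.cos_pos_of_mem_Ioo ⟨by linarith, h3⟩
  set B := 1 / (-Real.cos (q * θ₀)) with hB
  have hBpos : 0 < B := by rw [hB]; apply one_div_pos.2; linarith
  refine ⟨(1 + B) / Real.cos θ₀ ^ q, B, by positivity, hBpos.le, ?_⟩
  intro w hw
  by_cases hw0 : w = 0
  · subst hw0
    simp [Complex.zero_cpow (show (q : ℂ) ≠ 0 by exact_mod_cast (by linarith : q ≠ 0)),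
      Real.zero_rpow (show q ≠ 0 by linarith)]
  set r := ‖w‖ with hr
  set θ := Complex.arg w with hθ
  have hrpos : 0 < r := norm_pos_iff.2 hw0
  have hre : w.re = r * Real.cos θ := (Complex.norm_mul_cos_arg w).symm
  have him : w.im = r * Real.sin θ := (Complex.norm_mul_sin_arg w).symm
  have harg : |θ| ≤ π / 2 := Complex.abs_arg_le_pi_div_two_iff.2 hw
  have hpow : (w ^ (q : ℂ)).re = r ^ q * Real.cos (q * θ) := by
    rw [Complex.cpow_ofReal_re]
    rw [mul_comm θ q]
  have hcos0 : 0 ≤ Real.cos θ := by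
    have := abs_le.1 harg
    exact Real.cos_nonneg_of_mem_Icc ⟨by linarith [this.1], this.2⟩
  rw [hpow, hre, him, abs_mul, abs_of_pos hrpos, Real.mul_rpow hrpos.le (abs_nonneg _),
    Real.mul_rpow hrpos.le hcos0]
  have hrq : 0 < r ^ q := Real.rpow_pos_of_pos hrpos q
  suffices |Real.sin θ| ^ q ≤ (1 + B) / Real.cos θ₀ ^ q * Real.cos θ ^ q - B * Real.cos (q * θ) by
    nlinarith
  have hs : |Real.sin θ| ^ q ≤ 1 :=
    Real.rpow_le_one (abs_nonneg _) (Real.abs_sin_le_one _) (by linarith)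
  have hcp : 0 ≤ Real.cos θ ^ q := Real.rpow_nonneg hcos0 q
  have hcosabs : Real.cos (q * θ) = Real.cos (q * |θ|) := by
    rcases abs_choice θ with h | h <;> rw [h]
    rw [mul_neg, Real.cos_neg]
  by_cases hcase : θ₀ ≤ |θ|
  · have : Real.cos (q * |θ|) ≤ Real.cos (q * θ₀) := by
      apply Real.cos_le_cos_of_nonneg_of_le_pi (by positivity) (by nlinarith)
      gcongr
    have hBc : B * Real.cos (q * θ₀) = -1 := by
      rw [hB]; field_simp; rw [div_self hc.ne]
    have : B * Real.cos (q * |θ|) ≤ -1 := by nlinarith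
    rw [hcosabs]
    have : 0 ≤ (1 + B) / Real.cos θ₀ ^ q * Real.cos θ ^ q := by positivity
    linarith
  · push Not at hcase
    have : Real.cos θ₀ ≤ Real.cos θ := by
      rw [← Real.cos_abs θ]
      apply Real.cos_le_cos_of_nonneg_of_le_pi (abs_nonneg _) (by linarith) hcase.le
    have h5 : Real.cos θ₀ ^ q ≤ Real.cos θ ^ q := by gcongr
    have h6 : 0 < Real.cos θ₀ ^ q := by positivity
    have h7 : 1 + B ≤ (1 + B) / Real.cos θ₀ ^ q * Real.cos θ ^ q := by
      rw [div_mul_eq_mul_div, le_div_iff₀ h6]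
      gcongr
    have := Real.cos_le_one (q * θ)
    nlinarith

def pk (δ x : ℝ) : ℝ := δ / (x ^ 2 + δ ^ 2)
def qk (δ x : ℝ) : ℝ := x / (x ^ 2 + δ ^ 2)

def Fh (f : ℝ → ℝ) (w : ℂ) : ℂ := ∫ y : ℝ, (f y : ℂ) * (Complex.I / (w - y))

lemma im_le_norm_sub (w : ℂ) (y : ℝ) : w.im ≤ ‖w - y‖ := by
  have := Complex.abs_im_le_norm (w - y)
  simp at this
  exact (le_abs_self _).trans this

lemma sub_ne_zero_of_im_pos {w : ℂ} (hw : 0 < w.im) (y : ℝ) : w - y ≠ 0 := by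
  intro h
  have := im_le_norm_sub w y
  rw [h] at this; simp at this; linarith

lemma fh_integrable {f : ℝ → ℝ} (hf : Integrable f) {w : ℂ} (hw : 0 < w.im) :
    Integrable (fun y : ℝ => (f y : ℂ) * (Complex.I / (w - y))) := by
  refine (hf.ofReal (𝕜 := ℂ)).mul_bdd (c := 1 / w.im) ?_ ?_
  · apply Continuous.aestronglyMeasurable
    exact continuous_const.div (by fun_prop) (fun y => sub_ne_zero_of_im_pos hw y)
  · refine Filter.Eventually.of_forall fun y => ?_
    rw [norm_div, Complex.norm_I]
    exact one_div_le_one_div_of_le hw (im_le_norm_sub w y)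

lemma fh_differentiableAt {f : ℝ → ℝ} (hf : Integrable f) {w : ℂ} (hw : 0 < w.im) :
    DifferentiableAt ℂ (Fh f) w := by
  have key : ∀ v ∈ Metric.ball w (w.im / 2), w.im / 2 < v.im := by
    intro v hv
    rw [Metric.mem_ball, dist_eq_norm] at hv
    have := (Complex.abs_im_le_norm (v - w)).trans_lt hv
    rw [Complex.sub_im, abs_lt] at this
    linarith [this.1]
  refine (hasDerivAt_integral_of_dominated_loc_of_deriv_le
    (F := fun (w : ℂ) (y : ℝ) => (f y : ℂ) * (Complex.I / (w - y)))
    (F' := fun (w : ℂ) (y : ℝ) => (f y : ℂ) * (-Complex.I / (w - y) ^ 2))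
    (bound := fun y => |f y| * (1 / (w.im / 2) ^ 2))
    (Metric.ball_mem_nhds w (half_pos hw)) ?_ (fh_integrable hf hw) ?_ ?_ ?_ ?_).2.differentiableAt
  · filter_upwards [Metric.ball_mem_nhds w (half_pos hw)] with v hv
    exact (fh_integrable hf ((half_pos hw).trans (key v hv))).aestronglyMeasurable
  · refine (hf.ofReal (𝕜 := ℂ)).aestronglyMeasurable.mul ?_
    apply Continuous.aestronglyMeasurable
    exact continuous_const.div (by fun_prop) (fun y => pow_ne_zero _ (sub_ne_zero_of_im_pos hw y))
  · refine Filter.Eventually.of_forall fun y v hv => ?_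
    rw [norm_mul, norm_div, norm_neg, Complex.norm_I, norm_pow, Complex.norm_real, Real.norm_eq_abs]
    gcongr
    exact (key v hv).le.trans (im_le_norm_sub v y)
  · exact hf.abs.mul_const _
  · refine Filter.Eventually.of_forall fun y v hv => ?_
    have hne := sub_ne_zero_of_im_pos ((half_pos hw).trans (key v hv)) y
    have h1 : HasDerivAt (fun v : ℂ => v - y) 1 v := (hasDerivAt_id v).sub_const _
    have := ((hasDerivAt_const v Complex.I).div h1 hne).const_mul (f y : ℂ)
    simpa using this

lemma fh_norm_le1 {f : ℝ → ℝ} {R : ℝ} (hf : Integrable f) 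
    (hfR : ∀ y, R < |y| → f y = 0) {w : ℂ} (hw : 0 < w.im) (hwR : 2 * R ≤ ‖w‖) :
    ‖Fh f w‖ ≤ (2 * ∫ y, |f y|) / ‖w‖ := by
  have hw0 : 0 < ‖w‖ := norm_pos_iff.2 (by rintro rfl; simp at hw)
  have : (2 * ∫ y, |f y|) / ‖w‖ = ∫ y, |f y| * (2 / ‖w‖) := by
    rw [integral_mul_const]; ring
  rw [this]
  refine norm_integral_le_of_norm_le (hf.abs.mul_const _) (Filter.Eventually.of_forall fun y => ?_)
  rw [norm_mul, norm_div, Complex.norm_I, Complex.norm_real, Real.norm_eq_abs]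
  by_cases hy : R < |y|
  · simp [hfR y hy]
  · push Not at hy
    refine mul_le_mul_of_nonneg_left ?_ (abs_nonneg _)
    have h1 : ‖w‖ / 2 ≤ ‖w - y‖ := by
      have := norm_sub_norm_le w (y : ℂ)
      rw [Complex.norm_real, Real.norm_eq_abs] at this
      linarith
    rw [div_le_div_iff₀ (by linarith) hw0]
    linarith

lemma fh_re_im {f : ℝ → ℝ} (hf : Integrable f) {x δ : ℝ} (hδ : 0 < δ) :
    (Fh f (x + δ * Complex.I)).re = ∫ y, pk δ (x - y) * f y ∧
    (Fh f (x + δ * Complex.I)).im = ∫ y, qk δ (x - y) * f y := by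
  have hi := fh_integrable hf (w := x + δ * Complex.I) (by simpa using hδ)
  have hden : ∀ y : ℝ, Complex.I / ((x : ℂ) + δ * Complex.I - y) =
      (pk δ (x - y) : ℂ) + (qk δ (x - y) : ℂ) * Complex.I := by
    intro y
    have h1 := sub_ne_zero_of_im_pos (w := x + δ * Complex.I) (by simpa using hδ) y
    have h2 : ((x - y) ^ 2 + δ ^ 2 : ℂ) ≠ 0 := by
      have : (0:ℝ) < (x - y) ^ 2 + δ ^ 2 := by positivity
      exact_mod_cast this.ne'
    rw [div_eq_iff h1, pk, qk]
    push_cast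
    field_simp
    ring_nf
    simp
    ring
  constructor
  · have := integral_re hi
    simp only [RCLike.re_to_complex] at this
    rw [Fh, ← this]
    refine integral_congr_ae (Filter.Eventually.of_forall fun y => ?_)
    simp only [hden]
    simp [mul_comm]
  · have := integral_im hi
    simp only [RCLike.im_to_complex] at this
    rw [Fh, ← this]
    refine integral_congr_ae (Filter.Eventually.of_forall fun y => ?_)
    simp only [hden]
    simp [mul_comm]

lemma mink_lint {α β : Type*} [MeasurableSpace α] [MeasurableSpace β] (μ : Measure β) (ν : Measure α)
    [SFinite μ] [SFinite ν] {q : ℝ} (hq : 1 < q) {c : β → ℝ≥0∞} {F : β → α → ℝ≥0∞}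
    (hc : Measurable c) (hF : Measurable (Function.uncurry F)) {M : ℝ≥0∞}
    (hM : ∀ r, ∫⁻ x, F r x ^ q ∂ν ≤ M) :
    ∫⁻ x, (∫⁻ r, c r * F r x ∂μ) ^ q ∂ν ≤ (∫⁻ r, c r ∂μ) ^ q * M := by
  have hFq : Measurable (Function.uncurry fun x r => c r * F r x ^ q) := by
    have : Measurable fun z : α × β => F z.2 z.1 := hF.comp measurable_swap
    exact (hc.comp measurable_snd).mul (this.pow_const q)
  calc ∫⁻ x, (∫⁻ r, c r * F r x ∂μ) ^ q ∂ν
      ≤ ∫⁻ x, (∫⁻ r, c r ∂μ) ^ (q - 1) * ∫⁻ r, c r * F r x ^ q ∂μ ∂ν := by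
        refine lintegral_mono fun x => jensen_lint μ hq hc.aemeasurable ?_
        exact (hF.comp (measurable_id.prodMk measurable_const)).aemeasurable
    _ = (∫⁻ r, c r ∂μ) ^ (q - 1) * ∫⁻ x, ∫⁻ r, c r * F r x ^ q ∂μ ∂ν := by
        rw [lintegral_const_mul]
        exact hFq.lintegral_prod_right'
    _ = (∫⁻ r, c r ∂μ) ^ (q - 1) * ∫⁻ r, c r * ∫⁻ x, F r x ^ q ∂ν ∂μ := by
        rw [lintegral_lintegral_swap hFq.aemeasurable]
        congr 1
        refine lintegral_congr fun r => ?_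
        rw [lintegral_const_mul]
        exact (hF.comp (measurable_const.prodMk measurable_id)).pow_const q
    _ ≤ (∫⁻ r, c r ∂μ) ^ (q - 1) * ∫⁻ r, c r * M ∂μ := by
        gcongr with r
        exact hM r
    _ = _ := by
        rw [lintegral_mul_const _ hc, ← mul_assoc]
        congr 1
        nth_rewrite 2 [← ENNReal.rpow_one (∫⁻ r, c r ∂μ)]
        rw [← ENNReal.rpow_add_of_nonneg _ _ (by linarith) (by norm_num)]
        congr 1; ring

lemma young_lint {q : ℝ} (hq : 1 < q) {c F : ℝ → ℝ≥0∞} (hc : Measurable c) (hF : Measurable F) :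
    ∫⁻ x, (∫⁻ y, c (x - y) * F y) ^ q ≤ (∫⁻ r, c r) ^ q * ∫⁻ x, F x ^ q := by
  have e : ∀ x, ∫⁻ y, c (x - y) * F y = ∫⁻ r, c r * F (x - r) := by
    intro x
    rw [← lintegral_sub_left_eq_self (fun y => c (x - y) * F y) x]
    simp
  simp only [e]
  refine mink_lint volume volume hq hc (F := fun r x => F (x - r)) ?_ (fun r => ?_)
  · exact hF.comp (measurable_snd.sub measurable_fst)
  · rw [lintegral_sub_right_eq_self (fun x => F x ^ q) r]

lemma pk_nonneg {δ : ℝ} (hδ : 0 < δ) (x : ℝ) : 0 ≤ pk δ x := by unfold pk; positivity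

lemma pk_cont {δ : ℝ} (hδ : 0 < δ) : Continuous (pk δ) := by
  unfold pk
  exact continuous_const.div (by fun_prop) (fun x => by positivity)

lemma qk_cont {δ : ℝ} (hδ : 0 < δ) : Continuous (qk δ) := by
  unfold qk
  exact continuous_id.div (by fun_prop) (fun x => by positivity)

lemma pk_eq {δ : ℝ} (hδ : 0 < δ) : pk δ = fun x => δ⁻¹ * (1 + (x / δ) ^ 2)⁻¹ := by
  ext x; unfold pk
  have : 0 < x ^ 2 + δ ^ 2 := by positivity
  field_simp
  ring

lemma pk_integrable {δ : ℝ} (hδ : 0 < δ) : Integrable (pk δ) := by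
  rw [pk_eq hδ]
  exact (integrable_inv_one_add_sq.comp_div hδ.ne').const_mul _

lemma pk_integral {δ : ℝ} (hδ : 0 < δ) : ∫ x, pk δ x = π := by
  rw [pk_eq hδ, integral_const_mul, Measure.integral_comp_div (fun x : ℝ => (1 + x ^ 2)⁻¹) δ,
    integral_univ_inv_one_add_sq, abs_of_pos hδ, smul_eq_mul]
  field_simp

lemma pk_lint {δ : ℝ} (hδ : 0 < δ) : ∫⁻ x, ENNReal.ofReal (pk δ x) = ENNReal.ofReal π := by
  rw [← pk_integral hδ, ofReal_integral_eq_lintegral_ofReal (pk_integrable hδ)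
    (Filter.Eventually.of_forall (pk_nonneg hδ))]

lemma pk_le {δ : ℝ} (hδ : 0 < δ) (x : ℝ) : pk δ x ≤ 1 / δ := by
  unfold pk
  rw [div_le_div_iff₀ (by positivity) hδ]
  nlinarith [sq_nonneg x]

lemma qk_le {δ : ℝ} (hδ : 0 < δ) (x : ℝ) : |qk δ x| ≤ 1 / δ := by
  unfold qk
  rw [abs_div, abs_of_pos (show 0 < x ^ 2 + δ ^ 2 by positivity),
    div_le_div_iff₀ (by positivity) hδ, ← sq_abs x]
  nlinarith [sq_nonneg (|x| - δ), abs_nonneg x, sq_nonneg (|x|), sq_nonneg δ]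

lemma fh_pow_bound {q : ℝ} (hq : 1 < q) {f : ℝ → ℝ} {R δ T : ℝ} (hδ : 0 < δ) (hf : Integrable f)
    (hfR : ∀ y, R < |y| → f y = 0) (hpos : ∀ w : ℂ, 0 < w.im → 0 < (Fh f w).re)
    (hT : 0 < T) (hTR : 2 * R ≤ T) (hTδ : δ ≤ T) :
    ‖∫ x in (-T)..T, (Fh f (x + δ * Complex.I)) ^ (q : ℂ)‖ ≤
      4 * T * ((2 * ∫ y, |f y|) / T) ^ q := by
  set m := ∫ y, |f y| with hm
  have hm0 : 0 ≤ m := integral_nonneg fun y => abs_nonneg _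
  set K := ((2 * m) / T) ^ q with hK
  have bd : ∀ w : ℂ, 0 < w.im → T ≤ ‖w‖ → ‖(Fh f w) ^ (q : ℂ)‖ ≤ K := by
    intro w hw hwT
    rw [Complex.norm_cpow_real, hK]
    refine Real.rpow_le_rpow (norm_nonneg _) ?_ (by linarith)
    refine (fh_norm_le1 hf hfR hw (hTR.trans hwT)).trans ?_
    gcongr
  have hdiff : DifferentiableOn ℂ (fun w => (Fh f w) ^ (q : ℂ))
      (uIcc (-T + δ * Complex.I : ℂ).re (T + T * Complex.I : ℂ).re ×ℂ
        uIcc (-T + δ * Complex.I : ℂ).im (T + T * Complex.I : ℂ).im) := by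
    intro w hw
    have him : 0 < w.im := by
      have := hw.2
      simp [uIcc_of_le hTδ] at this
      linarith [this.1]
    exact ((fh_differentiableAt hf him).cpow_const (Or.inl (hpos w him))).differentiableWithinAt
  have h := Complex.integral_boundary_rect_eq_zero_of_differentiableOn _ _ _ hdiff
  simp at h
  have e : (∫ x in (-T)..T, (Fh f (x + δ * Complex.I)) ^ (q : ℂ)) =
      (∫ x in (-T)..T, (Fh f (x + T * Complex.I)) ^ (q : ℂ))
      - Complex.I * (∫ y in δ..T, (Fh f (T + y * Complex.I)) ^ (q : ℂ))
      + Complex.I * (∫ y in δ..T, (Fh f (-T + y * Complex.I)) ^ (q : ℂ)) := by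
    linear_combination h
  rw [e]
  have b1 : ‖∫ x in (-T)..T, (Fh f (x + T * Complex.I)) ^ (q : ℂ)‖ ≤ K * |T - -T| := by
    refine intervalIntegral.norm_integral_le_of_norm_le_const fun x _ => bd _ (by simpa using hT) ?_
    have := Complex.abs_im_le_norm (x + T * Complex.I)
    simp at this; exact (le_abs_self _).trans this
  have b2 : ‖Complex.I * ∫ y in δ..T, (Fh f (T + y * Complex.I)) ^ (q : ℂ)‖ ≤ K * |T - δ| := by
    rw [norm_mul, Complex.norm_I, one_mul]
    refine intervalIntegral.norm_integral_le_of_norm_le_const fun y hy => bd _ ?_ ?_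
    · rw [uIoc_of_le hTδ] at hy; simp; linarith [hy.1]
    · have := Complex.abs_re_le_norm (T + y * Complex.I)
      simp at this; exact (le_abs_self _).trans this
  have b3 : ‖Complex.I * ∫ y in δ..T, (Fh f (-T + y * Complex.I)) ^ (q : ℂ)‖ ≤ K * |T - δ| := by
    rw [norm_mul, Complex.norm_I, one_mul]
    refine intervalIntegral.norm_integral_le_of_norm_le_const fun y hy => bd _ ?_ ?_
    · rw [uIoc_of_le hTδ] at hy; simp; linarith [hy.1]
    · have := Complex.abs_re_le_norm (-T + y * Complex.I)
      simp at this; exact (le_abs_self _).trans this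
  have hK0 : 0 ≤ K := by positivity
  rw [abs_of_nonneg (by linarith)] at b1 b2 b3
  refine (norm_add_le _ _).trans ((add_le_add ((norm_sub_le _ _).trans (add_le_add b1 b2)) b3).trans ?_)
  nlinarith

lemma qk_pos_lint {q A B : ℝ} (hq : 1 < q) (hA : 0 ≤ A) (hB : 0 ≤ B)
    (hAB : ∀ w : ℂ, 0 ≤ w.re → |w.im| ^ q ≤ A * w.re ^ q - B * ((w ^ (q : ℂ)).re))
    {f : ℝ → ℝ} {R δ : ℝ} (hδ : 0 < δ) (hf : Integrable f) (hf0 : ∀ y, 0 ≤ f y)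
    (hfR : ∀ y, R < |y| → f y = 0) :
    ∫⁻ x, ‖∫ y, qk δ (x - y) * f y‖ₑ ^ q ≤
      ENNReal.ofReal A * ∫⁻ x, ‖∫ y, pk δ (x - y) * f y‖ₑ ^ q := by
  have hq0 : 0 < q := by linarith
  by_cases hz : ∫ y, f y = 0
  · rw [integral_eq_zero_iff_of_nonneg hf0 hf] at hz
    have : ∀ x, ∫ y, qk δ (x - y) * f y = 0 := by
      intro x
      rw [integral_eq_zero_of_ae]
      filter_upwards [hz] with y hy
      simp [hy]
    simp [this, hq0]
  have hfpos : 0 < ∫ y, f y := lt_of_le_of_ne (integral_nonneg hf0) (Ne.symm hz)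
  have hpos : ∀ w : ℂ, 0 < w.im → 0 < (Fh f w).re := by
    intro w hw
    have := (fh_re_im hf (x := w.re) hw).1
    rw [Complex.re_add_im] at this
    rw [this]
    have hi : Integrable fun y => pk w.im (w.re - y) * f y := by
      refine hf.bdd_mul (c := 1 / w.im) ?_ ?_
      · exact ((pk_cont hw).comp (by fun_prop)).aestronglyMeasurable
      · refine Filter.Eventually.of_forall fun y => ?_
        rw [Real.norm_eq_abs, abs_of_nonneg (pk_nonneg hw _)]
        exact pk_le hw _
    rw [integral_pos_iff_support_of_nonneg (fun y => mul_nonneg (pk_nonneg hw _) (hf0 y)) hi]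
    rw [integral_pos_iff_support_of_nonneg hf0 hf] at hfpos
    convert hfpos using 2
    ext y
    have : pk w.im (w.re - y) ≠ 0 := by
      unfold pk; positivity
    simp [this]
  set G : ℝ → ℂ := fun x => Fh f (x + δ * Complex.I) with hG
  have him : ∀ x : ℝ, 0 < ((x : ℂ) + δ * Complex.I).im := fun x => by simpa using hδ
  have hGc : Continuous G := by
    rw [continuous_iff_continuousAt]
    intro x
    exact ContinuousAt.comp (f := fun x : ℝ => (x : ℂ) + δ * Complex.I)
      (fh_differentiableAt hf (him x)).continuousAt (by fun_prop)
  have hGq : Continuous fun x => G x ^ (q : ℂ) := by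
    rw [continuous_iff_continuousAt]
    intro x
    exact (hGc.continuousAt).cpow continuousAt_const (Or.inl (hpos _ (him x)))
  have hGre : ∀ x, (G x).re = ∫ y, pk δ (x - y) * f y := fun x => (fh_re_im hf hδ).1
  have hGim : ∀ x, (G x).im = ∫ y, qk δ (x - y) * f y := fun x => (fh_re_im hf hδ).2
  simp only [← hGre, ← hGim]
  set m := ∫ y, |f y|
  have hfin : ∀ T : ℝ, 0 < T → 2 * R ≤ T → δ ≤ T →
      ∫⁻ x in Icc (-T) T, ‖(G x).im‖ₑ ^ q ≤ ENNReal.ofReal A * (∫⁻ x, ‖(G x).re‖ₑ ^ q)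
        + ENNReal.ofReal (B * (4 * T * ((2 * m) / T) ^ q)) := by
    intro T hT hTR hTδ
    have hle := fh_pow_bound hq hδ hf hfR hpos hT hTR hTδ
    have e1 : ∀ x, ‖(G x).im‖ₑ ^ q = ENNReal.ofReal (|(G x).im| ^ q) := by
      intro x
      rw [← Real.norm_eq_abs, ← ENNReal.ofReal_rpow_of_nonneg (norm_nonneg _) hq0.le, ofReal_norm]
    have e2 : ∀ x, ‖(G x).re‖ₑ ^ q = ENNReal.ofReal ((G x).re ^ q) := by
      intro x
      rw [← ENNReal.ofReal_rpow_of_nonneg (hpos _ (him x)).le hq0.le, Real.enorm_of_nonneg (hpos _ (him x)).le]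
    have c1 : Continuous fun x => |(G x).im| ^ q :=
      ((Complex.continuous_im.comp hGc).abs).rpow_const (fun _ => Or.inr hq0.le)
    have c2 : Continuous fun x => (G x).re ^ q :=
      ((Complex.continuous_re.comp hGc)).rpow_const (fun _ => Or.inr hq0.le)
    have c3 : Continuous fun x => (G x ^ (q : ℂ)).re := Complex.continuous_re.comp hGq
    simp only [e1, e2]
    rw [← ofReal_integral_eq_lintegral_ofReal (c1.integrableOn_Icc)
      (Filter.Eventually.of_forall fun x => by positivity)]
    have hr : ∫ x in Icc (-T) T, |(G x).im| ^ q ≤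
        A * (∫ x in Icc (-T) T, (G x).re ^ q) + B * (4 * T * ((2 * m) / T) ^ q) := by
      calc ∫ x in Icc (-T) T, |(G x).im| ^ q
          ≤ ∫ x in Icc (-T) T, (A * (G x).re ^ q - B * (G x ^ (q : ℂ)).re) := by
            refine integral_mono c1.integrableOn_Icc (Continuous.integrableOn_Icc (by fun_prop)) ?_
            intro x
            exact hAB _ (hpos _ (him x)).le
        _ = A * (∫ x in Icc (-T) T, (G x).re ^ q) - B * ∫ x in Icc (-T) T, (G x ^ (q : ℂ)).re := by
            rw [integral_sub (c2.integrableOn_Icc.const_mul _) (c3.integrableOn_Icc.const_mul _),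
              integral_const_mul, integral_const_mul]
        _ ≤ _ := by
            have : |∫ x in Icc (-T) T, (G x ^ (q : ℂ)).re| ≤ 4 * T * ((2 * m) / T) ^ q := by
              have h1 := integral_re (hGq.integrableOn_Icc (μ := volume) (a := -T) (b := T))
              simp only [RCLike.re_to_complex] at h1
              rw [h1]
              refine (Complex.abs_re_le_norm _).trans ?_
              rw [integral_Icc_eq_integral_Ioc, ← intervalIntegral.integral_of_le (by linarith)]
              exact hle
            have h2 := abs_le.1 this
            nlinarith [mul_le_mul_of_nonneg_left h2.1 hB]
    refine (ENNReal.ofReal_le_ofReal hr).trans ?_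
    refine ENNReal.ofReal_add_le.trans ?_
    gcongr
    rw [ENNReal.ofReal_mul hA]
    gcongr
    rw [ofReal_integral_eq_lintegral_ofReal (c2.integrableOn_Icc)
      (Filter.Eventually.of_forall fun x => Real.rpow_nonneg (hpos _ (him x)).le _)]
    exact setLIntegral_le_lintegral _ _
  have t1 := (aecover_Icc (μ := volume) (Filter.tendsto_neg_atTop_atBot (G := ℝ))
    (Filter.tendsto_id (α := ℝ))).lintegral_tendsto_of_countably_generated
    (f := fun x => ‖(G x).im‖ₑ ^ q)
    ((Complex.continuous_im.comp hGc).measurable.enorm.pow_const q).aemeasurable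
  have t2 : Filter.Tendsto (fun T : ℝ => ENNReal.ofReal A * (∫⁻ x, ‖(G x).re‖ₑ ^ q)
        + ENNReal.ofReal (B * (4 * T * ((2 * m) / T) ^ q))) Filter.atTop
        (nhds (ENNReal.ofReal A * (∫⁻ x, ‖(G x).re‖ₑ ^ q) + ENNReal.ofReal 0)) := by
    refine Filter.Tendsto.add tendsto_const_nhds (ENNReal.tendsto_ofReal ?_)
    have hm0 : 0 ≤ m := integral_nonneg fun y => abs_nonneg _
    have h3 : Filter.Tendsto (fun T : ℝ => (B * 4 * (2 * m) ^ q) * T ^ (-(q - 1)))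
        Filter.atTop (nhds ((B * 4 * (2 * m) ^ q) * 0)) :=
      (tendsto_rpow_neg_atTop (by linarith)).const_mul _
    rw [mul_zero] at h3
    refine h3.congr' ?_
    filter_upwards [Filter.eventually_gt_atTop 0] with T hT
    rw [Real.div_rpow (by positivity) hT.le, neg_sub, Real.rpow_sub hT, Real.rpow_one]
    ring
  simp only [ENNReal.ofReal_zero, add_zero] at t2
  refine le_of_tendsto_of_tendsto t1 t2 ?_
  filter_upwards [Filter.eventually_gt_atTop 0, Filter.eventually_ge_atTop (2 * R),
    Filter.eventually_ge_atTop δ] with T h1 h2 h3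
  exact hfin T h1 h2 h3

lemma conv_young {E : Type*} [NormedAddCommGroup E] [NormedSpace ℝ E] [MeasurableSpace E]
    [OpensMeasurableSpace E] {q : ℝ} (hq : 1 < q)
    {k : ℝ → ℝ} {f : ℝ → E} (hk : Measurable k) (hf : Measurable f) :
    ∫⁻ x, ‖∫ y, k (x - y) • f y‖ₑ ^ q ≤ (∫⁻ r, ‖k r‖ₑ) ^ q * ∫⁻ x, ‖f x‖ₑ ^ q := by
  refine le_trans ?_ (young_lint hq hk.enorm hf.enorm)
  refine lintegral_mono fun x => ENNReal.rpow_le_rpow ?_ (by linarith)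
  refine (enorm_integral_le_lintegral_enorm _).trans (lintegral_mono fun y => ?_)
  rw [enorm_smul]

lemma add_pow_lint {α : Type*} [MeasurableSpace α] {μ : Measure α} {q : ℝ} (hq : 1 < q)
    {F G : α → ℝ≥0∞} (hF : AEMeasurable F μ) :
    ∫⁻ x, (F x + G x) ^ q ∂μ ≤ 2 ^ (q - 1) * (∫⁻ x, F x ^ q ∂μ + ∫⁻ x, G x ^ q ∂μ) := by
  rw [← lintegral_add_left' (hF.pow_const q), ← lintegral_const_mul' _ _ (by
    exact ENNReal.rpow_ne_top_of_nonneg (by linarith) (by norm_num))]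
  exact lintegral_mono fun x => ENNReal.rpow_add_le_mul_rpow_add_rpow _ _ hq.le

structure BCm {E : Type*} [NormedAddCommGroup E] [MeasurableSpace E] (f : ℝ → E) : Prop where
  meas : Measurable f
  bdd : ∃ M, ∀ x, ‖f x‖ ≤ M
  supp : ∃ R, ∀ x, R < |x| → f x = 0

lemma BCm.integrable {E : Type*} [NormedAddCommGroup E] [MeasurableSpace E] [BorelSpace E]
    [SecondCountableTopology E] {f : ℝ → E} (hf : BCm f) : Integrable f := by
  obtain ⟨M, hM⟩ := hf.bdd
  obtain ⟨R, hR⟩ := hf.supp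
  have : f = indicator (Icc (-R) R) f := by
    ext x
    by_cases hx : x ∈ Icc (-R) R
    · rw [indicator_of_mem hx]
    · rw [indicator_of_notMem hx]
      apply hR
      by_contra h
      push Not at h
      exact hx (abs_le.1 h)
  rw [this, integrable_indicator_iff measurableSet_Icc]
  exact Measure.integrableOn_of_bounded (M := M) (by simp) hf.meas.aestronglyMeasurable
    (Filter.Eventually.of_forall hM)

lemma qk_smul_integrable {E : Type*} [NormedAddCommGroup E] [NormedSpace ℝ E] {δ : ℝ} (hδ : 0 < δ)
    {f : ℝ → E} (hf : Integrable f) (x : ℝ) : Integrable fun y => qk δ (x - y) • f y := by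
  refine hf.bdd_smul (C := 1 / δ) ?_ ?_
  · exact ((qk_cont hδ).comp (by fun_prop)).aestronglyMeasurable
  · exact Filter.Eventually.of_forall fun y => by rw [Real.norm_eq_abs]; exact qk_le hδ _

lemma qk_conv_cont {E : Type*} [NormedAddCommGroup E] [NormedSpace ℝ E] {δ : ℝ} (hδ : 0 < δ)
    {f : ℝ → E} (hf : Integrable f) : Continuous fun x => ∫ y, qk δ (x - y) • f y := by
  refine continuous_of_dominated (bound := fun y => 1 / δ * ‖f y‖) ?_ ?_ (hf.norm.const_mul _) ?_
  · exact fun x => (qk_smul_integrable hδ hf x).aestronglyMeasurable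
  · intro x
    refine Filter.Eventually.of_forall fun y => ?_
    rw [norm_smul, Real.norm_eq_abs]
    exact mul_le_mul_of_nonneg_right (qk_le hδ _) (norm_nonneg _)
  · refine Filter.Eventually.of_forall fun y => ?_
    exact ((qk_cont hδ).comp (by fun_prop)).smul continuous_const

lemma qk_small {q : ℝ} (hq : 1 < q) (hq2 : q ≤ 2) : ∃ C : ℝ≥0∞, C ≠ ⊤ ∧ ∀ δ > 0, ∀ f : ℝ → ℝ,
    BCm f → ∫⁻ x, ‖∫ y, qk δ (x - y) • f y‖ₑ ^ q ≤ C * ∫⁻ x, ‖f x‖ₑ ^ q := by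
  obtain ⟨A, B, hA, hB, hAB⟩ := pich_ineq hq hq2
  have hq0 : 0 < q := by linarith
  set C1 := ENNReal.ofReal A * ENNReal.ofReal π ^ q with hC1
  have hC1t : C1 ≠ ⊤ := ENNReal.mul_ne_top (by simp) (ENNReal.rpow_ne_top_of_nonneg hq0.le (by simp))
  have key : ∀ δ > 0, ∀ f : ℝ → ℝ, BCm f → (∀ y, 0 ≤ f y) →
      ∫⁻ x, ‖∫ y, qk δ (x - y) • f y‖ₑ ^ q ≤ C1 * ∫⁻ x, ‖f x‖ₑ ^ q := by
    intro δ hδ f hf hf0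
    obtain ⟨R, hR⟩ := hf.supp
    refine (qk_pos_lint hq hA hB hAB hδ hf.integrable hf0 hR).trans ?_
    rw [hC1, mul_assoc]
    gcongr
    have := conv_young hq (pk_cont hδ).measurable hf.meas
    have e : ∫⁻ r, ‖pk δ r‖ₑ = ENNReal.ofReal π := by
      rw [← pk_lint hδ]
      exact lintegral_congr fun r => Real.enorm_of_nonneg (pk_nonneg hδ r)
    rw [e] at this
    exact this
  refine ⟨2 ^ (q - 1) * (C1 + C1), ?_, ?_⟩
  · refine ENNReal.mul_ne_top (ENNReal.rpow_ne_top_of_nonneg (by linarith) (by norm_num)) ?_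
    simp [hC1t]
  intro δ hδ f hf
  obtain ⟨M, hM⟩ := hf.bdd
  obtain ⟨R, hR⟩ := hf.supp
  have hp : BCm (fun x => max (f x) 0) := by
    refine ⟨hf.meas.max measurable_const, ⟨M, fun x => ?_⟩, ⟨R, fun x hx => by simp [hR x hx]⟩⟩
    refine le_trans ?_ (hM x)
    rw [Real.norm_eq_abs, Real.norm_eq_abs, abs_of_nonneg (le_max_right _ _)]
    exact max_le (le_abs_self _) (abs_nonneg _)
  have hn : BCm (fun x => max (-f x) 0) := by
    refine ⟨hf.meas.neg.max measurable_const, ⟨M, fun x => ?_⟩, ⟨R, fun x hx => by simp [hR x hx]⟩⟩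
    refine le_trans ?_ (hM x)
    rw [Real.norm_eq_abs, Real.norm_eq_abs, abs_of_nonneg (le_max_right _ _)]
    exact max_le (neg_le_abs _) (abs_nonneg _)
  have e : ∀ x, ∫ y, qk δ (x - y) • f y = (∫ y, qk δ (x - y) • max (f y) 0) -
      ∫ y, qk δ (x - y) • max (-f y) 0 := by
    intro x
    rw [← integral_sub (qk_smul_integrable hδ hp.integrable x)
      (qk_smul_integrable hδ hn.integrable x)]
    refine integral_congr_ae (Filter.Eventually.of_forall fun y => ?_)
    simp only [← smul_sub]
    congr 1
    rcases le_total 0 (f y) with h | h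
    · rw [max_eq_left h, max_eq_right (by linarith)]; ring
    · rw [max_eq_right h, max_eq_left (by linarith)]; ring
  calc ∫⁻ x, ‖∫ y, qk δ (x - y) • f y‖ₑ ^ q
      ≤ ∫⁻ x, (‖∫ y, qk δ (x - y) • max (f y) 0‖ₑ + ‖∫ y, qk δ (x - y) • max (-f y) 0‖ₑ) ^ q := by
        refine lintegral_mono fun x => ENNReal.rpow_le_rpow ?_ hq0.le
        rw [e]; exact enorm_sub_le
    _ ≤ 2 ^ (q - 1) * ((∫⁻ x, ‖∫ y, qk δ (x - y) • max (f y) 0‖ₑ ^ q) +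
          ∫⁻ x, ‖∫ y, qk δ (x - y) • max (-f y) 0‖ₑ ^ q) :=
        add_pow_lint hq ((qk_conv_cont hδ hp.integrable).measurable.enorm.aemeasurable)
    _ ≤ 2 ^ (q - 1) * (C1 * (∫⁻ x, ‖f x‖ₑ ^ q) + C1 * ∫⁻ x, ‖f x‖ₑ ^ q) := by
        gcongr
        · refine (key δ hδ _ hp fun y => le_max_right _ _).trans ?_
          gcongr with x
          refine enorm_le_iff_norm_le.2 ?_
          rw [Real.norm_eq_abs, Real.norm_eq_abs, abs_of_nonneg (le_max_right _ _)]
          exact max_le (le_abs_self _) (abs_nonneg _)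
        · refine (key δ hδ _ hn fun y => le_max_right _ _).trans ?_
          gcongr with x
          refine enorm_le_iff_norm_le.2 ?_
          rw [Real.norm_eq_abs, Real.norm_eq_abs, abs_of_nonneg (le_max_right _ _)]
          exact max_le (neg_le_abs _) (abs_nonneg _)
    _ = _ := by ring

lemma qk_conv_bdd {δ : ℝ} (hδ : 0 < δ) {f : ℝ → ℝ} (hf : Integrable f) (x : ℝ) :
    |∫ y, qk δ (x - y) • f y| ≤ 1 / δ * ∫ y, |f y| := by
  rw [← integral_const_mul, ← Real.norm_eq_abs]
  refine norm_integral_le_of_norm_le (hf.abs.const_mul _) (Filter.Eventually.of_forall fun y => ?_)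
  rw [norm_smul, Real.norm_eq_abs]
  exact mul_le_mul_of_nonneg_right (qk_le hδ _) (norm_nonneg _)

lemma qk_swap {δ : ℝ} (hδ : 0 < δ) {f h : ℝ → ℝ} (hf : BCm f) (hh : BCm h) :
    ∫ x, f x * ∫ y, qk δ (x - y) • h y = - ∫ y, (∫ x, qk δ (y - x) • f x) * h y := by
  have e1 : ∀ x, f x * (∫ y, qk δ (x - y) • h y) = ∫ y, f x * (qk δ (x - y) * h y) := by
    intro x; rw [integral_const_mul]; rfl
  have e2 : ∀ y, (∫ x, qk δ (y - x) • f x) * h y = -∫ x, f x * (qk δ (x - y) * h y) := by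
    intro y; rw [← integral_mul_const, ← integral_neg]
    refine integral_congr_ae (Filter.Eventually.of_forall fun x => ?_)
    have : qk δ (y - x) = - qk δ (x - y) := by unfold qk; rw [← neg_sub]; ring
    simp only [this, smul_eq_mul]; ring
  simp only [e1, e2]
  rw [integral_neg, neg_neg, integral_integral_swap]
  have : (Function.uncurry fun x y => f x * (qk δ (x - y) * h y)) =
      fun z : ℝ × ℝ => (qk δ (z.1 - z.2)) * (f z.1 * h z.2) := by
    ext z; simp [Function.uncurry]; ring
  rw [this]
  refine (hf.integrable.mul_prod hh.integrable).bdd_mul (c := 1 / δ) ?_ ?_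
  · exact ((qk_cont hδ).comp (by fun_prop)).aestronglyMeasurable
  · exact Filter.Eventually.of_forall fun y => by rw [Real.norm_eq_abs]; exact qk_le hδ _

lemma qk_large {q : ℝ} (hq2 : 2 < q) : ∃ C : ℝ≥0∞, C ≠ ⊤ ∧ ∀ δ > 0, ∀ f : ℝ → ℝ,
    BCm f → ∫⁻ x, ‖∫ y, qk δ (x - y) • f y‖ₑ ^ q ≤ C * ∫⁻ x, ‖f x‖ₑ ^ q := by
  have hq : 1 < q := by linarith
  have hq0 : 0 < q := by linarith
  have hpq : q.HolderConjugate (Real.conjExponent q) := Real.HolderConjugate.conjExponent hq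
  set p := Real.conjExponent q with hp
  have hp1 : 1 < p := hpq.symm.lt
  have hp2 : p ≤ 2 := by
    rw [hp, Real.conjExponent, div_le_iff₀ (by linarith)]; linarith
  have hp0 : 0 < p := by linarith
  obtain ⟨C, hC, hCb⟩ := qk_small hp1 hp2
  refine ⟨(C ^ (1 / p)) ^ q, by
    exact ENNReal.rpow_ne_top_of_nonneg hq0.le (ENNReal.rpow_ne_top_of_nonneg (by positivity) hC), ?_⟩
  intro δ hδ h hh
  set Q : ℝ → ℝ := fun x => ∫ y, qk δ (x - y) • h y with hQ
  have hQc : Continuous Q := qk_conv_cont hδ hh.integrable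
  have main : ∀ T : ℝ, ∫⁻ x in Icc (-T) T, ‖Q x‖ₑ ^ q ≤ (C ^ (1 / p)) ^ q * ∫⁻ x, ‖h x‖ₑ ^ q := by
    intro T
    set f : ℝ → ℝ := indicator (Icc (-T) T) fun x => SignType.sign (Q x) * |Q x| ^ (q - 1) with hf
    set X := ∫⁻ x in Icc (-T) T, ‖Q x‖ₑ ^ q with hX
    have hXt : X ≠ ⊤ := by
      refine ne_of_lt ?_
      have c1 : Continuous fun x => |Q x| ^ q := hQc.abs.rpow_const (fun _ => Or.inr hq0.le)
      have := (c1.integrableOn_Icc (μ := volume) (a := -T) (b := T)).2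
      rw [hX]
      refine lt_of_le_of_lt (lintegral_mono fun x => ?_) this
      show _ ≤ ‖|Q x| ^ q‖ₑ
      rw [Real.enorm_of_nonneg (show 0 ≤ |Q x| ^ q by positivity),
        ← ENNReal.ofReal_rpow_of_nonneg (abs_nonneg _) hq0.le, ← Real.norm_eq_abs, ofReal_norm]
    have hsgn : ∀ x, ‖((SignType.sign (Q x) : ℝ) * |Q x| ^ (q - 1))‖ = |Q x| ^ (q - 1) := by
      intro x
      rw [norm_mul, Real.norm_eq_abs, Real.norm_eq_abs, abs_of_nonneg (by positivity : 0 ≤ |Q x| ^ (q-1))]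
      rcases lt_trichotomy (Q x) 0 with h | h | h
      · rw [sign_neg h]; simp
      · rw [h]; simp; rw [Real.zero_rpow (by linarith)]
      · rw [sign_pos h]; simp
    have hfm : Measurable f := by
      refine Measurable.indicator ?_ measurableSet_Icc
      have h1 : Measurable fun x => (SignType.sign (Q x) : ℝ) := by
        have : (fun x => (SignType.sign (Q x) : ℝ)) = fun x => if 0 < Q x then 1 else if Q x < 0 then -1 else 0 := by
          ext x
          rcases lt_trichotomy (Q x) 0 with h | h | h
          · simp [sign_neg h, h, h.le, not_lt.2 h.le]
          · simp [h]
          · simp [sign_pos h, h]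
        rw [this]
        refine Measurable.ite (measurableSet_lt measurable_const hQc.measurable) measurable_const ?_
        exact Measurable.ite (measurableSet_lt hQc.measurable measurable_const) measurable_const measurable_const
      exact h1.mul ((hQc.abs.measurable).pow_const _)
    have hfB : BCm f := by
      refine ⟨hfm, ⟨(1 / δ * ∫ y, |h y|) ^ (q - 1), fun x => ?_⟩, ⟨T, fun x hx => ?_⟩⟩
      · refine (norm_indicator_le_norm_self _ _).trans ?_
        rw [hsgn]
        exact Real.rpow_le_rpow (abs_nonneg _) (qk_conv_bdd hδ hh.integrable x) (by linarith)
      · rw [hf, indicator_of_notMem]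
        intro hx'
        have := abs_le.2 hx'
        linarith
    have hfp : ∫⁻ x, ‖f x‖ₑ ^ p = X := by
      rw [hX, ← lintegral_indicator measurableSet_Icc]
      refine lintegral_congr fun x => ?_
      by_cases hx : x ∈ Icc (-T) T
      · rw [hf, indicator_of_mem hx, indicator_of_mem hx, ← ofReal_norm, hsgn, ← ofReal_norm,
          ENNReal.ofReal_rpow_of_nonneg (by positivity) hp0.le,
          ENNReal.ofReal_rpow_of_nonneg (by positivity) hq0.le, ← Real.rpow_mul (abs_nonneg _),
          Real.norm_eq_abs]
        congr 2
        exact hpq.sub_one_mul_conj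
      · rw [hf, indicator_of_notMem hx, indicator_of_notMem hx]; simp [hp0]
    have hXeq : X = ENNReal.ofReal (∫ x, f x * Q x) := by
      have e : ∀ x, f x * Q x = indicator (Icc (-T) T) (fun x => |Q x| ^ q) x := by
        intro x
        by_cases hx : x ∈ Icc (-T) T
        · rw [hf, indicator_of_mem hx, indicator_of_mem hx]
          have : (SignType.sign (Q x) : ℝ) * |Q x| ^ (q - 1) * Q x = |Q x| ^ (q - 1) * |Q x| := by
            rw [mul_right_comm]
            have := sign_mul_self (Q x)
            rw [this]; ring
          rw [this]
          by_cases hz : Q x = 0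
          · simp [hz, hq0.ne']
          · rw [← Real.rpow_add_one (abs_pos.2 hz).ne']; congr 1; ring
        · rw [hf, indicator_of_notMem hx, indicator_of_notMem hx]; simp
      simp only [e]
      have c1 : Continuous fun x => |Q x| ^ q := hQc.abs.rpow_const (fun _ => Or.inr hq0.le)
      rw [integral_indicator measurableSet_Icc, ofReal_integral_eq_lintegral_ofReal c1.integrableOn_Icc
        (Filter.Eventually.of_forall fun x => by positivity)]
      refine lintegral_congr fun x => ?_
      rw [← ENNReal.ofReal_rpow_of_nonneg (abs_nonneg _) hq0.le, ← Real.norm_eq_abs, ofReal_norm]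
    have hle : X ≤ (C ^ (1 / p) * X ^ (1 / p)) * (∫⁻ x, ‖h x‖ₑ ^ q) ^ (1 / q) := by
      calc X = ENNReal.ofReal (∫ x, f x * Q x) := hXeq
        _ = ENNReal.ofReal (- ∫ y, (∫ x, qk δ (y - x) • f x) * h y) := by rw [hQ, qk_swap hδ hfB hh]
        _ ≤ ‖- ∫ y, (∫ x, qk δ (y - x) • f x) * h y‖ₑ := by
            rw [← ofReal_norm]; exact ENNReal.ofReal_le_ofReal (le_abs_self _)
        _ ≤ ∫⁻ y, ‖∫ x, qk δ (y - x) • f x‖ₑ * ‖h y‖ₑ := by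
            rw [enorm_neg]
            refine (enorm_integral_le_lintegral_enorm _).trans (lintegral_mono fun y => ?_)
            rw [enorm_mul]
        _ ≤ (∫⁻ y, ‖∫ x, qk δ (y - x) • f x‖ₑ ^ p) ^ (1 / p) * (∫⁻ x, ‖h x‖ₑ ^ q) ^ (1 / q) :=
            ENNReal.lintegral_mul_le_Lp_mul_Lq _ hpq.symm
              (qk_conv_cont hδ hfB.integrable).measurable.enorm.aemeasurable
              hh.meas.enorm.aemeasurable
        _ ≤ (C * X) ^ (1 / p) * (∫⁻ x, ‖h x‖ₑ ^ q) ^ (1 / q) := by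
            gcongr
            rw [← hfp]
            exact hCb δ hδ f hfB
        _ = _ := by rw [ENNReal.mul_rpow_of_nonneg _ _ (by positivity)]
    by_cases hX0 : X = 0
    · rw [hX0]; exact zero_le
    have h1 : X ^ (1 / q) ≤ C ^ (1 / p) * (∫⁻ x, ‖h x‖ₑ ^ q) ^ (1 / q) := by
      have hXp0 : X ^ (1 / p) ≠ 0 := by
        simp [ENNReal.rpow_eq_zero_iff, hX0, hXt]
      have hXpt : X ^ (1 / p) ≠ ⊤ := ENNReal.rpow_ne_top_of_nonneg (by positivity) hXt
      rw [← ENNReal.mul_le_mul_iff_right hXp0 hXpt]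
      calc X ^ (1 / p) * X ^ (1 / q) = X := by
            rw [← ENNReal.rpow_add _ _ hX0 hXt, one_div, one_div, hpq.symm.inv_add_inv_eq_one, ENNReal.rpow_one]
        _ ≤ _ := hle
        _ = _ := by ring
    calc X = (X ^ (1 / q)) ^ q := by
          rw [← ENNReal.rpow_mul, one_div, inv_mul_cancel₀ hq0.ne', ENNReal.rpow_one]
      _ ≤ (C ^ (1 / p) * (∫⁻ x, ‖h x‖ₑ ^ q) ^ (1 / q)) ^ q := by gcongr
      _ = _ := by
        rw [ENNReal.mul_rpow_of_nonneg _ _ hq0.le, ← ENNReal.rpow_mul (∫⁻ x, ‖h x‖ₑ ^ q),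
          one_div q, inv_mul_cancel₀ hq0.ne', ENNReal.rpow_one]
  have t1 := (aecover_Icc (μ := volume) (Filter.tendsto_neg_atTop_atBot (G := ℝ))
    (Filter.tendsto_id (α := ℝ))).lintegral_tendsto_of_countably_generated
    (f := fun x => ‖Q x‖ₑ ^ q) (hQc.measurable.enorm.pow_const q).aemeasurable
  exact le_of_tendsto t1 (Filter.Eventually.of_forall main)

lemma qk_real {q : ℝ} (hq : 1 < q) : ∃ C : ℝ≥0∞, C ≠ ⊤ ∧ ∀ δ > 0, ∀ f : ℝ → ℝ,
    BCm f → ∫⁻ x, ‖∫ y, qk δ (x - y) • f y‖ₑ ^ q ≤ C * ∫⁻ x, ‖f x‖ₑ ^ q := by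
  rcases le_or_gt q 2 with h | h
  · exact qk_small hq h
  · exact qk_large h

lemma fatou_bound {α E : Type*} [MeasurableSpace α] {μ : Measure α} [NormedAddCommGroup E]
    [MeasurableSpace E] [OpensMeasurableSpace E] {q : ℝ} (hq : 0 < q) {u : ℕ → α → E} {v : α → E}
    {K : ℝ≥0∞} (hu : ∀ n, Measurable (u n))
    (hlim : ∀ᵐ x ∂μ, Filter.Tendsto (fun n => u n x) Filter.atTop (nhds (v x)))
    (hK : ∀ n, ∫⁻ x, ‖u n x‖ₑ ^ q ∂μ ≤ K) : ∫⁻ x, ‖v x‖ₑ ^ q ∂μ ≤ K := by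
  calc ∫⁻ x, ‖v x‖ₑ ^ q ∂μ = ∫⁻ x, Filter.liminf (fun n => ‖u n x‖ₑ ^ q) Filter.atTop ∂μ := by
        refine lintegral_congr_ae ?_
        filter_upwards [hlim] with x hx
        have h1 : Filter.Tendsto (fun n => ‖u n x‖ₑ ^ q) Filter.atTop (nhds (‖v x‖ₑ ^ q)) :=
          ((ENNReal.continuous_rpow_const (y := q)).tendsto _).comp
            ((continuous_enorm.tendsto _).comp hx)
        exact h1.liminf_eq.symm
    _ ≤ Filter.liminf (fun n => ∫⁻ x, ‖u n x‖ₑ ^ q ∂μ) Filter.atTop :=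
        lintegral_liminf_le fun n => (hu n).enorm.pow_const q
    _ ≤ K := by
        refine (Filter.liminf_le_liminf (Filter.Eventually.of_forall hK)).trans ?_
        simp

lemma qk_complex {q : ℝ} (hq : 1 < q) : ∃ C : ℝ≥0∞, C ≠ ⊤ ∧ ∀ δ > 0, ∀ f : ℝ → ℂ,
    BCm f → ∫⁻ x, ‖∫ y, qk δ (x - y) • f y‖ₑ ^ q ≤ C * ∫⁻ x, ‖f x‖ₑ ^ q := by
  obtain ⟨C1, hC1t, hb⟩ := qk_real hq
  have hq0 : 0 < q := by linarith
  refine ⟨2 ^ (q - 1) * (C1 + C1), ?_, ?_⟩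
  · refine ENNReal.mul_ne_top (ENNReal.rpow_ne_top_of_nonneg (by linarith) (by norm_num)) ?_
    simp [hC1t]
  intro δ hδ f hf
  obtain ⟨M, hM⟩ := hf.bdd
  obtain ⟨R, hR⟩ := hf.supp
  have hp : BCm (fun x => (f x).re) :=
    ⟨Complex.measurable_re.comp hf.meas, ⟨M, fun x => (Complex.abs_re_le_norm _).trans (hM x)⟩,
      ⟨R, fun x hx => by simp [hR x hx]⟩⟩
  have hn : BCm (fun x => (f x).im) :=
    ⟨Complex.measurable_im.comp hf.meas, ⟨M, fun x => (Complex.abs_im_le_norm _).trans (hM x)⟩,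
      ⟨R, fun x hx => by simp [hR x hx]⟩⟩
  have e : ∀ x, ‖∫ y, qk δ (x - y) • f y‖ₑ ≤ ‖∫ y, qk δ (x - y) • (f y).re‖ₑ +
      ‖∫ y, qk δ (x - y) • (f y).im‖ₑ := by
    intro x
    have hi := qk_smul_integrable hδ hf.integrable x
    have h1 := integral_re hi
    have h2 := integral_im hi
    simp only [RCLike.re_to_complex, Complex.smul_re] at h1
    simp only [RCLike.im_to_complex, Complex.smul_im] at h2
    rw [h1, h2, ← ofReal_norm, ← ofReal_norm, ← ofReal_norm, ← ENNReal.ofReal_add (norm_nonneg _) (norm_nonneg _)]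
    exact ENNReal.ofReal_le_ofReal (Complex.norm_le_abs_re_add_abs_im _)
  calc ∫⁻ x, ‖∫ y, qk δ (x - y) • f y‖ₑ ^ q
      ≤ ∫⁻ x, (‖∫ y, qk δ (x - y) • (f y).re‖ₑ + ‖∫ y, qk δ (x - y) • (f y).im‖ₑ) ^ q :=
        lintegral_mono fun x => ENNReal.rpow_le_rpow (e x) hq0.le
    _ ≤ 2 ^ (q - 1) * ((∫⁻ x, ‖∫ y, qk δ (x - y) • (f y).re‖ₑ ^ q) +
          ∫⁻ x, ‖∫ y, qk δ (x - y) • (f y).im‖ₑ ^ q) :=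
        add_pow_lint hq ((qk_conv_cont hδ hp.integrable).measurable.enorm.aemeasurable)
    _ ≤ 2 ^ (q - 1) * (C1 * (∫⁻ x, ‖f x‖ₑ ^ q) + C1 * ∫⁻ x, ‖f x‖ₑ ^ q) := by
        gcongr
        · refine (hb δ hδ _ hp).trans ?_
          gcongr with x
          exact enorm_le_iff_norm_le.2 (Complex.abs_re_le_norm _)
        · refine (hb δ hδ _ hn).trans ?_
          gcongr with x
          exact enorm_le_iff_norm_le.2 (Complex.abs_im_le_norm _)
    _ = _ := by ring

lemma qk_bound {q : ℝ} (hq : 1 < q) : ∃ C : ℝ≥0∞, C ≠ ⊤ ∧ ∀ δ > 0, ∀ f : ℝ → ℂ,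
    Measurable f → Integrable f →
      ∫⁻ x, ‖∫ y, qk δ (x - y) • f y‖ₑ ^ q ≤ C * ∫⁻ x, ‖f x‖ₑ ^ q := by
  obtain ⟨C, hC, hb⟩ := qk_complex hq
  refine ⟨C, hC, fun δ hδ f hfm hfi => ?_⟩
  set S : ℕ → Set ℝ := fun n => {y | |y| ≤ n} ∩ {y | ‖f y‖ ≤ n} with hS
  have hSm : ∀ n, MeasurableSet (S n) := fun n =>
    (measurableSet_le (by fun_prop) (by fun_prop)).inter (measurableSet_le hfm.norm (by fun_prop))
  have hB : ∀ n, BCm ((S n).indicator f) := fun n =>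
    ⟨hfm.indicator (hSm n), ⟨n, fun x => by
      by_cases hx : x ∈ S n
      · rw [indicator_of_mem hx]; exact hx.2
      · rw [indicator_of_notMem hx]; simp⟩, ⟨n, fun x hx => by
      rw [indicator_of_notMem]
      intro h; exact absurd h.1 (not_le.2 hx)⟩⟩
  refine fatou_bound (by linarith : 0 < q) (u := fun n x => ∫ y, qk δ (x - y) • (S n).indicator f y)
    (fun n => (qk_conv_cont hδ (hB n).integrable).measurable)
    (Filter.Eventually.of_forall fun x => ?_) (fun n => (hb δ hδ _ (hB n)).trans ?_)
  · refine tendsto_integral_of_dominated_convergence (fun y => 1 / δ * ‖f y‖)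
      (fun n => (qk_smul_integrable hδ (hB n).integrable x).aestronglyMeasurable)
      (hfi.norm.const_mul _) (fun n => Filter.Eventually.of_forall fun y => ?_)
      (Filter.Eventually.of_forall fun y => ?_)
    · rw [norm_smul, Real.norm_eq_abs]
      exact mul_le_mul (qk_le hδ _) (norm_indicator_le_norm_self _ _) (norm_nonneg _) (by positivity)
    · refine tendsto_const_nhds.congr' ?_
      obtain ⟨n1, h1⟩ := exists_nat_ge (|y|)
      obtain ⟨n2, h2⟩ := exists_nat_ge (‖f y‖)
      filter_upwards [Filter.eventually_ge_atTop n1, Filter.eventually_ge_atTop n2] with n h3 h4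
      rw [indicator_of_mem]
      exact ⟨h1.trans (by exact_mod_cast h3), h2.trans (by exact_mod_cast h4)⟩
  · gcongr with x
    exact enorm_le_iff_norm_le.2 (norm_indicator_le_norm_self _ _)

/-- truncated Hilbert kernel -/
def tk (δ s : ℝ) : ℝ := if δ < |s| then s⁻¹ else 0

lemma tk_meas (δ : ℝ) : Measurable (tk δ) :=
  Measurable.ite (measurableSet_lt (by fun_prop) (by fun_prop)) (by fun_prop) (by fun_prop)

lemma tk_le {δ : ℝ} (hδ : 0 < δ) (s : ℝ) : |tk δ s| ≤ 1 / δ := by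
  unfold tk; split_ifs with h
  · rw [abs_inv, ← one_div]; exact one_div_le_one_div_of_le hδ h.le
  · simp; exact hδ.le

lemma tk_smul_integrable {E : Type*} [NormedAddCommGroup E] [NormedSpace ℝ E] {δ : ℝ} (hδ : 0 < δ)
    {f : ℝ → E} (hf : Integrable f) (x : ℝ) : Integrable fun y => tk δ (x - y) • f y := by
  refine hf.bdd_smul (C := 1 / δ) ?_ ?_
  · exact ((tk_meas δ).comp (by fun_prop)).aestronglyMeasurable
  · exact Filter.Eventually.of_forall fun y => by rw [Real.norm_eq_abs]; exact tk_le hδ _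

lemma tk_sub_qk {δ : ℝ} (hδ : 0 < δ) (s : ℝ) : |tk δ s - qk δ s| ≤ pk δ s := by
  unfold tk qk pk
  have h0 : 0 < s ^ 2 + δ ^ 2 := by positivity
  split_ifs with h
  · have hs : s ≠ 0 := by rintro rfl; simp at h; linarith
    have : s⁻¹ - s / (s ^ 2 + δ ^ 2) = (δ / s) * (δ / (s ^ 2 + δ ^ 2)) := by
      field_simp; ring
    rw [this, abs_mul, abs_of_pos (show 0 < δ / (s ^ 2 + δ ^ 2) by positivity)]
    have h2 : |δ / s| ≤ 1 := by
      rw [abs_div, abs_of_pos hδ, div_le_one (by positivity)]; exact h.le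
    exact mul_le_of_le_one_left (by positivity) h2
  · push Not at h
    rw [zero_sub, abs_neg, abs_div, abs_of_pos h0]
    gcongr

lemma tk_bound {q : ℝ} (hq : 1 < q) : ∃ C : ℝ≥0∞, C ≠ ⊤ ∧ ∀ δ > 0, ∀ f : ℝ → ℂ,
    Measurable f → Integrable f →
      ∫⁻ x, ‖∫ y, tk δ (x - y) • f y‖ₑ ^ q ≤ C * ∫⁻ x, ‖f x‖ₑ ^ q := by
  obtain ⟨C, hC, hb⟩ := qk_bound hq
  have hq0 : 0 < q := by linarith
  refine ⟨2 ^ (q - 1) * (C + (ENNReal.ofReal π) ^ q), ?_, fun δ hδ f hfm hfi => ?_⟩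
  · refine ENNReal.mul_ne_top (ENNReal.rpow_ne_top_of_nonneg (by linarith) (by norm_num)) ?_
    exact ENNReal.add_ne_top.2 ⟨hC, ENNReal.rpow_ne_top_of_nonneg hq0.le (by simp)⟩
  have e : ∀ x, ‖∫ y, tk δ (x - y) • f y‖ₑ ≤ ‖∫ y, qk δ (x - y) • f y‖ₑ +
      ‖∫ y, (tk δ (x - y) - qk δ (x - y)) • f y‖ₑ := by
    intro x
    have : ∫ y, tk δ (x - y) • f y = (∫ y, qk δ (x - y) • f y) +
        ∫ y, (tk δ (x - y) - qk δ (x - y)) • f y := by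
      simp only [sub_smul]
      rw [integral_sub (tk_smul_integrable hδ hfi x) (qk_smul_integrable hδ hfi x)]
      abel
    rw [this]; exact enorm_add_le _ _
  calc ∫⁻ x, ‖∫ y, tk δ (x - y) • f y‖ₑ ^ q
      ≤ ∫⁻ x, (‖∫ y, qk δ (x - y) • f y‖ₑ + ‖∫ y, (tk δ (x - y) - qk δ (x - y)) • f y‖ₑ) ^ q :=
        lintegral_mono fun x => ENNReal.rpow_le_rpow (e x) hq0.le
    _ ≤ 2 ^ (q - 1) * ((∫⁻ x, ‖∫ y, qk δ (x - y) • f y‖ₑ ^ q) +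
          ∫⁻ x, ‖∫ y, (tk δ (x - y) - qk δ (x - y)) • f y‖ₑ ^ q) :=
        add_pow_lint hq ((qk_conv_cont hδ hfi).measurable.enorm.aemeasurable)
    _ ≤ 2 ^ (q - 1) * (C * (∫⁻ x, ‖f x‖ₑ ^ q) + ENNReal.ofReal π ^ q * ∫⁻ x, ‖f x‖ₑ ^ q) := by
        gcongr
        · exact hb δ hδ f hfm hfi
        · refine (conv_young hq (k := fun s => tk δ s - qk δ s)
            ((tk_meas δ).sub (qk_cont hδ).measurable) hfm).trans ?_
          gcongr
          rw [← pk_lint hδ]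
          refine lintegral_mono fun r => ?_
          rw [← ofReal_norm]
          exact ENNReal.ofReal_le_ofReal (tk_sub_qk hδ r)
    _ = _ := by ring

structure BC2 (g : ℝ × ℝ → ℂ) : Prop where
  meas : Measurable g
  bdd : ∃ M, ∀ x, ‖g x‖ ≤ M
  supp : ∃ R, ∀ x, (R < |x.1| ∨ R < |x.2|) → g x = 0

lemma BC2.integrable {g : ℝ × ℝ → ℂ} (hf : BC2 g) : Integrable g := by
  obtain ⟨M, hM⟩ := hf.bdd
  obtain ⟨R, hR⟩ := hf.supp
  have : g = indicator (Icc (-R) R ×ˢ Icc (-R) R) g := by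
    ext x
    by_cases hx : x ∈ Icc (-R) R ×ˢ Icc (-R) R
    · rw [indicator_of_mem hx]
    · rw [indicator_of_notMem hx]
      apply hR
      by_contra h
      push Not at h
      exact hx ⟨abs_le.1 h.1, abs_le.1 h.2⟩
  rw [this, integrable_indicator_iff (measurableSet_Icc.prod measurableSet_Icc)]
  exact Measure.integrableOn_of_bounded (M := M)
    (((isCompact_Icc (a := -R) (b := R)).prod (isCompact_Icc (a := -R) (b := R))).measure_lt_top.ne) hf.meas.aestronglyMeasurable
    (Filter.Eventually.of_forall hM)

def cv (k : ℝ × ℝ → ℝ) (g : ℝ × ℝ → ℂ) (p : ℝ × ℝ) : ℂ := ∫ x, k x • g (p - x)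

lemma cv_eq (k : ℝ × ℝ → ℝ) (g : ℝ × ℝ → ℂ) (p : ℝ × ℝ) : cv k g p = ∫ x, k (p - x) • g x := by
  unfold cv
  rw [← integral_sub_left_eq_self (fun x => k (p - x) • g x) _ p]
  simp

lemma cv_meas {k : ℝ × ℝ → ℝ} {g : ℝ × ℝ → ℂ} (hk : Measurable k) (hg : Measurable g) :
    Measurable (cv k g) := by
  have : StronglyMeasurable (Function.uncurry fun (p x : ℝ × ℝ) => k x • g (p - x)) := by
    apply Measurable.stronglyMeasurable
    exact (hk.comp measurable_snd).smul (hg.comp (measurable_fst.sub measurable_snd))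
  exact this.integral_prod_right.measurable

lemma cv_integrable {k : ℝ × ℝ → ℝ} {g : ℝ × ℝ → ℂ} (hk : Measurable k) {C : ℝ}
    (hC : ∀ x, |k x| ≤ C) (hg : Integrable g) (p : ℝ × ℝ) : Integrable fun x => k x • g (p - x) := by
  refine (hg.comp_sub_left p).bdd_smul C hk.aestronglyMeasurable (Filter.Eventually.of_forall hC)

lemma cv_integrable' {k : ℝ × ℝ → ℝ} {g : ℝ × ℝ → ℂ} (hk : Measurable k) {C : ℝ}
    (hC : ∀ x, |k x| ≤ C) (hg : Integrable g) (p : ℝ × ℝ) : Integrable fun x => k (p - x) • g x := by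
  refine hg.bdd_smul C (hk.comp (by fun_prop)).aestronglyMeasurable
    (Filter.Eventually.of_forall fun x => hC _)

/-- kernel obtained by rotating -/
def rk (δ : ℝ) (k : ℝ → ℝ) (x : ℝ × ℝ) : ℝ := tk δ x.2 * |x.2|⁻¹ * k (x.1 / x.2)

lemma rk_meas (δ : ℝ) {k : ℝ → ℝ} (hk : Measurable k) : Measurable (rk δ k) :=
  (((tk_meas δ).comp measurable_snd).mul (by fun_prop)).mul (hk.comp (by fun_prop))

lemma rk_le {δ : ℝ} (hδ : 0 < δ) {k : ℝ → ℝ} {C : ℝ} (hC : ∀ r, |k r| ≤ C) (x : ℝ × ℝ) :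
    |rk δ k x| ≤ 1 / δ * (1 / δ) * C := by
  have hC0 : 0 ≤ C := (abs_nonneg _).trans (hC 0)
  by_cases h : δ < |x.2|
  · unfold rk
    rw [abs_mul, abs_mul, abs_inv, abs_abs]
    refine mul_le_mul (mul_le_mul (tk_le hδ _) ?_ (by positivity) (by positivity)) (hC _)
      (abs_nonneg _) (by positivity)
    rw [← one_div]; exact one_div_le_one_div_of_le hδ h.le
  · simp [rk, tk, h]; positivity

lemma rk_cv {δ : ℝ} (hδ : 0 < δ) {k : ℝ → ℝ} {C : ℝ} (hC : ∀ r, |k r| ≤ C) (hk : Measurable k)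
    (hki : Integrable k) {g : ℝ × ℝ → ℂ} (hg : BC2 g) (z φ : ℝ) :
    cv (rk δ k) g (z, φ) = ∫ r, k r • ∫ s, tk δ s • g (z - r * s, φ - s) := by
  unfold cv
  have e0 : ∀ s, ∫ t, rk δ k (t, s) • g ((z, φ) - (t, s)) = ∫ r, (k r * tk δ s) • g (z - r * s, φ - s) := by
    intro s
    by_cases h : δ < |s|
    · have hs : s ≠ 0 := by rintro rfl; simp at h; linarith
      have := Measure.integral_comp_mul_right (fun t => (|s| * tk δ s * |s|⁻¹ * k (t / s)) • g (z - t, φ - s)) s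
      have h2 : |s| ≠ 0 := abs_ne_zero.2 hs
      calc _ = |s⁻¹| • ∫ t, (|s| * tk δ s * |s|⁻¹ * k (t / s)) • g (z - t, φ - s) := by
            rw [← integral_smul]
            refine integral_congr_ae (Filter.Eventually.of_forall fun t => ?_)
            simp only [rk, smul_smul, Prod.mk_sub_mk]
            congr 1
            rw [abs_inv]; field_simp
        _ = _ := by
            rw [← this]
            refine integral_congr_ae (Filter.Eventually.of_forall fun t => ?_)
            simp only
            congr 1
            rw [mul_div_cancel_right₀ _ hs]; field_simp
    · simp [rk, tk, h]
  rw [Measure.volume_eq_prod, integral_prod_symm _ (by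
    rw [← Measure.volume_eq_prod]
    exact cv_integrable (rk_meas δ hk) (rk_le hδ hC) hg.integrable (z, φ))]
  simp only [e0]
  have e1 : ∀ r, k r • ∫ s, tk δ s • g (z - r * s, φ - s) = ∫ s, (k r * tk δ s) • g (z - r * s, φ - s) := by
    intro r
    rw [← integral_smul]
    simp only [smul_smul]
  simp only [e1]
  rw [integral_integral_swap]
  obtain ⟨M, hM⟩ := hg.bdd
  obtain ⟨R, hR⟩ := hg.supp
  have hb : Integrable (indicator (Icc (φ - R) (φ + R)) (fun _ => 1 / δ * M) : ℝ → ℝ) :=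
    (integrable_indicator_iff measurableSet_Icc).2 (integrableOn_const (by simp))
  refine Integrable.mono' (hb.norm.mul_prod hki.norm) ?_ ?_
  · apply Measurable.aestronglyMeasurable
    refine ((hk.comp measurable_snd).mul ((tk_meas δ).comp measurable_fst)).smul (hg.meas.comp ?_)
    fun_prop
  · refine Filter.Eventually.of_forall fun x => ?_
    rcases x with ⟨s, r⟩
    simp only [Function.uncurry]
    have hM0 : 0 ≤ M := (norm_nonneg _).trans (hM 0)
    by_cases hs : s ∈ Icc (φ - R) (φ + R)
    · rw [indicator_of_mem hs, norm_smul, norm_mul]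
      have h1 : ‖tk δ s‖ ≤ 1 / δ := tk_le hδ s
      rw [Real.norm_of_nonneg (show 0 ≤ 1 / δ * M by positivity)]
      calc ‖k r‖ * ‖tk δ s‖ * ‖g (z - r * s, φ - s)‖ ≤ ‖k r‖ * (1 / δ) * M := by
            gcongr; exact hM _
        _ = _ := by ring
    · rw [hR]; · rw [smul_zero, norm_zero]; positivity
      right
      simp only
      by_contra h
      push Not at h
      have := abs_le.1 h
      exact hs ⟨by linarith [this.2], by linarith [this.1]⟩

lemma line_bound {q : ℝ} (hq : 1 < q) {C : ℝ≥0∞} (hb : ∀ δ > 0, ∀ f : ℝ → ℂ,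
    Measurable f → Integrable f →
      ∫⁻ x, ‖∫ y, tk δ (x - y) • f y‖ₑ ^ q ≤ C * ∫⁻ x, ‖f x‖ₑ ^ q)
    {δ : ℝ} (hδ : 0 < δ) {g : ℝ × ℝ → ℂ} (hg : BC2 g) (r : ℝ) :
    ∫⁻ x : ℝ × ℝ, ‖∫ s, tk δ s • g (x.1 - r * s, x.2 - s)‖ₑ ^ q ≤ C * ∫⁻ x, ‖g x‖ₑ ^ q := by
  have hm : Measurable fun x : ℝ × ℝ => ‖∫ s, tk δ s • g (x.1 - r * s, x.2 - s)‖ₑ ^ q := by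
    have : StronglyMeasurable (Function.uncurry fun (x : ℝ × ℝ) (s : ℝ) => tk δ s • g (x.1 - r * s, x.2 - s)) := by
      apply Measurable.stronglyMeasurable
      refine ((tk_meas δ).comp measurable_snd).smul (hg.meas.comp ?_)
      fun_prop
    exact (this.integral_prod_right.measurable).enorm.pow_const q
  have hgm : Measurable fun x : ℝ × ℝ => ‖g x‖ₑ ^ q := hg.meas.enorm.pow_const q
  obtain ⟨M, hM⟩ := hg.bdd
  obtain ⟨R, hR⟩ := hg.supp
  have shear : ∀ G : ℝ × ℝ → ℝ≥0∞, Measurable G →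
      ∫⁻ x, G x = ∫⁻ z : ℝ, ∫⁻ φ : ℝ, G (z + r * φ, φ) := by
    intro G hG
    rw [Measure.volume_eq_prod, lintegral_prod_symm _ hG.aemeasurable]
    rw [lintegral_lintegral_swap (f := fun z φ => G (z + r * φ, φ)) (by
      refine (hG.comp ?_).aemeasurable
      fun_prop)]
    refine lintegral_congr fun φ => ?_
    exact (lintegral_add_right_eq_self (μ := volume) (fun z => G (z, φ)) (r * φ)).symm
  rw [shear _ hm, shear _ hgm, ← lintegral_const_mul _ (by
    apply Measurable.lintegral_prod_right' (f := fun x : ℝ × ℝ => ‖g (x.1 + r * x.2, x.2)‖ₑ ^ q)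
    refine hgm.comp ?_
    fun_prop)]
  refine lintegral_mono fun z => ?_
  have hBC : BCm fun y => g (z + r * y, y) := by
    refine ⟨hg.meas.comp (by fun_prop), ⟨M, fun x => hM _⟩, ⟨R, fun x hx => hR _ (Or.inr hx)⟩⟩
  refine le_trans (le_of_eq ?_) (hb δ hδ _ hBC.meas hBC.integrable)
  refine lintegral_congr fun φ => ?_
  congr 2
  rw [← integral_sub_left_eq_self (fun y => tk δ (φ - y) • g (z + r * y, y)) _ φ]
  refine integral_congr_ae (Filter.Eventually.of_forall fun s => ?_)
  simp only [sub_sub_cancel]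
  congr 3
  ring

lemma rk_bound {q : ℝ} (hq : 1 < q) {k : ℝ → ℝ} {C : ℝ} (hC : ∀ r, |k r| ≤ C) (hk : Measurable k)
    (hki : Integrable k) : ∃ C : ℝ≥0∞, C ≠ ⊤ ∧ ∀ δ > 0, ∀ g, BC2 g →
      ∫⁻ x, ‖cv (rk δ k) g x‖ₑ ^ q ≤ C * ∫⁻ x, ‖g x‖ₑ ^ q := by
  obtain ⟨C1, hC1, hb⟩ := tk_bound hq
  refine ⟨(∫⁻ r, ‖k r‖ₑ) ^ q * C1, ENNReal.mul_ne_top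
    (ENNReal.rpow_ne_top_of_nonneg (by linarith) hki.2.ne) hC1, fun δ hδ g hg => ?_⟩
  have hm : Measurable (Function.uncurry fun (r : ℝ) (x : ℝ × ℝ) =>
      ‖∫ s, tk δ s • g (x.1 - r * s, x.2 - s)‖ₑ) := by
    have : StronglyMeasurable (Function.uncurry fun (x : ℝ × ℝ × ℝ) (s : ℝ) => tk δ s • g (x.2.1 - x.1 * s, x.2.2 - s)) := by
      apply Measurable.stronglyMeasurable
      refine ((tk_meas δ).comp measurable_snd).smul (hg.meas.comp ?_)
      fun_prop
    exact (this.integral_prod_right.measurable).enorm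
  rw [mul_assoc]
  refine le_trans ?_ (mink_lint volume volume hq hk.enorm hm (fun r => line_bound hq hb hδ hg r))
  refine lintegral_mono fun x => ENNReal.rpow_le_rpow ?_ (by linarith)
  rcases x with ⟨z, φ⟩
  rw [rk_cv hδ hC hk hki hg]
  refine (enorm_integral_le_lintegral_enorm _).trans (lintegral_mono fun y => ?_)
  rw [enorm_smul]

def κ1 (t s : ℝ) : ℝ := -2 * s * t / (t ^ 2 + s ^ 2) ^ 2
def κ2 (t s : ℝ) : ℝ := (s ^ 2 - t ^ 2) / (t ^ 2 + s ^ 2) ^ 2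

lemma clog_top (c : ℂ) : Filter.Tendsto (fun y : ℝ => Complex.log (y + c) - (Real.log y : ℂ))
    Filter.atTop (nhds 0) := by
  have h1 : Filter.Tendsto (fun y : ℝ => (1 : ℂ) + c * ((y⁻¹ : ℝ) : ℂ)) Filter.atTop (nhds (1 + c * ((0 : ℝ) : ℂ))) :=
    ((((Complex.continuous_ofReal.tendsto 0).comp tendsto_inv_atTop_zero)).const_mul c).const_add 1
  simp only [Complex.ofReal_zero, mul_zero, add_zero] at h1
  have h2 := (continuousAt_clog (x := 1) (by simp)).tendsto.comp h1
  rw [Complex.log_one] at h2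
  refine h2.congr' ?_
  have h3 := h1.eventually_ne (show (1 : ℂ) ≠ 0 by simp)
  filter_upwards [Filter.eventually_gt_atTop 0, h3] with y hy hne
  have : (y : ℂ) + c = (y : ℂ) * (1 + c * ((y⁻¹ : ℝ) : ℂ)) := by
    have : (y : ℂ) ≠ 0 := by exact_mod_cast hy.ne'
    push_cast; field_simp
  rw [this, Complex.log_ofReal_mul hy hne]
  simp

lemma clog_bot_aux (c : ℂ) {l : ℂ} {S : Set ℂ} (hS : ∀ y : ℝ, 0 < y → -1 + c * ((y⁻¹ : ℝ) : ℂ) ∈ S)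
    (hl : Filter.Tendsto Complex.log (nhdsWithin (-1) S) (nhds l)) (hne : ∀ z ∈ S, z ≠ 0) :
    Filter.Tendsto (fun y : ℝ => Complex.log (y + c) - (Real.log y : ℂ)) Filter.atBot (nhds l) := by
  have h1 : Filter.Tendsto (fun y : ℝ => (-1 : ℂ) + c * ((y⁻¹ : ℝ) : ℂ)) Filter.atTop (nhds (-1 + c * ((0 : ℝ) : ℂ))) :=
    ((((Complex.continuous_ofReal.tendsto 0).comp tendsto_inv_atTop_zero)).const_mul c).const_add (-1)
  simp only [Complex.ofReal_zero, mul_zero, add_zero] at h1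
  have h2 : Filter.Tendsto (fun y : ℝ => (-1 : ℂ) + c * ((y⁻¹ : ℝ) : ℂ)) Filter.atTop (nhdsWithin (-1) S) := by
    refine tendsto_nhdsWithin_iff.2 ⟨h1, ?_⟩
    filter_upwards [Filter.eventually_gt_atTop 0] with y hy using hS y hy
  have h4 := (hl.comp h2).comp Filter.tendsto_neg_atBot_atTop
  refine h4.congr' ?_
  filter_upwards [Filter.eventually_lt_atBot 0] with y hy
  have hy' : 0 < -y := by linarith
  simp only [Function.comp]
  have : (y : ℂ) + c = ((-y : ℝ) : ℂ) * (-1 + c * (((-y)⁻¹ : ℝ) : ℂ)) := by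
    have : (y : ℂ) ≠ 0 := by exact_mod_cast hy.ne
    push_cast; field_simp; ring
  rw [this, Complex.log_ofReal_mul hy' (hne _ (hS _ hy')), Real.log_neg_eq_log]
  simp

lemma clog_bot_pos {c : ℂ} (hc : 0 < c.im) :
    Filter.Tendsto (fun y : ℝ => Complex.log (y + c) - (Real.log y : ℂ))
      Filter.atBot (nhds (π * Complex.I)) := by
  have h := Complex.tendsto_log_nhdsWithin_im_nonneg_of_re_neg_of_im_zero (z := -1) (by simp) (by simp)
  simp only [norm_neg, norm_one, Real.log_one, Complex.ofReal_zero, zero_add] at h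
  have h' := h.mono_left (nhdsWithin_mono _ (show {z : ℂ | 0 < z.im} ⊆ {z : ℂ | 0 ≤ z.im} from
    fun z (hz : 0 < z.im) => (le_of_lt hz : 0 ≤ z.im)))
  refine clog_bot_aux c (S := {z : ℂ | 0 < z.im}) (fun y hy => ?_) h' (fun z hz h0 => ?_)
  · simp only [mem_ofPred_eq, Complex.add_im, Complex.neg_im, Complex.one_im, Complex.im_mul_ofReal]
    have := mul_pos hc (inv_pos.2 hy)
    linarith
  · rw [h0] at hz; simp at hz

lemma clog_bot_neg {c : ℂ} (hc : c.im < 0) :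
    Filter.Tendsto (fun y : ℝ => Complex.log (y + c) - (Real.log y : ℂ))
      Filter.atBot (nhds (-(π * Complex.I))) := by
  have h := Complex.tendsto_log_nhdsWithin_im_neg_of_re_neg_of_im_zero (z := -1) (by simp) (by simp)
  simp only [norm_neg, norm_one, Real.log_one, Complex.ofReal_zero, zero_sub] at h
  refine clog_bot_aux c (S := {z : ℂ | z.im < 0}) (fun y hy => ?_) h (fun z hz h0 => ?_)
  · simp only [mem_ofPred_eq, Complex.add_im, Complex.neg_im, Complex.one_im, Complex.im_mul_ofReal]
    have := mul_neg_of_neg_of_pos hc (inv_pos.2 hy)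
    linarith
  · rw [h0] at hz; simp at hz

lemma norm_add_mul_I (y s : ℝ) : ‖(y : ℂ) + s * Complex.I‖ ^ 2 = y ^ 2 + s ^ 2 := by
  rw [← Complex.normSq_eq_norm_sq, Complex.normSq_add_mul_I]

lemma ne_of_im {w : ℂ} (h : w.im ≠ 0) : w ≠ 0 := by rintro rfl; simp at h

lemma rat_integrable {w : ℂ} (hw : 0 < w.im) {s : ℝ} (hs : s ≠ 0) :
    Integrable fun y : ℝ => 1 / ((w - y) * (y + s * Complex.I) ^ 2) := by
  have h0 : ∀ y : ℝ, (y : ℂ) + s * Complex.I ≠ 0 := fun y => ne_of_im (by simpa using hs)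
  refine ((pk_integrable (abs_pos.2 hs)).mul_const (1 / w.im * |s|⁻¹)).mono' ?_ ?_
  · apply Continuous.aestronglyMeasurable
    exact continuous_const.div (by fun_prop) (fun y => mul_ne_zero (sub_ne_zero_of_im_pos hw y)
      (pow_ne_zero _ (h0 y)))
  · refine Filter.Eventually.of_forall fun y => ?_
    rw [norm_div, norm_one, norm_mul, norm_pow, norm_add_mul_I, pk, sq_abs]
    have h1 := im_le_norm_sub w y
    have h2 : 0 < y ^ 2 + s ^ 2 := by positivity
    have h3 : 0 < |s| := abs_pos.2 hs
    calc 1 / (‖w - y‖ * (y ^ 2 + s ^ 2)) ≤ 1 / (w.im * (y ^ 2 + s ^ 2)) := by gcongr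
      _ = _ := by field_simp

lemma rat_integral {w : ℂ} (hw : 0 < w.im) {s : ℝ} (hs : s ≠ 0) {σ : ℂ}
    (hσ : Filter.Tendsto (fun y : ℝ => Complex.log (y + s * Complex.I) - (Real.log y : ℂ))
      Filter.atBot (nhds (σ * (π * Complex.I)))) (ha : w + s * Complex.I ≠ 0) :
    ∫ y : ℝ, 1 / ((w - y) * (y + s * Complex.I) ^ 2) = -((1 + σ) * (π * Complex.I)) / (w + s * Complex.I) ^ 2 := by
  set a := w + s * Complex.I with hadef
  have h0 : ∀ y : ℝ, (y : ℂ) + s * Complex.I ≠ 0 := fun y => ne_of_im (by simpa using hs)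
  have inv0 : Filter.Tendsto (fun y : ℝ => 1 / (a * (y + s * Complex.I))) (Filter.cocompact ℝ) (nhds 0) := by
    have h1 : Filter.Tendsto (fun y : ℝ => (1 / ‖a‖) * ‖y‖⁻¹) (Filter.cocompact ℝ) (nhds ((1 / ‖a‖) * 0)) :=
      (tendsto_inv_atTop_zero.comp (tendsto_norm_cocompact_atTop (E := ℝ))).const_mul _
    rw [mul_zero] at h1
    refine squeeze_zero_norm' ?_ h1
    filter_upwards [(isCompact_singleton (x := (0 : ℝ))).compl_mem_cocompact] with y hy
    rw [norm_div, norm_one, norm_mul, one_div, mul_inv, one_div]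
    have h2 : ‖y‖ ≤ ‖(y : ℂ) + s * Complex.I‖ := by
      have := Complex.abs_re_le_norm ((y : ℂ) + s * Complex.I)
      simpa using this
    have h3 : 0 < ‖y‖ := norm_pos_iff.2 hy
    gcongr
  have D : ∀ y : ℝ, HasDerivAt (fun y : ℝ => (1 / a ^ 2) * (-Complex.log (y + -w) + Complex.log (y + s * Complex.I))
      - 1 / (a * (y + s * Complex.I))) (1 / ((w - y) * (y + s * Complex.I) ^ 2)) y := by
    intro y
    have hb : HasDerivAt (fun y : ℝ => (y : ℂ)) 1 y := Complex.ofRealCLM.hasDerivAt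
    have d1 : HasDerivAt (fun y : ℝ => Complex.log (y + -w)) (1 / (y + -w)) y :=
      (hb.add_const (-w)).clog_real (by right; simp; exact hw.ne')
    have d2 : HasDerivAt (fun y : ℝ => Complex.log (y + s * Complex.I)) (1 / (y + s * Complex.I)) y :=
      (hb.add_const (s * Complex.I)).clog_real (by right; simp; exact hs)
    have d3 := (hasDerivAt_const y (1 : ℂ)).div ((hb.add_const (s * Complex.I)).const_mul a)
      (mul_ne_zero ha (h0 y))
    have d4 := ((d1.neg.add d2).const_mul (1 / a ^ 2)).sub d3
    refine HasDerivAt.congr_deriv d4 ?_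
    have e1 := h0 y
    have e2 := sub_ne_zero_of_im_pos hw y
    have e3 : (y : ℂ) + -w ≠ 0 := by
      intro h; apply e2; linear_combination -h
    have : (s * Complex.I : ℂ) = a - w := by rw [hadef]; ring
    rw [this] at e1 ⊢
    field_simp
    ring
  have T1 : Filter.Tendsto (fun y : ℝ => (1 / a ^ 2) * (-Complex.log (y + -w) + Complex.log (y + s * Complex.I))
      - 1 / (a * (y + s * Complex.I))) Filter.atTop (nhds (1 / a ^ 2 * (-0 + 0) - 0)) := by
    refine Filter.Tendsto.sub (Filter.Tendsto.const_mul _ ?_) (inv0.mono_left atTop_le_cocompact)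
    refine ((clog_top (-w)).neg.add (clog_top (s * Complex.I))).congr fun y => ?_
    ring
  have T2 : Filter.Tendsto (fun y : ℝ => (1 / a ^ 2) * (-Complex.log (y + -w) + Complex.log (y + s * Complex.I))
      - 1 / (a * (y + s * Complex.I))) Filter.atBot
      (nhds (1 / a ^ 2 * (-(-(π * Complex.I)) + σ * (π * Complex.I)) - 0)) := by
    refine Filter.Tendsto.sub (Filter.Tendsto.const_mul _ ?_) (inv0.mono_left atBot_le_cocompact)
    refine ((clog_bot_neg (c := -w) (by simpa using hw)).neg.add hσ).congr fun y => ?_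
    ring
  rw [integral_of_hasDerivAt_of_tendsto D (rat_integrable hw hs) T2 T1]
  field_simp
  ring

lemma rat_integral_pos {w : ℂ} (hw : 0 < w.im) {s : ℝ} (hs : 0 < s) :
    ∫ y : ℝ, 1 / ((w - y) * (y + s * Complex.I) ^ 2) = -(2 * π * Complex.I) / (w + s * Complex.I) ^ 2 := by
  rw [rat_integral hw hs.ne' (σ := 1) (by
    rw [one_mul]; exact clog_bot_pos (by simpa using hs)) (ne_of_im (by simp; positivity))]
  ring

lemma rat_integral_neg {w : ℂ} (hw : 0 < w.im) {s : ℝ} (hs : s < 0) :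
    ∫ y : ℝ, 1 / ((w - y) * (y + s * Complex.I) ^ 2) = 0 := by
  by_cases ha : w + s * Complex.I = 0
  · have h0 : ∀ y : ℝ, (y : ℂ) + s * Complex.I ≠ 0 := fun y => ne_of_im (by simpa using hs.ne)
    have T : Filter.Tendsto (fun y : ℝ => (1 / 2 : ℂ) / ((y + s * Complex.I) ^ 2)) (Filter.cocompact ℝ) (nhds 0) := by
      have h1 : Filter.Tendsto (fun y : ℝ => (1 / 2) * (‖y‖⁻¹) ^ 2) (Filter.cocompact ℝ) (nhds ((1 / 2) * 0 ^ 2)) :=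
        ((tendsto_inv_atTop_zero.comp (tendsto_norm_cocompact_atTop (E := ℝ))).pow 2).const_mul _
      rw [zero_pow (by norm_num), mul_zero] at h1
      refine squeeze_zero_norm' ?_ h1
      filter_upwards [(isCompact_singleton (x := (0 : ℝ))).compl_mem_cocompact] with y hy
      have h2 : ‖y‖ ≤ ‖(y : ℂ) + s * Complex.I‖ := by
        have := Complex.abs_re_le_norm ((y : ℂ) + s * Complex.I)
        simpa using this
      have h3 : 0 < ‖y‖ := norm_pos_iff.2 hy
      rw [norm_div, norm_pow, div_eq_mul_inv, ← inv_pow]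
      simp only [one_div, norm_inv, Complex.norm_ofNat]
      gcongr
    rw [integral_of_hasDerivAt_of_tendsto (f := fun y : ℝ => (1 / 2 : ℂ) / ((y + s * Complex.I) ^ 2))
      (fun y => ?_) (rat_integrable hw hs.ne)
      (T.mono_left atBot_le_cocompact) (T.mono_left atTop_le_cocompact), sub_zero]
    have hb : HasDerivAt (fun y : ℝ => (y : ℂ)) 1 y := Complex.ofRealCLM.hasDerivAt
    have d3 := (hasDerivAt_const y (1 / 2 : ℂ)).div ((hb.add_const (s * Complex.I)).pow 2)
      (pow_ne_zero _ (h0 y))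
    refine HasDerivAt.congr_deriv d3 ?_
    have e1 := h0 y
    have e2 := sub_ne_zero_of_im_pos hw y
    have : w - y = -(y + s * Complex.I) := by linear_combination ha
    rw [this]
    simp only [Pi.pow_apply]
    field_simp
    norm_num
    ring
  · rw [rat_integral hw hs.ne (σ := -1) (by
      rw [neg_one_mul]; exact clog_bot_neg (by simpa using hs)) ha]
    simp

lemma qk_conv_κ2 {δ s : ℝ} (hδ : 0 < δ) (hs : 0 < s) (x : ℝ) :
    ∫ y, qk δ (x - y) * κ2 y s = -π * κ1 x (s + δ) := by
  have hw : 0 < ((x : ℂ) + δ * Complex.I).im := by simpa using hδ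
  set w : ℂ := (x : ℂ) + δ * Complex.I with hwd
  have i1 := rat_integrable hw hs.ne'
  have i2 := rat_integrable hw (neg_ne_zero.2 hs.ne')
  have hsum := integral_add i1 i2
  rw [rat_integral_pos hw hs, rat_integral_neg hw (neg_lt_zero.2 hs), add_zero] at hsum
  have hre := integral_re (i1.add i2)
  simp only [RCLike.re_to_complex, Pi.add_apply] at hre
  rw [hsum] at hre
  have e1 : ∀ y : ℝ, (1 / ((w - y) * (y + s * Complex.I) ^ 2) +
      1 / ((w - y) * (y + ((-s : ℝ) : ℂ) * Complex.I) ^ 2)).re = -2 * (qk δ (x - y) * κ2 y s) := by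
    intro y
    have h1 : (y : ℂ) + s * Complex.I ≠ 0 := ne_of_im (by simpa using hs.ne')
    have h2 : (y : ℂ) + ((-s : ℝ) : ℂ) * Complex.I ≠ 0 := ne_of_im (by simpa using hs.ne')
    have h3 := sub_ne_zero_of_im_pos hw y
    have h4 : (y ^ 2 + s ^ 2 : ℂ) ≠ 0 := by
      have : (0:ℝ) < y ^ 2 + s ^ 2 := by positivity
      exact_mod_cast this.ne'
    have e : 1 / ((w - y) * (y + s * Complex.I) ^ 2) +
      1 / ((w - y) * (y + ((-s : ℝ) : ℂ) * Complex.I) ^ 2) = ((-2 * κ2 y s : ℝ) : ℂ) * (w - y)⁻¹ := by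
      have e5 : ((y : ℂ) + s * Complex.I) * (y + ((-s : ℝ) : ℂ) * Complex.I) = y ^ 2 + s ^ 2 := by
        push_cast; linear_combination (-s ^ 2 : ℂ) * Complex.I_sq
      have e6 : ((y : ℂ) + s * Complex.I) ^ 2 + (y + ((-s : ℝ) : ℂ) * Complex.I) ^ 2 = 2 * (y ^ 2 - s ^ 2) := by
        push_cast; linear_combination (2 * s ^ 2 : ℂ) * Complex.I_sq
      have : ((-2 * κ2 y s : ℝ) : ℂ) = 2 * (y ^ 2 - s ^ 2) / (y ^ 2 + s ^ 2) ^ 2 := by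
        unfold κ2; push_cast; ring
      rw [this, ← e5, ← e6]
      generalize (y : ℂ) + s * Complex.I = A at *
      generalize (y : ℂ) + ((-s : ℝ) : ℂ) * Complex.I = B at *
      field_simp
      ring
    rw [e, Complex.re_ofReal_mul, Complex.inv_re]
    have : (w - y).re = x - y := by simp [hwd]
    rw [this]
    have : Complex.normSq (w - y) = (x - y) ^ 2 + δ ^ 2 := by
      rw [Complex.normSq_apply]; simp [hwd]; ring
    rw [this, qk]; ring
  simp only [e1] at hre
  rw [integral_const_mul] at hre
  have e2 : (-(2 * π * Complex.I) / (w + s * Complex.I) ^ 2).re = 2 * π * κ1 x (s + δ) := by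
    have h4 : (x ^ 2 + (s + δ) ^ 2 : ℂ) ≠ 0 := by
      have : (0:ℝ) < x ^ 2 + (s + δ) ^ 2 := by positivity
      exact_mod_cast this.ne'
    have h5 : w + s * Complex.I ≠ 0 := ne_of_im (by simp [hwd]; positivity)
    have : -(2 * π * Complex.I) / (w + s * Complex.I) ^ 2 =
        ((2 * π * κ1 x (s + δ) : ℝ) : ℂ) + ((2 * π * κ2 x (s + δ) : ℝ) : ℂ) * Complex.I := by
      rw [div_eq_iff (pow_ne_zero _ h5), hwd, κ1, κ2]
      push_cast
      field_simp
      ring_nf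
      simp only [Complex.I_sq, show Complex.I ^ 3 = -Complex.I by
        rw [show Complex.I ^ 3 = Complex.I ^ 2 * Complex.I by ring, Complex.I_sq]; ring]
      ring
    rw [this]
    simp
  rw [e2] at hre
  linarith

def k1f (r : ℝ) : ℝ := -2 * r / (1 + r ^ 2) ^ 2
def k2f (r : ℝ) : ℝ := (1 - r ^ 2) / (1 + r ^ 2) ^ 2

lemma k1f_le (r : ℝ) : |k1f r| ≤ (1 + r ^ 2)⁻¹ := by
  have h : 0 < 1 + r ^ 2 := by positivity
  rw [k1f, abs_div, abs_of_pos (pow_pos h 2), div_le_iff₀ (pow_pos h 2)]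
  have : (1 + r ^ 2)⁻¹ * (1 + r ^ 2) ^ 2 = 1 + r ^ 2 := by field_simp
  rw [this, abs_le]
  constructor <;> nlinarith [sq_nonneg (r - 1), sq_nonneg (r + 1)]

lemma k2f_le (r : ℝ) : |k2f r| ≤ (1 + r ^ 2)⁻¹ := by
  have h : 0 < 1 + r ^ 2 := by positivity
  rw [k2f, abs_div, abs_of_pos (pow_pos h 2), div_le_iff₀ (pow_pos h 2)]
  have : (1 + r ^ 2)⁻¹ * (1 + r ^ 2) ^ 2 = 1 + r ^ 2 := by field_simp
  rw [this, abs_le]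
  constructor <;> nlinarith [sq_nonneg r]

lemma k1f_meas : Measurable k1f := by unfold k1f; fun_prop
lemma k2f_meas : Measurable k2f := by unfold k2f; fun_prop

lemma k1f_int : Integrable k1f := integrable_inv_one_add_sq.mono' k1f_meas.aestronglyMeasurable
  (Filter.Eventually.of_forall k1f_le)
lemma k2f_int : Integrable k2f := integrable_inv_one_add_sq.mono' k2f_meas.aestronglyMeasurable
  (Filter.Eventually.of_forall k2f_le)

lemma inv_sq_le_one (r : ℝ) : (1 + r ^ 2)⁻¹ ≤ 1 := inv_le_one_of_one_le₀ (by nlinarith [sq_nonneg r])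

lemma rk_k1 {δ : ℝ} (hδ : 0 < δ) (t s : ℝ) :
    rk δ k1f (t, s) = if δ < |s| then κ1 t |s| else 0 := by
  by_cases h : δ < |s|
  · have hs : s ≠ 0 := by rintro rfl; simp at h; linarith
    have hs' : |s| ≠ 0 := abs_ne_zero.2 hs
    simp only [rk, tk, if_pos h, k1f, κ1, sq_abs]
    have e : t ^ 2 + s ^ 2 ≠ 0 := by positivity
    have e' : 1 + (t / s) ^ 2 ≠ 0 := by positivity
    have : 1 + (t / s) ^ 2 = (t ^ 2 + s ^ 2) / s ^ 2 := by field_simp; ring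
    rw [this]
    field_simp
    rw [sq_abs]
  · simp [rk, tk, h]

lemma rk_k2 {δ : ℝ} (hδ : 0 < δ) (t s : ℝ) :
    rk δ k2f (t, s) = if δ < |s| then s / |s| * κ2 t |s| else 0 := by
  by_cases h : δ < |s|
  · have hs : s ≠ 0 := by rintro rfl; simp at h; linarith
    have hs' : |s| ≠ 0 := abs_ne_zero.2 hs
    simp only [rk, tk, if_pos h, k2f, κ2, sq_abs]
    have e : t ^ 2 + s ^ 2 ≠ 0 := by positivity
    have e' : 1 + (t / s) ^ 2 ≠ 0 := by positivity
    have : 1 + (t / s) ^ 2 = (t ^ 2 + s ^ 2) / s ^ 2 := by field_simp; ring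
    rw [this]
    field_simp
  · simp [rk, tk, h]

lemma κ1_le (t s : ℝ) : |κ1 t s| ≤ (t ^ 2 + s ^ 2)⁻¹ := by
  rcases eq_or_ne (t ^ 2 + s ^ 2) 0 with h | h
  · simp [κ1, h]
  have h : 0 < t ^ 2 + s ^ 2 := lt_of_le_of_ne (by positivity) h.symm
  rw [κ1, abs_div, abs_of_pos (pow_pos h 2), div_le_iff₀ (pow_pos h 2)]
  have : (t ^ 2 + s ^ 2)⁻¹ * (t ^ 2 + s ^ 2) ^ 2 = t ^ 2 + s ^ 2 := by field_simp
  rw [this, abs_le]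
  constructor <;> nlinarith [sq_nonneg (s - t), sq_nonneg (s + t)]

lemma κ2_le (t s : ℝ) : |κ2 t s| ≤ (t ^ 2 + s ^ 2)⁻¹ := by
  rcases eq_or_ne (t ^ 2 + s ^ 2) 0 with h | h
  · simp [κ2, h]
  have h : 0 < t ^ 2 + s ^ 2 := lt_of_le_of_ne (by positivity) h.symm
  rw [κ2, abs_div, abs_of_pos (pow_pos h 2), div_le_iff₀ (pow_pos h 2)]
  have : (t ^ 2 + s ^ 2)⁻¹ * (t ^ 2 + s ^ 2) ^ 2 = t ^ 2 + s ^ 2 := by field_simp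
  rw [this, abs_le]
  constructor <;> nlinarith [sq_nonneg s, sq_nonneg t]

lemma inv_le_pk {δ t s : ℝ} (hδ : 0 < δ) (h : δ ≤ |s|) : (t ^ 2 + s ^ 2)⁻¹ ≤ 1 / δ * pk δ t := by
  have : 1 / δ * pk δ t = (t ^ 2 + δ ^ 2)⁻¹ := by unfold pk; field_simp
  rw [this]
  have : δ ^ 2 ≤ s ^ 2 := by rw [← sq_abs s]; gcongr
  gcongr

lemma abs_div_abs_le (s : ℝ) : abs (s / |s|) ≤ 1 := by
  rw [abs_div, abs_abs]; exact div_self_le_one _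

lemma rk_k2_le {δ : ℝ} (hδ : 0 < δ) (x : ℝ × ℝ) : |rk δ k2f x| ≤ 1 / δ * pk δ x.1 := by
  rcases x with ⟨t, s⟩
  rw [rk_k2 hδ]
  split_ifs with h
  · rw [abs_mul]
    refine le_trans (mul_le_of_le_one_left (abs_nonneg _) (abs_div_abs_le s)) ((κ2_le _ _).trans ?_)
    exact inv_le_pk hδ (by rw [abs_abs]; exact h.le)
  · rw [abs_zero]; exact mul_nonneg (by positivity) (pk_nonneg hδ _)

lemma pk_prod_integrable {δ : ℝ} (hδ : 0 < δ) {g : ℝ × ℝ → ℂ} (hg : Integrable g) (hgm : Measurable g) :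
    Integrable (fun w : ℝ × (ℝ × ℝ) => pk δ (w.1 - w.2.1) * ‖g w.2‖) := by
  have hm : Measurable (fun w : ℝ × (ℝ × ℝ) => pk δ (w.1 - w.2.1) * ‖g w.2‖) :=
    (((pk_cont hδ).measurable).comp (by fun_prop)).mul ((hgm.comp measurable_snd).norm)
  rw [Measure.volume_eq_prod, integrable_prod_iff' hm.aestronglyMeasurable]
  constructor
  · exact Filter.Eventually.of_forall fun x => (((pk_integrable hδ).comp_sub_right x.1).mul_const ‖g x‖)
  · have : (fun y : ℝ × ℝ => ∫ x : ℝ, ‖pk δ (x - y.1) * ‖g y‖‖) = fun y => π * ‖g y‖ := by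
      ext y
      simp only [norm_mul, norm_norm, Real.norm_of_nonneg (pk_nonneg hδ _)]
      rw [integral_mul_const, integral_sub_right_eq_self (fun x => pk δ x), pk_integral hδ]
    rw [this]
    exact hg.norm.const_mul _

def kB (δ ε : ℝ) (x : ℝ × ℝ) : ℝ := if δ < |x.2| then x.2 / |x.2| * κ1 x.1 (|x.2| + ε) else 0

lemma kB_meas (δ ε : ℝ) : Measurable (kB δ ε) := by
  unfold kB κ1
  refine Measurable.ite (measurableSet_lt measurable_const (by fun_prop)) (by fun_prop) (by fun_prop)

lemma inv_sq_le {δ t s : ℝ} (hδ : 0 < δ) (h : δ ≤ s) : (t ^ 2 + s ^ 2)⁻¹ ≤ 1 / δ ^ 2 := by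
  rw [one_div]
  have : δ ^ 2 ≤ s ^ 2 := by gcongr
  have : δ ^ 2 ≤ t ^ 2 + s ^ 2 := by nlinarith [sq_nonneg t]
  gcongr

lemma kB_le {δ ε : ℝ} (hδ : 0 < δ) (hε : 0 ≤ ε) (x : ℝ × ℝ) : |kB δ ε x| ≤ 1 / δ ^ 2 := by
  unfold kB
  split_ifs with h
  · rw [abs_mul]
    refine le_trans (mul_le_of_le_one_left (abs_nonneg _) (abs_div_abs_le _)) ((κ1_le _ _).trans ?_)
    exact inv_sq_le hδ (by linarith)
  · rw [abs_zero]; positivity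

lemma rk_prod_integrable {δ : ℝ} (hδ : 0 < δ) {g : ℝ × ℝ → ℂ} (hg : BC2 g) (φ : ℝ) {m : ℝ → ℝ}
    (hm : Measurable m) {C : ℝ} (hC : ∀ y, |m y| ≤ C) :
    Integrable (fun w : ℝ × (ℝ × ℝ) => (m w.1 * rk δ k2f ((w.1, φ) - w.2)) • g w.2) := by
  refine ((pk_prod_integrable hδ hg.integrable hg.meas).const_mul (C * (1 / δ))).mono' ?_ ?_
  · apply Measurable.aestronglyMeasurable
    exact ((hm.comp measurable_fst).mul ((rk_meas δ k2f_meas).comp (by fun_prop))).smul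
      (hg.meas.comp measurable_snd)
  · refine Filter.Eventually.of_forall fun w => ?_
    rw [norm_smul, norm_mul, Real.norm_eq_abs, Real.norm_eq_abs]
    have h1 := rk_k2_le hδ ((w.1, φ) - w.2)
    have h2 := hC w.1
    have h3 : 0 ≤ C := (abs_nonneg _).trans h2
    calc |m w.1| * |rk δ k2f ((w.1, φ) - w.2)| * ‖g w.2‖
        ≤ C * (1 / δ * pk δ ((w.1, φ) - w.2).1) * ‖g w.2‖ := by gcongr
      _ = _ := by simp only [Prod.fst_sub]; ring

lemma T2_int {δ : ℝ} (hδ : 0 < δ) {g : ℝ × ℝ → ℂ} (hg : BC2 g) (φ : ℝ) :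
    Integrable (fun y => cv (rk δ k2f) g (y, φ)) := by
  have h := (rk_prod_integrable hδ hg φ (m := fun _ => 1) (by fun_prop) (C := 1) (by simp)).integral_prod_left
  simp only [one_mul] at h
  simp_rw [cv_eq]
  exact h

lemma kB_id {δ ε : ℝ} (hδ : 0 < δ) (hε : 0 < ε) {g : ℝ × ℝ → ℂ} (hg : BC2 g) (z φ : ℝ) :
    ∫ y, qk ε (z - y) • cv (rk δ k2f) g (y, φ) = (-π : ℝ) • cv (kB δ ε) g (z, φ) := by
  have h := (rk_prod_integrable hδ hg φ (m := fun y => qk ε (z - y))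
    ((qk_cont hε).measurable.comp (by fun_prop)) (C := 1 / ε) (fun y => qk_le hε _))
  have h2 := integral_integral_swap (f := fun (y : ℝ) (x : ℝ × ℝ) => (qk ε (z - y) * rk δ k2f ((y, φ) - x)) • g x) h
  have e1 : ∀ y, qk ε (z - y) • cv (rk δ k2f) g (y, φ) =
      ∫ x, (qk ε (z - y) * rk δ k2f ((y, φ) - x)) • g x := by
    intro y
    rw [cv_eq, ← integral_smul]
    simp only [smul_smul]
  simp_rw [e1]
  rw [h2, cv_eq, ← integral_smul]
  refine integral_congr_ae (Filter.Eventually.of_forall fun x => ?_)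
  simp only
  rw [integral_smul_const, smul_smul]
  congr 1
  rcases x with ⟨x1, x2⟩
  simp only [Prod.mk_sub_mk]
  simp_rw [rk_k2 hδ]
  unfold kB
  simp only
  split_ifs with h
  · have hs : 0 < |φ - x2| := hδ.trans h
    rw [← integral_add_right_eq_self _ x1]
    simp only [add_sub_cancel_right]
    have := qk_conv_κ2 hε hs (z - x1)
    calc _ = (φ - x2) / |φ - x2| * ∫ y, qk ε (z - x1 - y) * κ2 y |φ - x2| := by
          rw [← integral_const_mul]; congr 1; ext y
          rw [show z - (y + x1) = z - x1 - y by ring]; ring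
      _ = _ := by rw [this]; ring
  · simp

lemma kB_bound {q : ℝ} (hq : 1 < q) : ∃ C : ℝ≥0∞, C ≠ ⊤ ∧ ∀ δ > 0, ∀ g, BC2 g →
      ∫⁻ x, ‖cv (kB δ 0) g x‖ₑ ^ q ≤ C * ∫⁻ x, ‖g x‖ₑ ^ q := by
  obtain ⟨C1, hC1, h1⟩ := rk_bound hq (fun r => (k2f_le r).trans (inv_sq_le_one r)) k2f_meas k2f_int
  obtain ⟨C2, hC2, h2⟩ := qk_bound hq
  refine ⟨C2 * C1, ENNReal.mul_ne_top hC2 hC1, fun δ hδ g hg => ?_⟩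
  have hlim : ∀ x, Filter.Tendsto (fun n : ℕ => cv (kB δ (1 / ((n : ℝ) + 1))) g x) Filter.atTop
      (nhds (cv (kB δ 0) g x)) := by
    intro x
    refine tendsto_integral_of_dominated_convergence (fun y => 1 / δ ^ 2 * ‖g (x - y)‖)
      (fun n => (cv_integrable (kB_meas _ _) (kB_le hδ (by positivity)) hg.integrable x).aestronglyMeasurable)
      ((hg.integrable.comp_sub_left x).norm.const_mul _)
      (fun n => Filter.Eventually.of_forall fun y => ?_)
      (Filter.Eventually.of_forall fun y => ?_)
    · rw [norm_smul, Real.norm_eq_abs]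
      gcongr
      exact kB_le hδ (by positivity) _
    · refine Filter.Tendsto.smul_const ?_ _
      unfold kB
      split_ifs with h
      · refine Filter.Tendsto.const_mul _ ?_
        have hs : 0 < |y.2| := hδ.trans h
        have hc : ContinuousAt (fun ε => κ1 y.1 (|y.2| + ε)) 0 := by
          unfold κ1
          refine ContinuousAt.div (by fun_prop) (by fun_prop) ?_
          have : 0 < |y.2| + 0 := by linarith
          positivity
        exact hc.tendsto.comp tendsto_one_div_add_atTop_nhds_zero_nat
      · exact tendsto_const_nhds
  refine fatou_bound (by linarith : 0 < q) (u := fun (n : ℕ) x => cv (kB δ (1 / ((n : ℝ) + 1))) g x)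
    (fun n => cv_meas (kB_meas _ _) hg.meas) (Filter.Eventually.of_forall hlim) (fun n => ?_)
  have hε : (0:ℝ) < 1 / ((n : ℝ) + 1) := by positivity
  have hT : Measurable (cv (rk δ k2f) g) := cv_meas (rk_meas δ k2f_meas) hg.meas
  calc ∫⁻ x, ‖cv (kB δ (1 / ((n : ℝ) + 1))) g x‖ₑ ^ q
      ≤ ∫⁻ φ : ℝ, ∫⁻ z : ℝ, ‖cv (kB δ (1 / ((n : ℝ) + 1))) g (z, φ)‖ₑ ^ q := by
        rw [Measure.volume_eq_prod, lintegral_prod_symm]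
        exact ((cv_meas (kB_meas _ _) hg.meas).enorm.pow_const q).aemeasurable
    _ ≤ ∫⁻ φ : ℝ, C2 * ∫⁻ z : ℝ, ‖cv (rk δ k2f) g (z, φ)‖ₑ ^ q := by
        refine lintegral_mono fun φ => ?_
        refine le_trans (lintegral_mono fun z => ?_) (h2 _ hε _ (hT.comp (by fun_prop)) (T2_int hδ hg φ))
        refine ENNReal.rpow_le_rpow ?_ (by linarith)
        rw [kB_id hδ hε hg, enorm_smul]
        refine le_mul_of_one_le_left (zero_le) ?_
        rw [enorm_neg, ← ofReal_norm, Real.norm_eq_abs, abs_of_pos pi_pos]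
        exact ENNReal.one_le_ofReal.2 (by linarith [pi_gt_three])
    _ = C2 * ∫⁻ x, ‖cv (rk δ k2f) g x‖ₑ ^ q := by
        rw [lintegral_const_mul', Measure.volume_eq_prod, lintegral_prod_symm]
        · exact (hT.enorm.pow_const q).aemeasurable
        · exact hC2
    _ ≤ C2 * (C1 * ∫⁻ x, ‖g x‖ₑ ^ q) := by gcongr; exact h1 δ hδ g hg
    _ = _ := by rw [mul_assoc]

def kK (δ : ℝ) (x : ℝ × ℝ) : ℝ := if δ < x.2 then κ1 x.1 x.2 else 0

lemma kK_meas (δ : ℝ) : Measurable (kK δ) := by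
  unfold kK κ1
  refine Measurable.ite (measurableSet_lt measurable_const (by fun_prop)) (by fun_prop) (by fun_prop)

lemma kK_le {δ : ℝ} (hδ : 0 < δ) (x : ℝ × ℝ) : |kK δ x| ≤ 1 / δ ^ 2 := by
  unfold kK
  split_ifs with h
  · exact (κ1_le _ _).trans (inv_sq_le hδ h.le)
  · rw [abs_zero]; positivity

lemma kK_eq {δ : ℝ} (hδ : 0 < δ) (x : ℝ × ℝ) : kK δ x = 2⁻¹ * rk δ k1f x + 2⁻¹ * kB δ 0 x := by
  rcases x with ⟨t, s⟩
  rw [rk_k1 hδ]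
  unfold kK kB
  simp only [add_zero]
  rcases lt_trichotomy s 0 with h | h | h
  · rw [if_neg (by linarith), abs_of_neg h]
    split_ifs
    · have : s / -s = -1 := by rw [div_neg, div_self h.ne]
      rw [this]; ring
    · ring
  · subst h; simp [not_lt.2 hδ.le]
  · rw [abs_of_pos h]
    split_ifs
    · rw [div_self h.ne']; ring
    · ring

lemma K_bound {q : ℝ} (hq : 1 < q) : ∃ C : ℝ≥0∞, C ≠ ⊤ ∧ ∀ δ > 0, ∀ g, BC2 g →
      ∫⁻ x, ‖cv (kK δ) g x‖ₑ ^ q ≤ C * ∫⁻ x, ‖g x‖ₑ ^ q := by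
  obtain ⟨C1, hC1, h1⟩ := rk_bound hq (fun r => (k1f_le r).trans (inv_sq_le_one r)) k1f_meas k1f_int
  obtain ⟨C2, hC2, h2⟩ := kB_bound hq
  refine ⟨2 ^ (q - 1) * (C1 + C2), ENNReal.mul_ne_top (ENNReal.rpow_ne_top_of_nonneg (by linarith) (by simp))
    (ENNReal.add_ne_top.2 ⟨hC1, hC2⟩), fun δ hδ g hg => ?_⟩
  have hA : Measurable (cv (rk δ k1f) g) := cv_meas (rk_meas δ k1f_meas) hg.meas
  calc ∫⁻ x, ‖cv (kK δ) g x‖ₑ ^ q ≤ ∫⁻ x, (‖cv (rk δ k1f) g x‖ₑ + ‖cv (kB δ 0) g x‖ₑ) ^ q := by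
        refine lintegral_mono fun x => ENNReal.rpow_le_rpow ?_ (by linarith)
        have : cv (kK δ) g x = (2⁻¹ : ℝ) • cv (rk δ k1f) g x + (2⁻¹ : ℝ) • cv (kB δ 0) g x := by
          unfold cv
          rw [← integral_smul, ← integral_smul, ← integral_add]
          · simp_rw [kK_eq hδ, add_smul, mul_smul]
          · exact (cv_integrable (rk_meas δ k1f_meas)
              (rk_le hδ (fun r => (k1f_le r).trans (inv_sq_le_one r))) hg.integrable x).smul _
          · exact (cv_integrable (kB_meas δ 0)
              (kB_le hδ le_rfl) hg.integrable x).smul _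
        rw [this]
        have h2e : ‖(2⁻¹ : ℝ)‖ₑ ≤ 1 := by
          rw [← ofReal_norm]; simp
        refine (enorm_add_le _ _).trans ?_
        rw [enorm_smul, enorm_smul]
        gcongr
        · exact mul_le_of_le_one_left zero_le h2e
        · exact mul_le_of_le_one_left zero_le h2e
    _ ≤ _ := add_pow_lint hq hA.enorm.aemeasurable
    _ ≤ 2 ^ (q - 1) * ((C1 * ∫⁻ x, ‖g x‖ₑ ^ q) + (C2 * ∫⁻ x, ‖g x‖ₑ ^ q)) := by
        gcongr
        · exact h1 δ hδ g hg
        · exact h2 δ hδ g hg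
    _ = _ := by ring

lemma scale_lint {c : ℝ} (hc : 0 < c) {f : ℝ → ℝ≥0∞} (hf : Measurable f) :
    ∫⁻ x, f x = ENNReal.ofReal c * ∫⁻ x, f (c * x) := by
  conv_lhs => rw [← Real.smul_map_volume_mul_left hc.ne']
  rw [lintegral_smul_measure, lintegral_map hf (by fun_prop), abs_of_pos hc, smul_eq_mul]

lemma rpow_sub_one_le {a r : ℝ} (ha : a < 1) (h0 : 0 < r) (h1 : r < 1) :
    |r ^ (-a) - 1| ≤ max 1 (-a) * (1 - r) * r ^ (-max a 0) := by
  rcases le_or_gt 0 a with h | h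
  · have e1 : r ^ a ≤ 1 := rpow_le_one h0.le h1.le h
    have e2 : r ≤ r ^ a := by
      calc r = r ^ (1:ℝ) := (rpow_one r).symm
        _ ≤ r ^ a := rpow_le_rpow_of_exponent_ge h0 h1.le ha.le
    have e3 : 0 < r ^ a := rpow_pos_of_pos h0 a
    rw [max_eq_left h, max_eq_left (by linarith), one_mul, rpow_neg h0.le]
    have e4 : (r ^ a)⁻¹ - 1 = (1 - r ^ a) * (r ^ a)⁻¹ := by field_simp
    rw [e4, abs_of_nonneg (mul_nonneg (by linarith) (by positivity))]
    gcongr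
  · rw [max_eq_right h.le, neg_zero, rpow_zero, mul_one]
    have e1 : r ^ (-a) ≤ 1 := rpow_le_one h0.le h1.le (by linarith)
    rw [abs_of_nonpos (by linarith)]
    rcases le_or_gt 1 (-a) with h2 | h2
    · rw [max_eq_right h2]
      have := one_add_mul_self_le_rpow_one_add (s := r - 1) (by linarith) h2
      rw [add_sub_cancel] at this
      linarith
    · rw [max_eq_left h2.le]
      have e2 : r ≤ r ^ (-a) := by
        calc r = r ^ (1:ℝ) := (rpow_one r).symm
          _ ≤ r ^ (-a) := rpow_le_rpow_of_exponent_ge h0 h1.le h2.le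
      linarith

lemma BC2.weight {g : ℝ × ℝ → ℂ} (hg : BC2 g) (a : ℝ) {φ0 : ℝ} (h0 : 0 < φ0)
    (hs : ∀ x : ℝ × ℝ, x.2 < φ0 → g x = 0) : BC2 fun x => (x.2 ^ a : ℝ) • g x := by
  obtain ⟨M, hM⟩ := hg.bdd
  obtain ⟨R, hR⟩ := hg.supp
  refine ⟨?_, ⟨max (φ0 ^ a) (R ^ a) * M, fun x => ?_⟩, R, fun x hx => by rw [hR x hx, smul_zero]⟩
  · exact ((measurable_snd.pow_const a)).smul hg.meas
  · have hM0 : 0 ≤ M := (norm_nonneg _).trans (hM 0)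
    have hm : 0 < max (φ0 ^ a) (R ^ a) := lt_max_of_lt_left (rpow_pos_of_pos h0 a)
    by_cases h : x.2 < φ0
    · rw [hs x h, smul_zero, norm_zero]; positivity
    by_cases h' : R < |x.2|
    · rw [hR x (Or.inr h'), smul_zero, norm_zero]; positivity
    push Not at h h'
    have hx : 0 < x.2 := h0.trans_le h
    rw [abs_of_pos hx] at h'
    rw [norm_smul, Real.norm_of_nonneg (rpow_nonneg hx.le a)]
    refine mul_le_mul ?_ (hM x) (norm_nonneg _) hm.le
    rcases le_or_gt 0 a with ha | ha
    · exact (rpow_le_rpow hx.le h' ha).trans (le_max_right _ _)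
    · exact (rpow_le_rpow_of_nonpos h0 h ha.le).trans (le_max_left _ _)

def cE (a q : ℝ) (w : ℝ × ℝ) : ℝ≥0∞ :=
  (Ioo (0:ℝ) 1).indicator (fun r => ENNReal.ofReal (max 1 (-a) * r ^ (-max a 0 - 1 / q))) w.1 *
    ENNReal.ofReal ((1 + w.2 ^ 2)⁻¹)

lemma cE_meas (a q : ℝ) : Measurable (cE a q) := by
  unfold cE
  refine Measurable.mul ?_ (by fun_prop)
  refine Measurable.comp (Measurable.indicator ?_ measurableSet_Ioo) measurable_fst
  fun_prop

lemma cE_fin {a q : ℝ} (hq : 1 < q) (ha : a + 1 / q < 1) : ∫⁻ w, cE a q w ≠ ⊤ := by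
  unfold cE
  rw [Measure.volume_eq_prod, lintegral_prod_mul
    (f := (Ioo (0:ℝ) 1).indicator (fun r => ENNReal.ofReal (max 1 (-a) * r ^ (-max a 0 - 1 / q))))
    (g := fun y : ℝ => ENNReal.ofReal ((1 + y ^ 2)⁻¹))
    (Measurable.indicator (by fun_prop) measurableSet_Ioo).aemeasurable (by fun_prop)]
  refine ENNReal.mul_ne_top ?_ ?_
  · rw [lintegral_indicator measurableSet_Ioo]
    have h1 : -1 < -max a 0 - 1 / q := by
      have : max a 0 < 1 - 1 / q := max_lt (by linarith) (by
        have : 1 / q < 1 := by rw [div_lt_one (by linarith)]; exact hq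
        linarith)
      linarith
    have h2 : IntegrableOn (fun r : ℝ => max 1 (-a) * r ^ (-max a 0 - 1 / q)) (Ioo 0 1) :=
      ((intervalIntegral.integrableOn_Ioo_rpow_iff one_pos).2 h1).const_mul _
    exact h2.lintegral_lt_top.ne
  · exact (integrable_inv_one_add_sq.lintegral_lt_top).ne

def FE (h : ℝ × ℝ → ℂ) (q : ℝ) (w x : ℝ × ℝ) : ℝ≥0∞ :=
  ENNReal.ofReal ((max w.1 0) ^ (1 / q)) * ‖h (x.1 - x.2 * (1 - w.1) * w.2, x.2 * w.1)‖ₑ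

lemma FE_meas {h : ℝ × ℝ → ℂ} (hh : Measurable h) (q : ℝ) : Measurable (Function.uncurry (FE h q)) := by
  unfold FE Function.uncurry
  refine Measurable.mul (by fun_prop) (Measurable.enorm (hh.comp (by fun_prop)))

lemma FE_bound {h : ℝ × ℝ → ℂ} (hh : Measurable h) {q : ℝ} (hq : 1 < q) (w : ℝ × ℝ) :
    ∫⁻ x, FE h q w x ^ q ≤ ∫⁻ x, ‖h x‖ₑ ^ q := by
  have hq0 : 0 < q := by linarith
  rcases le_or_gt w.1 0 with h0 | h0
  · have : ∀ x, FE h q w x ^ q = 0 := fun x => by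
      unfold FE
      rw [max_eq_right h0, zero_rpow (by positivity), ENNReal.ofReal_zero, zero_mul, ENNReal.zero_rpow_of_pos hq0]
    simp [this]
  · have e : ∀ x, FE h q w x ^ q = ENNReal.ofReal w.1 *
        ‖h (x.1 - x.2 * (1 - w.1) * w.2, x.2 * w.1)‖ₑ ^ q := fun x => by
      unfold FE
      rw [max_eq_left h0.le, ENNReal.mul_rpow_of_nonneg _ _ hq0.le,
        ENNReal.ofReal_rpow_of_nonneg (by positivity) hq0.le, ← rpow_mul h0.le, one_div,
        inv_mul_cancel₀ hq0.ne', rpow_one]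
    simp_rw [e]
    have hm : Measurable fun x => ‖h x‖ₑ ^ q := hh.enorm.pow_const q
    have hm2 : Measurable fun x : ℝ × ℝ => ‖h (x.1 - x.2 * (1 - w.1) * w.2, x.2 * w.1)‖ₑ ^ q :=
      hm.comp (g := fun x => ‖h x‖ₑ ^ q) (by fun_prop)
    rw [lintegral_const_mul _ hm2, Measure.volume_eq_prod, lintegral_prod_symm _ hm2.aemeasurable,
      lintegral_prod_symm _ hm.aemeasurable]
    have e2 : ∀ y : ℝ, ∫⁻ x : ℝ, ‖h (x - y * (1 - w.1) * w.2, y * w.1)‖ₑ ^ q = ∫⁻ x : ℝ, ‖h (x, w.1 * y)‖ₑ ^ q := by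
      intro y
      rw [mul_comm w.1 y]
      exact lintegral_sub_right_eq_self (fun x => ‖h (x, y * w.1)‖ₑ ^ q) _
    simp only [e2]
    rw [scale_lint h0 (f := fun y => ∫⁻ x : ℝ, ‖h (x, y)‖ₑ ^ q)]
    exact hm.lintegral_prod_left'

lemma D_bound {a q : ℝ} (hq : 1 < q) (ha : a < 1) {h : ℝ × ℝ → ℂ} (hh : Measurable h)
    {z φ : ℝ} (hφ : 0 < φ) :
    ∫⁻ x : ℝ × ℝ, (Ioo 0 φ).indicator (fun y => ENNReal.ofReal |(y / φ) ^ (-a) - 1|) x.2 *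
      ENNReal.ofReal (((z - x.1) ^ 2 + (φ - x.2) ^ 2)⁻¹) * ‖h x‖ₑ ≤
    ∫⁻ w, cE a q w * FE h q w (z, φ) := by
  have hq0 : 0 < q := by linarith
  have m1 : Measurable fun y => (Ioo 0 φ).indicator (fun y => ENNReal.ofReal |(y / φ) ^ (-a) - 1|) y :=
    Measurable.indicator (by fun_prop) measurableSet_Ioo
  have m2 : Measurable fun x : ℝ × ℝ => (Ioo 0 φ).indicator (fun y => ENNReal.ofReal |(y / φ) ^ (-a) - 1|) x.2 *
      ENNReal.ofReal (((z - x.1) ^ 2 + (φ - x.2) ^ 2)⁻¹) * ‖h x‖ₑ :=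
    Measurable.mul (Measurable.mul (m1.comp measurable_snd) (by fun_prop)) hh.enorm
  have m3 : Measurable fun w => cE a q w * FE h q w (z, φ) :=
    (cE_meas a q).mul ((FE_meas hh q).comp (by fun_prop : Measurable fun w : ℝ × ℝ => (w, ((z, φ) : ℝ × ℝ))))
  rw [Measure.volume_eq_prod, lintegral_prod_symm _ m2.aemeasurable, lintegral_prod _ m3.aemeasurable,
    scale_lint hφ m2.lintegral_prod_left', ← lintegral_const_mul' _ _ ENNReal.ofReal_ne_top]
  refine lintegral_mono fun r => ?_
  by_cases hr : r ∈ Ioo (0:ℝ) 1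
  · obtain ⟨h0, h1⟩ := hr
    have h1' : 0 < 1 - r := by linarith
    have hmem : φ * r ∈ Ioo 0 φ := ⟨by positivity, by nlinarith⟩
    have mz : Measurable fun x : ℝ => (Ioo 0 φ).indicator (fun y => ENNReal.ofReal |(y / φ) ^ (-a) - 1|) (φ * r) *
      ENNReal.ofReal (((z - x) ^ 2 + (φ - φ * r) ^ 2)⁻¹) * ‖h (x, φ * r)‖ₑ :=
      m2.comp (by fun_prop : Measurable fun x : ℝ => (x, φ * r))
    simp only
    rw [← lintegral_sub_left_eq_self _ z, scale_lint (f := fun x => (Ioo 0 φ).indicator (fun y => ENNReal.ofReal |(y / φ) ^ (-a) - 1|) (φ * r) *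
            ENNReal.ofReal (((z - (z - x)) ^ 2 + (φ - φ * r) ^ 2)⁻¹) *
          ‖h (z - x, φ * r)‖ₑ) (mul_pos hφ h1') (mz.comp (by fun_prop : Measurable fun x => z - x)),
      ← lintegral_const_mul' _ _ ENNReal.ofReal_ne_top, ← lintegral_const_mul' _ _ ENNReal.ofReal_ne_top]
    refine lintegral_mono fun τ => ?_
    unfold cE FE
    simp only
    rw [indicator_of_mem hmem, indicator_of_mem (show r ∈ Ioo (0:ℝ) 1 from ⟨h0, h1⟩), mul_div_cancel_left₀ _ hφ.ne',
      max_eq_left h0.le, sub_sub_cancel]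
    simp only [← mul_assoc]
    refine mul_le_mul' ?_ le_rfl
    rw [← ENNReal.ofReal_mul (by positivity), ← ENNReal.ofReal_mul (by positivity), ← ENNReal.ofReal_mul (by positivity),
      ← ENNReal.ofReal_mul (by positivity), ← ENNReal.ofReal_mul (by positivity)]
    refine ENNReal.ofReal_le_ofReal ?_
    have e1 : ((φ * (1 - r) * τ) ^ 2 + (φ - φ * r) ^ 2)⁻¹ = (φ * (φ * (1 - r)) * (1 - r))⁻¹ * (1 + τ ^ 2)⁻¹ := by
      rw [← mul_inv]; congr 1; ring
    have e2 : r ^ (-max a 0 - 1 / q) * r ^ (1 / q) = r ^ (-max a 0) := by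
      rw [← rpow_add h0]; congr 1; ring
    rw [e1]
    calc φ * (φ * (1 - r)) * |r ^ (-a) - 1| * ((φ * (φ * (1 - r)) * (1 - r))⁻¹ * (1 + τ ^ 2)⁻¹)
        ≤ φ * (φ * (1 - r)) * (max 1 (-a) * (1 - r) * r ^ (-max a 0)) * ((φ * (φ * (1 - r)) * (1 - r))⁻¹ * (1 + τ ^ 2)⁻¹) := by
          gcongr
          exact rpow_sub_one_le ha h0 h1
      _ = max 1 (-a) * r ^ (-max a 0) * (1 + τ ^ 2)⁻¹ := by field_simp
      _ = _ := by rw [← e2]; ring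
  · have hmem : φ * r ∉ Ioo 0 φ := by
      rintro ⟨h2, h3⟩
      exact hr ⟨by by_contra h; push Not at h; nlinarith, by by_contra h; push Not at h; nlinarith⟩
    simp only [indicator_of_notMem hmem, zero_mul, lintegral_zero, mul_zero]
    exact zero_le

lemma KW_bound {a q : ℝ} (hq : 1 < q) (ha : a + 1 / q < 1) : ∃ C : ℝ≥0∞, C ≠ ⊤ ∧ ∀ δ > 0, ∀ g, BC2 g →
    (∃ φ0 > 0, ∀ x : ℝ × ℝ, x.2 < φ0 → g x = 0) →
      ∫⁻ x in {x : ℝ × ℝ | 0 < x.2}, ‖(x.2 ^ a : ℝ) • cv (kK δ) g x‖ₑ ^ q ≤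
        C * ∫⁻ x, ‖(x.2 ^ a : ℝ) • g x‖ₑ ^ q := by
  have hq0 : 0 < q := by linarith
  have ha1 : a < 1 := by
    have : 0 < 1 / q := by positivity
    linarith
  obtain ⟨C1, hC1, h1⟩ := K_bound hq
  refine ⟨2 ^ (q - 1) * (C1 + (∫⁻ w, cE a q w) ^ q), ENNReal.mul_ne_top (ENNReal.rpow_ne_top_of_nonneg (by linarith) (by simp))
    (ENNReal.add_ne_top.2 ⟨hC1, ENNReal.rpow_ne_top_of_nonneg hq0.le (cE_fin hq ha)⟩), fun δ hδ g hg hs => ?_⟩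
  obtain ⟨φ0, h0, hs⟩ := hs
  have hh : BC2 fun x => (x.2 ^ a : ℝ) • g x := hg.weight a h0 hs
  set h : ℝ × ℝ → ℂ := fun x => (x.2 ^ a : ℝ) • g x with hdef
  have hK : Measurable (cv (kK δ) h) := cv_meas (kK_meas δ) hh.meas
  have key : ∀ x : ℝ × ℝ, 0 < x.2 → ‖(x.2 ^ a : ℝ) • cv (kK δ) g x‖ₑ ≤
      ‖cv (kK δ) h x‖ₑ + ∫⁻ w, cE a q w * FE h q w x := by
    rintro ⟨z, φ⟩ hφ
    simp only at hφ
    have i1 := cv_integrable' (kK_meas δ) (kK_le hδ) hg.integrable (z, φ)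
    have i2 := cv_integrable' (kK_meas δ) (kK_le hδ) hh.integrable (z, φ)
    have e1 : (φ ^ a : ℝ) • cv (kK δ) g (z, φ) = cv (kK δ) h (z, φ) +
        ∫ x, ((φ ^ a : ℝ) • (kK δ ((z, φ) - x) • g x) - kK δ ((z, φ) - x) • h x) := by
      have := integral_sub (i1.smul (φ ^ a : ℝ)) i2
      simp only [Pi.smul_apply] at this
      rw [this, integral_smul, ← cv_eq, ← cv_eq]
      abel
    simp only [e1]
    refine (enorm_add_le _ _).trans ?_
    gcongr
    refine (enorm_integral_le_lintegral_enorm _).trans (le_trans (lintegral_mono fun x => ?_)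
      (D_bound hq ha1 hh.meas hφ))
    rcases x with ⟨x1, x2⟩
    simp only [Prod.mk_sub_mk, kK]
    split_ifs with hc
    · by_cases hx : x2 < φ0
      · simp [hdef, hs (x1, x2) hx]
      push Not at hx
      have hx0 : 0 < x2 := h0.trans_le hx
      have hmem : x2 ∈ Ioo 0 φ := ⟨hx0, by linarith⟩
      rw [indicator_of_mem hmem]
      have e2 : (φ ^ a : ℝ) • (κ1 (z - x1) (φ - x2) • g (x1, x2)) - κ1 (z - x1) (φ - x2) • h (x1, x2)
          = (((x2 / φ) ^ (-a) - 1) * κ1 (z - x1) (φ - x2)) • h (x1, x2) := by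
        simp only [hdef, smul_smul, ← sub_smul]
        congr 1
        rw [div_rpow hx0.le hφ.le, rpow_neg hx0.le, rpow_neg hφ.le]
        have := rpow_pos_of_pos hx0 a
        have := rpow_pos_of_pos hφ a
        field_simp
      rw [e2, enorm_smul, enorm_mul]
      gcongr
      · rw [← ofReal_norm, Real.norm_eq_abs]
      · rw [← ofReal_norm, Real.norm_eq_abs]
        exact ENNReal.ofReal_le_ofReal (κ1_le _ _)
    · simp
  calc ∫⁻ x in {x : ℝ × ℝ | 0 < x.2}, ‖(x.2 ^ a : ℝ) • cv (kK δ) g x‖ₑ ^ q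
      ≤ ∫⁻ x in {x : ℝ × ℝ | 0 < x.2}, (‖cv (kK δ) h x‖ₑ + ∫⁻ w, cE a q w * FE h q w x) ^ q := by
        refine setLIntegral_mono' (measurableSet_lt measurable_const measurable_snd) fun x hx => ?_
        exact ENNReal.rpow_le_rpow (key x hx) hq0.le
    _ ≤ ∫⁻ x, (‖cv (kK δ) h x‖ₑ + ∫⁻ w, cE a q w * FE h q w x) ^ q := setLIntegral_le_lintegral _ _
    _ ≤ _ := add_pow_lint hq hK.enorm.aemeasurable
    _ ≤ 2 ^ (q - 1) * ((C1 * ∫⁻ x, ‖h x‖ₑ ^ q) + ((∫⁻ w, cE a q w) ^ q * ∫⁻ x, ‖h x‖ₑ ^ q)) := by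
        gcongr
        · exact h1 δ hδ h hh
        · exact mink_lint volume volume hq (cE_meas a q) (FE_meas hh.meas q) (fun w => FE_bound hh.meas hq w)
    _ = _ := by ring

lemma pd1_eq {f : ℝ × ℝ → ℂ} (hf : ContDiff ℝ (⊤ : ℕ∞) f) : pd1 f = fun x => fderiv ℝ f x (1, 0) := by
  ext x
  have hd : HasFDerivAt f (fderiv ℝ f x) x := (hf.differentiable (by simp) x).hasFDerivAt
  have h2 : HasDerivAt (fun s : ℝ => ((s, x.2) : ℝ × ℝ)) (1, 0) x.1 :=
    (hasDerivAt_id x.1).prodMk (hasDerivAt_const _ _)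
  exact (HasFDerivAt.comp_hasDerivAt (f := fun s : ℝ => ((s, x.2) : ℝ × ℝ)) x.1 hd h2).deriv

lemma pd2_eq {f : ℝ × ℝ → ℂ} (hf : ContDiff ℝ (⊤ : ℕ∞) f) : pd2 f = fun x => fderiv ℝ f x (0, 1) := by
  ext x
  have hd : HasFDerivAt f (fderiv ℝ f x) x := (hf.differentiable (by simp) x).hasFDerivAt
  have h2 : HasDerivAt (fun s : ℝ => ((x.1, s) : ℝ × ℝ)) (0, 1) x.2 :=
    (hasDerivAt_const _ _).prodMk (hasDerivAt_id x.2)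
  exact (HasFDerivAt.comp_hasDerivAt (f := fun s : ℝ => ((x.1, s) : ℝ × ℝ)) x.2 hd h2).deriv

lemma sm_pd1 {f : ℝ × ℝ → ℂ} (hf : ContDiff ℝ (⊤ : ℕ∞) f) : ContDiff ℝ (⊤ : ℕ∞) (pd1 f) := by
  rw [pd1_eq hf]
  exact (hf.fderiv_right (m := (⊤ : ℕ∞)) (by simp)).clm_apply contDiff_const

lemma sm_pd2 {f : ℝ × ℝ → ℂ} (hf : ContDiff ℝ (⊤ : ℕ∞) f) : ContDiff ℝ (⊤ : ℕ∞) (pd2 f) := by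
  rw [pd2_eq hf]
  exact (hf.fderiv_right (m := (⊤ : ℕ∞)) (by simp)).clm_apply contDiff_const

lemma sm_hd1 {f : ℝ × ℝ → ℂ} (hf : ContDiff ℝ (⊤ : ℕ∞) f) (x y : ℝ) :
    HasDerivAt (fun s => f (s, y)) (pd1 f (x, y)) x := by
  have : ContDiff ℝ (⊤ : ℕ∞) fun s : ℝ => f (s, y) := hf.comp (by fun_prop)
  exact (this.differentiable (by simp) x).hasDerivAt

lemma sm_hd2 {f : ℝ × ℝ → ℂ} (hf : ContDiff ℝ (⊤ : ℕ∞) f) (x y : ℝ) :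
    HasDerivAt (fun s => f (x, s)) (pd2 f (x, y)) y := by
  have : ContDiff ℝ (⊤ : ℕ∞) fun s : ℝ => f (x, s) := hf.comp (by fun_prop)
  exact (this.differentiable (by simp) y).hasDerivAt

lemma pd_comm {f : ℝ × ℝ → ℂ} (hf : ContDiff ℝ (⊤ : ℕ∞) f) : pd1 (pd2 f) = pd2 (pd1 f) := by
  have hf' : ContDiff ℝ (⊤ : ℕ∞) (fderiv ℝ f) := hf.fderiv_right (m := (⊤ : ℕ∞)) (by simp)
  rw [pd1_eq (sm_pd2 hf), pd2_eq (sm_pd1 hf), pd1_eq hf, pd2_eq hf]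
  ext x
  have h1 : HasFDerivAt (fderiv ℝ f) (fderiv ℝ (fderiv ℝ f) x) x :=
    (hf'.differentiable (by simp) x).hasFDerivAt
  have := second_derivative_symmetric (f := f) (fun y => (hf.differentiable (by simp) y).hasFDerivAt) h1 (1, 0) (0, 1)
  have e : ∀ v : ℝ × ℝ, fderiv ℝ (fun x => fderiv ℝ f x v) x = (fderiv ℝ (fderiv ℝ f) x).flip v := fun v => by
    have := h1.clm_apply (hasFDerivAt_const v x)
    simpa using this.fderiv
  simp only [e, ContinuousLinearMap.flip_apply]
  exact this

structure Cc (f : ℝ × ℝ → ℂ) : Prop where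
  sm : ContDiff ℝ (⊤ : ℕ∞) f
  cs : HasCompactSupport f

lemma Cc.pd1 {f : ℝ × ℝ → ℂ} (h : Cc f) : Cc (pd1 f) :=
  ⟨sm_pd1 h.sm, by rw [pd1_eq h.sm]; exact h.cs.fderiv_apply ℝ _⟩

lemma Cc.pd2 {f : ℝ × ℝ → ℂ} (h : Cc f) : Cc (pd2 f) :=
  ⟨sm_pd2 h.sm, by rw [pd2_eq h.sm]; exact h.cs.fderiv_apply ℝ _⟩

lemma Cc.bc2 {f : ℝ × ℝ → ℂ} (h : Cc f) : BC2 f := by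
  refine ⟨h.sm.continuous.measurable, ?_, ?_⟩
  · obtain ⟨M, hM⟩ := h.sm.continuous.bounded_above_of_compact_support h.cs
    exact ⟨M, hM⟩
  · obtain ⟨R, hR⟩ := h.cs.isCompact.isBounded.exists_norm_le
    refine ⟨R, fun x hx => ?_⟩
    by_contra h0
    have := hR x (subset_tsupport _ h0)
    rw [Prod.norm_def, max_le_iff] at this
    rcases hx with hx | hx
    · exact absurd this.1 (not_le.2 hx)
    · exact absurd this.2 (not_le.2 hx)

lemma mul_pd1 {f g : ℝ × ℝ → ℂ} (hf : ContDiff ℝ (⊤ : ℕ∞) f) (hg : ContDiff ℝ (⊤ : ℕ∞) g) :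
    pd1 (fun x => f x * g x) = fun x => pd1 f x * g x + f x * pd1 g x := by
  ext x; exact ((sm_hd1 hf x.1 x.2).mul (sm_hd1 hg x.1 x.2)).deriv

lemma mul_pd2 {f g : ℝ × ℝ → ℂ} (hf : ContDiff ℝ (⊤ : ℕ∞) f) (hg : ContDiff ℝ (⊤ : ℕ∞) g) :
    pd2 (fun x => f x * g x) = fun x => pd2 f x * g x + f x * pd2 g x := by
  ext x; exact ((sm_hd2 hf x.1 x.2).mul (sm_hd2 hg x.1 x.2)).deriv

lemma add_pd1 {f g : ℝ × ℝ → ℂ} (hf : ContDiff ℝ (⊤ : ℕ∞) f) (hg : ContDiff ℝ (⊤ : ℕ∞) g) :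
    pd1 (fun x => f x + g x) = fun x => pd1 f x + pd1 g x := by
  ext x; exact ((sm_hd1 hf x.1 x.2).add (sm_hd1 hg x.1 x.2)).deriv

lemma add_pd2 {f g : ℝ × ℝ → ℂ} (hf : ContDiff ℝ (⊤ : ℕ∞) f) (hg : ContDiff ℝ (⊤ : ℕ∞) g) :
    pd2 (fun x => f x + g x) = fun x => pd2 f x + pd2 g x := by
  ext x; exact ((sm_hd2 hf x.1 x.2).add (sm_hd2 hg x.1 x.2)).deriv

lemma cv_sm {k : ℝ × ℝ → ℝ} (hk : LocallyIntegrable k) {g : ℝ × ℝ → ℂ} (hg : Cc g) :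
    ContDiff ℝ (⊤ : ℕ∞) (cv k g) ∧ pd1 (cv k g) = cv k (pd1 g) ∧ pd2 (cv k g) = cv k (pd2 g) := by
  have e : ∀ f : ℝ × ℝ → ℂ, cv k f = convolution k f (ContinuousLinearMap.lsmul ℝ ℝ) volume := fun f => rfl
  have h1 : ContDiff ℝ (⊤ : ℕ∞) (cv k g) := by
    rw [e]; exact hg.cs.contDiff_convolution_right _ hk hg.sm
  have h2 : ∀ x v, fderiv ℝ (cv k g) x v = cv k (fun y => fderiv ℝ g y v) x := by
    intro x v
    rw [e, (hg.cs.hasFDerivAt_convolution_right (ContinuousLinearMap.lsmul ℝ ℝ) hk (hg.sm.of_le (by simp)) x).fderiv,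
      convolution_precompR_apply _ hk (hg.cs.fderiv ℝ) (hg.sm.continuous_fderiv (by simp)), e]
  refine ⟨h1, ?_, ?_⟩
  · rw [pd1_eq h1, pd1_eq hg.sm]; ext x; exact h2 x _
  · rw [pd2_eq h1, pd2_eq hg.sm]; ext x; exact h2 x _

/-- horizontal convolution at height shift δ -/
def hv (k : ℝ → ℝ) (δ : ℝ) (g : ℝ × ℝ → ℂ) (x : ℝ × ℝ) : ℂ := ∫ t, k t • g (x.1 - t, x.2 - δ)

lemma hv_sm {k : ℝ → ℝ} (hk : Continuous k) (δ : ℝ) {g : ℝ × ℝ → ℂ} (hg : Cc g) :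
    ContDiff ℝ (⊤ : ℕ∞) (hv k δ g) ∧ pd1 (hv k δ g) = hv k δ (pd1 g) := by
  constructor
  · have e : hv k δ g = convolution (fun x : ℝ × ℝ => k x.1) g (ContinuousLinearMap.lsmul ℝ ℝ)
        (Measure.map (fun t : ℝ => ((t, δ) : ℝ × ℝ)) volume) := by
      ext x
      have hm : Continuous fun t : ℝ => ((t, δ) : ℝ × ℝ) := by fun_prop
      rw [convolution_def, integral_map hm.measurable.aemeasurable]
      · rfl
      · apply Continuous.aestronglyMeasurable
        have := hg.sm.continuous
        have : Continuous fun t : ℝ × ℝ => (k t.1) • g (x - t) := by fun_prop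
        exact this
    rw [e]
    refine hg.cs.contDiff_convolution_right _ ?_ hg.sm
    have : IsLocallyFiniteMeasure (Measure.map (fun t : ℝ => ((t, δ) : ℝ × ℝ)) volume) := by
      refine ⟨fun x => ⟨Metric.closedBall x 1, Metric.closedBall_mem_nhds _ one_pos, ?_⟩⟩
      rw [Measure.map_apply (by fun_prop) Metric.isClosed_closedBall.measurableSet]
      refine lt_of_le_of_lt (measure_mono (t := Metric.closedBall x.1 1) fun t ht => ?_) measure_closedBall_lt_top
      rw [mem_preimage, Metric.mem_closedBall, Prod.dist_eq] at ht
      exact (le_max_left _ _).trans ht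
    exact (hk.comp continuous_fst).locallyIntegrable
  · ext x
    have hc : HasCompactSupport fun t => g (t, x.2 - δ) := by
      obtain ⟨R, hR⟩ := hg.bc2.supp
      refine HasCompactSupport.of_support_subset_isCompact (isCompact_Icc (a := -R) (b := R)) fun t ht => ?_
      by_contra h
      exact ht (hR _ (Or.inl (by by_contra h'; push Not at h'; exact h (abs_le.1 h'))))
    have hs : ContDiff ℝ 1 fun t : ℝ => g (t, x.2 - δ) := (hg.sm.comp (by fun_prop)).of_le (by simp)
    have := hc.hasDerivAt_convolution_right (ContinuousLinearMap.lsmul ℝ ℝ) (μ := volume) hk.locallyIntegrable hs x.1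
    exact this.deriv

def cut (δ : ℝ) (m : ℝ × ℝ → ℝ) (x : ℝ × ℝ) : ℝ := if δ < x.2 then m x else 0

lemma cut_meas (δ : ℝ) {m : ℝ × ℝ → ℝ} (hm : Measurable m) : Measurable (cut δ m) :=
  Measurable.ite (measurableSet_lt measurable_const measurable_snd) hm measurable_const

lemma cut_le {δ : ℝ} {m : ℝ × ℝ → ℝ} {C : ℝ} (hC : 0 ≤ C) (h : ∀ t s, δ < s → |m (t, s)| ≤ C) (x : ℝ × ℝ) :
    |cut δ m x| ≤ C := by
  unfold cut
  split_ifs with hx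
  · exact h x.1 x.2 hx
  · rwa [abs_zero]

lemma BC2.slice1 {F : ℝ × ℝ → ℂ} (h : BC2 F) (y : ℝ) : BCm fun t => F (t, y) := by
  obtain ⟨M, hM⟩ := h.bdd
  obtain ⟨R, hR⟩ := h.supp
  exact ⟨h.meas.comp (by fun_prop), ⟨M, fun _ => hM _⟩, ⟨R, fun x hx => hR _ (Or.inl hx)⟩⟩

lemma BC2.slice2 {F : ℝ × ℝ → ℂ} (h : BC2 F) (y : ℝ) : BCm fun t => F (y, t) := by
  obtain ⟨M, hM⟩ := h.bdd
  obtain ⟨R, hR⟩ := h.supp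
  exact ⟨h.meas.comp (by fun_prop), ⟨M, fun _ => hM _⟩, ⟨R, fun x hx => hR _ (Or.inr hx)⟩⟩

lemma ibp_t {δ : ℝ} (hδ : 0 < δ) {m m' : ℝ × ℝ → ℝ} (hm : Measurable m) (hm' : Measurable m') {C C' : ℝ}
    (hC0 : 0 ≤ C) (hC0' : 0 ≤ C') (hC : ∀ t s, δ < s → |m (t, s)| ≤ C) (hC' : ∀ t s, δ < s → |m' (t, s)| ≤ C')
    (hd : ∀ t s, 0 < s → HasDerivAt (fun t => m (t, s)) (m' (t, s)) t)
    {F : ℝ × ℝ → ℂ} (hF : Cc F) (p : ℝ × ℝ) : cv (cut δ m') F p = cv (cut δ m) (pd1 F) p := by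
  have i1 := cv_integrable (cut_meas δ hm') (cut_le hC0' hC') hF.bc2.integrable p
  have i2 := cv_integrable (cut_meas δ hm) (cut_le hC0 hC) hF.pd1.bc2.integrable p
  rw [← sub_eq_zero]
  unfold cv
  rw [← integral_sub i1 i2, Measure.volume_eq_prod, integral_prod_symm (fun x => cut δ m' x • F (p - x) - cut δ m x • pd1 F (p - x)) (i1.sub i2)]
  refine integral_eq_zero_of_ae (Filter.Eventually.of_forall fun s => ?_)
  simp only [Pi.zero_apply, cut]
  by_cases hs : δ < s
  · simp only [if_pos hs]
    have hs0 : 0 < s := hδ.trans hs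
    have j : ∀ {n : ℝ × ℝ → ℝ} {G : ℝ × ℝ → ℂ} {C : ℝ}, Measurable n → (∀ t s, δ < s → |n (t, s)| ≤ C) → BC2 G →
        Integrable fun t => n (t, s) • G (p - (t, s)) := by
      intro n G C hn hnC hG
      have := (hG.slice1 (p.2 - s)).integrable.comp_sub_left p.1
      exact this.bdd_smul C (hn.comp (by fun_prop)).aestronglyMeasurable
        (Filter.Eventually.of_forall fun t => hnC t s hs)
    refine integral_eq_zero_of_hasDerivAt_of_integrable (f := fun t => m (t, s) • F (p - (t, s)))
      (fun t => ?_) ((j hm' hC' hF.bc2).sub (j hm hC hF.pd1.bc2)) (j hm hC hF.bc2)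
    have h1 : HasDerivAt (fun t => F (p - (t, s))) (-(pd1 F (p - (t, s)))) t := by
      have := (sm_hd1 hF.sm (p.1 - t) (p.2 - s)).scomp t ((hasDerivAt_id t).const_sub p.1)
      rw [neg_one_smul] at this; exact this
    refine HasDerivAt.congr_deriv ((hd t s hs0).smul h1) ?_
    rw [smul_neg]; ring
  · simp [if_neg hs]

lemma ibp_s {δ : ℝ} (hδ : 0 < δ) {m m' : ℝ × ℝ → ℝ} (hm : Measurable m) (hm' : Measurable m') {C C' : ℝ}
    (hC0 : 0 ≤ C) (hC0' : 0 ≤ C') (hC : ∀ t s, δ < s → |m (t, s)| ≤ C) (hC' : ∀ t s, δ < s → |m' (t, s)| ≤ C')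
    (hd : ∀ t s, 0 < s → HasDerivAt (fun s => m (t, s)) (m' (t, s)) s)
    {F : ℝ × ℝ → ℂ} (hF : Cc F) (p : ℝ × ℝ) : cv (cut δ m') F p = cv (cut δ m) (pd2 F) p -
      hv (fun t => m (t, δ)) δ F p := by
  have i1 := cv_integrable (cut_meas δ hm') (cut_le hC0' hC') hF.bc2.integrable p
  have i2 := cv_integrable (cut_meas δ hm) (cut_le hC0 hC) hF.pd2.bc2.integrable p
  suffices H : cv (cut δ m') F p - cv (cut δ m) (pd2 F) p = -hv (fun t => m (t, δ)) δ F p by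
    linear_combination H
  rw [hv, ← integral_neg]
  unfold cv
  rw [← integral_sub i1 i2, Measure.volume_eq_prod, integral_prod (fun x => cut δ m' x • F (p - x) - cut δ m x • pd2 F (p - x)) (i1.sub i2)]
  refine integral_congr_ae (Filter.Eventually.of_forall fun t => ?_)
  simp only
  have j : ∀ {n : ℝ × ℝ → ℝ} {G : ℝ × ℝ → ℂ} {C : ℝ}, 0 ≤ C → Measurable n → (∀ t s, δ < s → |n (t, s)| ≤ C) → BC2 G →
      Integrable fun s => cut δ n (t, s) • G (p - (t, s)) := by
    intro n G C h0 hn hnC hG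
    have := (hG.slice2 (p.1 - t)).integrable.comp_sub_left p.2
    exact this.bdd_smul C ((cut_meas δ hn).comp (by fun_prop)).aestronglyMeasurable
      (Filter.Eventually.of_forall fun s => cut_le h0 hnC _)
  have e1 : (fun s => cut δ m' (t, s) • F (p - (t, s)) - cut δ m (t, s) • pd2 F (p - (t, s))) =
      (Ioi δ).indicator fun s => m' (t, s) • F (p - (t, s)) - m (t, s) • pd2 F (p - (t, s)) := by
    ext s
    by_cases hs : δ < s
    · rw [indicator_of_mem (by exact hs)]; simp [cut, hs]
    · rw [indicator_of_notMem (by exact hs)]; simp [cut, hs]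
  have i3 := (j hC0' hm' hC' hF.bc2).sub (j hC0 hm hC hF.pd2.bc2)
  have i3' : Integrable (fun s => cut δ m' (t, s) • F (p - (t, s)) - cut δ m (t, s) • pd2 F (p - (t, s))) := i3
  rw [e1, integrable_indicator_iff measurableSet_Ioi] at i3'
  rw [e1, integral_indicator measurableSet_Ioi]
  have hD : ∀ s, 0 < s → HasDerivAt (fun s => m (t, s) • F (p - (t, s)))
      (m' (t, s) • F (p - (t, s)) - m (t, s) • pd2 F (p - (t, s))) s := by
    intro s hs0
    have h1 : HasDerivAt (fun s => F (p - (t, s))) (-(pd2 F (p - (t, s)))) s := by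
      have := (sm_hd2 hF.sm (p.1 - t) (p.2 - s)).scomp s ((hasDerivAt_id s).const_sub p.2)
      rw [neg_one_smul] at this; exact this
    refine HasDerivAt.congr_deriv ((hd t s hs0).smul h1) ?_
    rw [smul_neg]; ring
  rw [integral_Ioi_of_hasDerivAt_of_tendsto (m := 0) (f := fun s => m (t, s) • F (p - (t, s)))
    (hD δ hδ).continuousAt.continuousWithinAt (fun s hs => hD s (hδ.trans hs)) i3']
  · rw [zero_sub]; rfl
  · obtain ⟨R, hR⟩ := hF.bc2.supp
    refine tendsto_const_nhds.congr' ?_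
    filter_upwards [Filter.eventually_gt_atTop (p.2 + R)] with s hs
    rw [hR, smul_zero]
    right
    rw [lt_abs]; right
    simp only [Prod.snd_sub]; linarith

lemma div_id {δ : ℝ} (hδ : 0 < δ) {g : ℝ × ℝ → ℂ} (hg : Cc g) (x : ℝ × ℝ) :
    cv (kK δ) (pd1 (pd1 g)) x + cv (kK δ) (pd2 (pd2 g)) x =
      hv (pk δ) δ (pd1 (pd2 g)) x - hv (qk δ) δ (pd1 (pd1 g)) x := by
  have eK : kK δ = cut δ (fun x => κ1 x.1 x.2) := rfl
  set P : ℝ × ℝ → ℝ := fun x => pk x.2 x.1 with hP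
  set Q : ℝ × ℝ → ℝ := fun x => qk x.2 x.1 with hQ
  have mP : Measurable P := by rw [hP]; unfold pk; fun_prop
  have mQ : Measurable Q := by rw [hQ]; unfold qk; fun_prop
  have m1 : Measurable fun x : ℝ × ℝ => κ1 x.1 x.2 := by unfold κ1; fun_prop
  have m2 : Measurable fun x : ℝ × ℝ => κ2 x.1 x.2 := by unfold κ2; fun_prop
  have m2' : Measurable fun x : ℝ × ℝ => -κ2 x.1 x.2 := m2.neg
  have inv_le : ∀ s, δ < s → 1 / s ≤ 1 / δ := fun s hs => one_div_le_one_div_of_le hδ hs.le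
  have bP : ∀ t s, δ < s → |P (t, s)| ≤ 1 / δ := fun t s hs => by
    rw [abs_of_nonneg (pk_nonneg (hδ.trans hs) _)]
    exact (pk_le (hδ.trans hs) _).trans (inv_le s hs)
  have bQ : ∀ t s, δ < s → |Q (t, s)| ≤ 1 / δ := fun t s hs => (qk_le (hδ.trans hs) _).trans (inv_le s hs)
  have b1 : ∀ t s, δ < s → |κ1 t s| ≤ 1 / δ ^ 2 := fun t s hs => (κ1_le _ _).trans (inv_sq_le hδ hs.le)
  have b2 : ∀ t s, δ < s → |κ2 t s| ≤ 1 / δ ^ 2 := fun t s hs => (κ2_le _ _).trans (inv_sq_le hδ hs.le)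
  have b2' : ∀ t s, δ < s → |-κ2 t s| ≤ 1 / δ ^ 2 := fun t s hs => by rw [abs_neg]; exact b2 t s hs
  have c0 : 0 ≤ 1 / δ := by positivity
  have c1 : 0 ≤ 1 / δ ^ 2 := by positivity
  have hden : ∀ t s : ℝ, 0 < s → t ^ 2 + s ^ 2 ≠ 0 := fun t s hs => by positivity
  have dPt : ∀ t s, 0 < s → HasDerivAt (fun t => P (t, s)) (κ1 t s) t := fun t s hs => by
    refine HasDerivAt.congr_deriv ((hasDerivAt_const t s).div (((hasDerivAt_id t).pow 2).add_const (s ^ 2)) (hden t s hs)) ?_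
    unfold κ1; simp; ring
  have dPs : ∀ t s, 0 < s → HasDerivAt (fun s => P (t, s)) (-κ2 t s) s := fun t s hs => by
    refine HasDerivAt.congr_deriv ((hasDerivAt_id s).div (((hasDerivAt_id s).pow 2).const_add (t ^ 2)) (hden t s hs)) ?_
    unfold κ2; simp; ring
  have dQt : ∀ t s, 0 < s → HasDerivAt (fun t => Q (t, s)) (κ2 t s) t := fun t s hs => by
    refine HasDerivAt.congr_deriv ((hasDerivAt_id t).div (((hasDerivAt_id t).pow 2).add_const (s ^ 2)) (hden t s hs)) ?_
    unfold κ2; simp; ring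
  have dQs : ∀ t s, 0 < s → HasDerivAt (fun s => Q (t, s)) (κ1 t s) s := fun t s hs => by
    refine HasDerivAt.congr_deriv ((hasDerivAt_const s t).div (((hasDerivAt_id s).pow 2).const_add (t ^ 2)) (hden t s hs)) ?_
    unfold κ1; simp; ring
  rw [eK]
  have I1 := ibp_t hδ mP m1 c0 c1 bP b1 dPt hg.pd2.pd2 x
  have I2 := ibp_s hδ mQ m1 c0 c1 bQ b1 dQs hg.pd1.pd1 x
  have I3 := ibp_t hδ mQ m2 c0 c1 bQ b2 dQt hg.pd2.pd1 x
  have I4 := ibp_s hδ mP m2' c0 c1 bP b2' dPs hg.pd2.pd1 x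
  have I5 : cv (cut δ fun x => -κ2 x.1 x.2) (pd1 (pd2 g)) x = -cv (cut δ fun x => κ2 x.1 x.2) (pd1 (pd2 g)) x := by
    unfold cv
    rw [← integral_neg]
    congr 1; ext y
    rw [← neg_smul]; congr 1
    unfold cut; split_ifs <;> simp
  have e1 : pd2 (pd1 (pd1 g)) = pd1 (pd1 (pd2 g)) := by rw [← pd_comm hg.pd1.sm, ← pd_comm hg.sm]
  have e2 : pd2 (pd1 (pd2 g)) = pd1 (pd2 (pd2 g)) := by rw [← pd_comm hg.pd2.sm]
  rw [e1] at I2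
  rw [e2] at I4
  have eh : hv (fun t => P (t, δ)) δ = hv (pk δ) δ := rfl
  have eh' : hv (fun t => Q (t, δ)) δ = hv (qk δ) δ := rfl
  rw [eh, I5] at I4
  rw [eh'] at I2
  rw [I1, I2, ← I3]
  linear_combination -I4

lemma hv_meas {k : ℝ → ℝ} (hk : Measurable k) (δ : ℝ) {g : ℝ × ℝ → ℂ} (hg : Measurable g) : Measurable (hv k δ g) := by
  have : StronglyMeasurable (Function.uncurry fun (p : ℝ × ℝ) (t : ℝ) => k t • g (p.1 - t, p.2 - δ)) := by
    apply Measurable.stronglyMeasurable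
    exact (hk.comp measurable_snd).smul (hg.comp (by fun_prop))
  exact this.integral_prod_right.measurable

lemma hv_lint {q : ℝ} {δ : ℝ} {C : ℝ≥0∞}
    (hC : ∀ f : ℝ → ℂ, Measurable f → Integrable f →
      ∫⁻ x, ‖∫ y, qk δ (x - y) • f y‖ₑ ^ q ≤ C * ∫⁻ x, ‖f x‖ₑ ^ q) {G : ℝ × ℝ → ℂ} (hG : BC2 G) :
    ∫⁻ x, ‖hv (qk δ) δ G x‖ₑ ^ q ≤ C * ∫⁻ x, ‖G x‖ₑ ^ q := by
  have hqm : Measurable (qk δ) := by unfold qk; fun_prop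
  have m1 : Measurable fun x => ‖hv (qk δ) δ G x‖ₑ ^ q := (hv_meas hqm δ hG.meas).enorm.pow_const q
  have m2 : Measurable fun x => ‖G x‖ₑ ^ q := hG.meas.enorm.pow_const q
  rw [Measure.volume_eq_prod, lintegral_prod_symm _ m1.aemeasurable, lintegral_prod_symm _ m2.aemeasurable,
    ← lintegral_sub_right_eq_self (fun y => ∫⁻ x, ‖G (x, y)‖ₑ ^ q) δ,
    ← lintegral_const_mul _ (by
      have := m2.lintegral_prod_left' (μ := (volume : Measure ℝ))
      exact this.comp (measurable_id.sub_const δ))]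
  refine lintegral_mono fun y => ?_
  have hs := hG.slice1 (y - δ)
  refine le_trans (le_of_eq ?_) (hC _ hs.meas hs.integrable)
  refine lintegral_congr fun x => ?_
  congr 2
  rw [hv, ← integral_sub_left_eq_self (fun t => qk δ (x - t) • G (t, y - δ)) _ x]
  simp

lemma HQ_bound (a : ℝ) {q : ℝ} (hq : 1 < q) : ∃ C : ℝ≥0∞, C ≠ ⊤ ∧ ∀ δ > 0, ∀ φ0, δ ≤ φ0 → ∀ g : ℝ × ℝ → ℂ,
    BC2 g → (∀ x : ℝ × ℝ, x.2 < φ0 → g x = 0) →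
      ∫⁻ x, ‖(x.2 ^ a : ℝ) • hv (qk δ) δ g x‖ₑ ^ q ≤ C * ∫⁻ x, ‖(x.2 ^ a : ℝ) • g x‖ₑ ^ q := by
  obtain ⟨C, hC, hb⟩ := qk_bound hq
  refine ⟨‖(2 ^ |a| : ℝ)‖ₑ ^ q * C, ENNReal.mul_ne_top (ENNReal.rpow_ne_top_of_nonneg (by linarith) enorm_ne_top) hC,
    fun δ hδ φ0 hφ g hg hs => ?_⟩
  have h := hv_lint (hb δ hδ) (hg.weight a (hδ.trans_le hφ) hs)
  rw [mul_assoc]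
  refine le_trans ?_ (mul_le_mul_right h _)
  rw [← lintegral_const_mul' _ _ (ENNReal.rpow_ne_top_of_nonneg (by linarith) enorm_ne_top)]
  refine lintegral_mono fun x => ?_
  have e : hv (qk δ) δ (fun x => (x.2 ^ a : ℝ) • g x) x = ((x.2 - δ) ^ a : ℝ) • hv (qk δ) δ g x := by
    unfold hv
    rw [← integral_smul]
    congr 1; ext t
    rw [smul_comm]
  rw [← ENNReal.mul_rpow_of_nonneg _ _ (by linarith), e]
  refine ENNReal.rpow_le_rpow ?_ (by linarith)
  by_cases hx : x.2 - δ < φ0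
  · have : hv (qk δ) δ g x = 0 := by
      unfold hv
      refine integral_eq_zero_of_ae (Filter.Eventually.of_forall fun t => ?_)
      simp only [Pi.zero_apply]
      rw [hs _ hx, smul_zero]
    simp [this]
  · push Not at hx
    rw [enorm_smul, enorm_smul, ← mul_assoc, ← enorm_mul]
    refine mul_le_mul_left ?_ _
    have p1 : 0 < x.2 - δ := by linarith
    have p2 : 0 < x.2 := by linarith
    rw [← ofReal_norm_eq_enorm, ← ofReal_norm_eq_enorm]
    refine ENNReal.ofReal_le_ofReal ?_
    rw [Real.norm_of_nonneg (by positivity), Real.norm_of_nonneg (by positivity)]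
    rcases le_total 0 a with ha | ha
    · rw [abs_of_nonneg ha, ← Real.mul_rpow (by norm_num) p1.le]
      exact Real.rpow_le_rpow p2.le (by linarith) ha
    · have : x.2 ^ a ≤ (x.2 - δ) ^ a := Real.rpow_le_rpow_of_nonpos p1 (by linarith) ha
      refine this.trans (le_mul_of_one_le_left (by positivity) ?_)
      exact Real.one_le_rpow (by norm_num) (abs_nonneg a)

/-- The two auxiliary potentials -/
def H2 (δ : ℝ) (g : ℝ × ℝ → ℂ) (x : ℝ × ℝ) : ℂ := cv (kK δ) g x
def H1 (δ : ℝ) (g : ℝ × ℝ → ℂ) (x : ℝ × ℝ) : ℂ := hv (qk δ) δ g x + cv (kK δ) g x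

lemma kK_loc {δ : ℝ} (hδ : 0 < δ) : LocallyIntegrable (kK δ) := by
  refine (locallyIntegrable_const (1 / δ ^ 2)).mono (kK_meas δ).aestronglyMeasurable
    (Filter.Eventually.of_forall fun x => ?_)
  rw [Real.norm_eq_abs]
  exact (kK_le hδ x).trans (le_abs_self _)

lemma H2_sm {δ : ℝ} (hδ : 0 < δ) {g : ℝ × ℝ → ℂ} (hg : Cc g) : ContDiff ℝ (⊤ : ℕ∞) (H2 δ g) := (cv_sm (kK_loc hδ) hg).1

lemma H1_sm {δ : ℝ} (hδ : 0 < δ) {g : ℝ × ℝ → ℂ} (hg : Cc g) : ContDiff ℝ (⊤ : ℕ∞) (H1 δ g) :=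
  (hv_sm (qk_cont hδ) δ hg).1.add (cv_sm (kK_loc hδ) hg).1

lemma H_id {δ : ℝ} (hδ : 0 < δ) {g : ℝ × ℝ → ℂ} (hg : Cc g) (x : ℝ × ℝ) :
    pd1 (pd1 (H1 δ g)) x + pd2 (pd2 (H2 δ g)) x = hv (pk δ) δ (pd1 (pd2 g)) x := by
  have a1 := cv_sm (kK_loc hδ) hg
  have a2 := cv_sm (kK_loc hδ) hg.pd1
  have a3 := cv_sm (kK_loc hδ) hg.pd2
  have b1 := hv_sm (qk_cont hδ) δ hg
  have b2 := hv_sm (qk_cont hδ) δ hg.pd1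
  have e1 : pd1 (H1 δ g) = fun x => hv (qk δ) δ (pd1 g) x + cv (kK δ) (pd1 g) x := by
    unfold H1; rw [add_pd1 b1.1 a1.1, b1.2, a1.2.1]
  have e2 : pd2 (H2 δ g) = cv (kK δ) (pd2 g) := a1.2.2
  rw [e1, e2, add_pd1 b2.1 a2.1, b2.2, a2.2.1, a3.2.2]
  have := div_id hδ hg x
  simp only
  linear_combination this

lemma kK_supp {δ φ0 : ℝ} (hδ : 0 < δ) {g : ℝ × ℝ → ℂ} (hs : ∀ x : ℝ × ℝ, x.2 < φ0 → g x = 0) {x : ℝ × ℝ} (hx : x.2 < φ0) :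
    H1 δ g x = 0 ∧ H2 δ g x = 0 := by
  have h2 : cv (kK δ) g x = 0 := by
    unfold cv
    refine integral_eq_zero_of_ae (Filter.Eventually.of_forall fun t => ?_)
    simp only [Pi.zero_apply, kK]
    split_ifs with ht
    · rw [hs _ (by simp only [Prod.snd_sub]; linarith), smul_zero]
    · rw [zero_smul]
  refine ⟨?_, h2⟩
  unfold H1
  rw [h2, add_zero]
  unfold hv
  refine integral_eq_zero_of_ae (Filter.Eventually.of_forall fun t => ?_)
  simp only [Pi.zero_apply]
  rw [hs _ (by simp only; linarith), smul_zero]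

lemma H_bound {a q : ℝ} (hq : 1 < q) (ha : a + 1 / q < 1) : ∃ C : ℝ≥0∞, C ≠ ⊤ ∧ ∀ δ > 0, ∀ φ0, δ ≤ φ0 →
    ∀ g : ℝ × ℝ → ℂ, BC2 g → (∀ x : ℝ × ℝ, x.2 < φ0 → g x = 0) →
      ∫⁻ x in {x : ℝ × ℝ | 0 < x.2}, ‖(x.2 ^ a : ℝ) • H1 δ g x‖ₑ ^ q ≤ C * ∫⁻ x, ‖(x.2 ^ a : ℝ) • g x‖ₑ ^ q ∧
      ∫⁻ x in {x : ℝ × ℝ | 0 < x.2}, ‖(x.2 ^ a : ℝ) • H2 δ g x‖ₑ ^ q ≤ C * ∫⁻ x, ‖(x.2 ^ a : ℝ) • g x‖ₑ ^ q := by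
  obtain ⟨C1, hC1, hb1⟩ := HQ_bound a hq
  obtain ⟨C2, hC2, hb2⟩ := KW_bound hq ha
  have h2 : (2 : ℝ≥0∞) ^ (q - 1) ≠ ⊤ := ENNReal.rpow_ne_top_of_nonneg (by linarith) (by norm_num)
  refine ⟨2 ^ (q - 1) * (C1 + C2) + C2, by finiteness, fun δ hδ φ0 hφ g hg hs => ⟨?_, ?_⟩⟩
  · have k1 := (setLIntegral_le_lintegral {x : ℝ × ℝ | 0 < x.2} _).trans (hb1 δ hδ φ0 hφ g hg hs)
    have k2 := hb2 δ hδ g hg ⟨φ0, hδ.trans_le hφ, hs⟩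
    have hm : Measurable fun x : ℝ × ℝ => ‖(x.2 ^ a : ℝ) • hv (qk δ) δ g x‖ₑ :=
      ((measurable_snd.pow_const a).smul (hv_meas (qk_cont hδ).measurable δ hg.meas)).enorm
    calc _ ≤ ∫⁻ x in {x : ℝ × ℝ | 0 < x.2}, (‖(x.2 ^ a : ℝ) • hv (qk δ) δ g x‖ₑ + ‖(x.2 ^ a : ℝ) • cv (kK δ) g x‖ₑ) ^ q := by
          refine lintegral_mono fun x => ENNReal.rpow_le_rpow ?_ (by linarith)
          unfold H1
          rw [smul_add]
          exact enorm_add_le _ _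
      _ ≤ _ := add_pow_lint hq hm.aemeasurable
      _ ≤ 2 ^ (q - 1) * (C1 * _ + C2 * _) := by gcongr
      _ ≤ _ := by
        rw [← add_mul, ← mul_assoc]
        gcongr
        exact le_self_add
  · refine (hb2 δ hδ g hg ⟨φ0, hδ.trans_le hφ, hs⟩).trans ?_
    gcongr
    exact le_add_self

structure TT (κ : ℝ) (f : ℝ × ℝ → ℂ) : Prop where
  cc : Cc f
  ss : tsupport f ⊆ strip κ

lemma TT.pd1 {κ : ℝ} {f : ℝ × ℝ → ℂ} (h : TT κ f) : TT κ (pd1 f) :=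
  ⟨h.cc.pd1, by rw [pd1_eq h.cc.sm]; exact (tsupport_fderiv_apply_subset ℝ _).trans h.ss⟩

lemma TT.pd2 {κ : ℝ} {f : ℝ × ℝ → ℂ} (h : TT κ f) : TT κ (pd2 f) :=
  ⟨h.cc.pd2, by rw [pd2_eq h.cc.sm]; exact (tsupport_fderiv_apply_subset ℝ _).trans h.ss⟩

lemma strip_meas (κ : ℝ) : MeasurableSet (strip κ) :=
  (measurableSet_lt measurable_const measurable_snd).inter (measurableSet_lt measurable_snd measurable_const)

lemma TT.integ {κ : ℝ} {f : ℝ × ℝ → ℂ} (h : TT κ f) {u : ℝ × ℝ → ℂ} (hu : LocallyIntegrableOn u (strip κ)) :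
    IntegrableOn (fun x => u x * f x) (strip κ) := by
  have hK : IsCompact (tsupport f) := h.cc.cs
  have h1 := hu.integrableOn_compact_subset h.ss hK
  obtain ⟨M, hM⟩ := h.cc.bc2.bdd
  have h2 : IntegrableOn (fun x => u x * f x) (tsupport f) :=
    Integrable.mul_bdd (c := M) h1 h.cc.sm.continuous.aestronglyMeasurable (Filter.Eventually.of_forall hM)
  refine (IntegrableOn.integrable_of_forall_notMem_eq_zero h2 fun x hx => ?_).integrableOn
  rw [image_eq_zero_of_notMem_tsupport hx, mul_zero]

structure Wt (b R : ℝ) (w : ℝ × ℝ → ℂ) : Prop where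
  sm : ContDiff ℝ (⊤ : ℕ∞) w
  z : ∀ x : ℝ × ℝ, (R < |x.1| ∨ b < x.2) → w x = 0

lemma wt_open (b R : ℝ) : IsOpen {x : ℝ × ℝ | R < |x.1| ∨ b < x.2} :=
  IsOpen.union (s₁ := {x : ℝ × ℝ | R < |x.1|}) (s₂ := {x : ℝ × ℝ | b < x.2}) (isOpen_lt continuous_const (by fun_prop)) (isOpen_lt continuous_const (by fun_prop))

lemma pd_zero_of_open {f : ℝ × ℝ → ℂ} (hf : ContDiff ℝ (⊤ : ℕ∞) f) {U : Set (ℝ × ℝ)} (hU : IsOpen U) (h : ∀ x ∈ U, f x = 0)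
    {x : ℝ × ℝ} (hx : x ∈ U) : pd1 f x = 0 ∧ pd2 f x = 0 := by
  rw [pd1_eq hf, pd2_eq hf]
  have : f =ᶠ[nhds x] fun _ => 0 := Filter.eventually_of_mem (hU.mem_nhds hx) h
  simp [this.fderiv_eq]

lemma Wt.pd1 {b R : ℝ} {w : ℝ × ℝ → ℂ} (h : Wt b R w) : Wt b R (pd1 w) :=
  ⟨sm_pd1 h.sm, fun _ hx => (pd_zero_of_open h.sm (wt_open b R) h.z hx).1⟩

lemma Wt.pd2 {b R : ℝ} {w : ℝ × ℝ → ℂ} (h : Wt b R w) : Wt b R (pd2 w) :=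
  ⟨sm_pd2 h.sm, fun _ hx => (pd_zero_of_open h.sm (wt_open b R) h.z hx).2⟩

lemma Wt.tt {b R κ φ0 : ℝ} {w H : ℝ × ℝ → ℂ} (h : Wt b R w) (hH : ContDiff ℝ (⊤ : ℕ∞) H)
    (hz : ∀ x : ℝ × ℝ, x.2 < φ0 → H x = 0) (h0 : 0 < φ0) (hb : b < κ) : TT κ (fun x => w x * H x) := by
  have hsub : tsupport (fun x => w x * H x) ⊆ Icc (-R) R ×ˢ Icc φ0 b := by
    refine closure_minimal (fun x hx => ?_) (isClosed_Icc.prod isClosed_Icc)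
    by_contra hc
    refine hx ?_
    simp only
    by_cases h1 : R < |x.1| ∨ b < x.2
    · rw [h.z x h1, zero_mul]
    · push Not at h1
      rw [hz, mul_zero]
      by_contra h2
      exact hc ⟨abs_le.1 h1.1, not_lt.1 h2, h1.2⟩
  refine ⟨⟨h.sm.mul hH, ?_⟩, fun x hx => ?_⟩
  · exact (isCompact_Icc.prod isCompact_Icc).of_isClosed_subset (isClosed_tsupport _) hsub
  · have := (hsub hx).2
    exact ⟨h0.trans_le this.1, this.2.trans_lt hb⟩

lemma weak_z {b R κ φ0 : ℝ} {w H : ℝ × ℝ → ℂ} (h : Wt b R w) (hH : ContDiff ℝ (⊤ : ℕ∞) H)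
    (hz : ∀ x : ℝ × ℝ, x.2 < φ0 → H x = 0) (h0 : 0 < φ0) (hb : b < κ) {u g10 g20 : ℝ × ℝ → ℂ}
    (hu : LocallyIntegrableOn u (strip κ)) (h1 : HasWeakDerivOn (strip κ) (1, 0) u g10)
    (h2 : HasWeakDerivOn (strip κ) (2, 0) u g20) :
    (∫ x in strip κ, u x * (w x * pd1 (pd1 H) x)) = (∫ x in strip κ, g20 x * (w x * H x)) +
      2 * (∫ x in strip κ, g10 x * (pd1 w x * H x)) + (∫ x in strip κ, u x * (pd1 (pd1 w) x * H x)) := by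
  have t0 := h.tt hH hz h0 hb
  have t1 := h.pd1.tt hH hz h0 hb
  have t2 := h.pd1.pd1.tt hH hz h0 hb
  have e2 := h2 _ t0.cc.sm t0.cc.cs t0.ss
  have e1 := h1 _ t1.cc.sm t1.cc.cs t1.ss
  simp only [pdMix, Function.iterate_succ, Function.iterate_zero, Function.comp, id] at e1 e2
  norm_num at e1 e2
  have E : ∀ x, u x * (w x * pd1 (pd1 H) x) = u x * pd1 (pd1 fun x => w x * H x) x -
      2 * (u x * pd1 (fun x => pd1 w x * H x) x) + u x * (pd1 (pd1 w) x * H x) := by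
    intro x
    rw [mul_pd1 h.sm hH, add_pd1 ((sm_pd1 h.sm).mul hH) (h.sm.mul (sm_pd1 hH)), mul_pd1 (sm_pd1 h.sm) hH,
      mul_pd1 h.sm (sm_pd1 hH)]
    ring
  have i2 := t0.pd1.pd1.integ hu
  have i1 := (t1.pd1.integ hu).const_mul 2
  rw [integral_congr_ae (Filter.Eventually.of_forall E), integral_add (by exact i2.sub i1) (t2.integ hu), integral_sub i2 i1,
    integral_const_mul, e1, e2]
  ring

lemma weak_p {b R κ φ0 : ℝ} {w H : ℝ × ℝ → ℂ} (h : Wt b R w) (hH : ContDiff ℝ (⊤ : ℕ∞) H)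
    (hz : ∀ x : ℝ × ℝ, x.2 < φ0 → H x = 0) (h0 : 0 < φ0) (hb : b < κ) {u g10 g20 : ℝ × ℝ → ℂ}
    (hu : LocallyIntegrableOn u (strip κ)) (h1 : HasWeakDerivOn (strip κ) (0, 1) u g10)
    (h2 : HasWeakDerivOn (strip κ) (0, 2) u g20) :
    (∫ x in strip κ, u x * (w x * pd2 (pd2 H) x)) = (∫ x in strip κ, g20 x * (w x * H x)) +
      2 * (∫ x in strip κ, g10 x * (pd2 w x * H x)) + (∫ x in strip κ, u x * (pd2 (pd2 w) x * H x)) := by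
  have t0 := h.tt hH hz h0 hb
  have t1 := h.pd2.tt hH hz h0 hb
  have t2 := h.pd2.pd2.tt hH hz h0 hb
  have e2 := h2 _ t0.cc.sm t0.cc.cs t0.ss
  have e1 := h1 _ t1.cc.sm t1.cc.cs t1.ss
  simp only [pdMix, Function.iterate_succ, Function.iterate_zero, Function.comp, id] at e1 e2
  norm_num at e1 e2
  have E : ∀ x, u x * (w x * pd2 (pd2 H) x) = u x * pd2 (pd2 fun x => w x * H x) x -
      2 * (u x * pd2 (fun x => pd2 w x * H x) x) + u x * (pd2 (pd2 w) x * H x) := by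
    intro x
    rw [mul_pd2 h.sm hH, add_pd2 ((sm_pd2 h.sm).mul hH) (h.sm.mul (sm_pd2 hH)), mul_pd2 (sm_pd2 h.sm) hH,
      mul_pd2 h.sm (sm_pd2 hH)]
    ring
  have i2 := t0.pd2.pd2.integ hu
  have i1 := (t1.pd2.integ hu).const_mul 2
  rw [integral_congr_ae (Filter.Eventually.of_forall E), integral_add (by exact i2.sub i1) (t2.integ hu), integral_sub i2 i1,
    integral_const_mul, e1, e2]
  ring

lemma key_id {b R κ φ0 δ : ℝ} (hδ : 0 < δ) {w g : ℝ × ℝ → ℂ} (h : Wt b R w) (hg : Cc g)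
    (hz : ∀ x : ℝ × ℝ, x.2 < φ0 → g x = 0) (h0 : 0 < φ0) (hb : b < κ) {u g10 g20 g01 g02 : ℝ × ℝ → ℂ}
    (hu : LocallyIntegrableOn u (strip κ)) (h10 : HasWeakDerivOn (strip κ) (1, 0) u g10)
    (h20 : HasWeakDerivOn (strip κ) (2, 0) u g20) (h01 : HasWeakDerivOn (strip κ) (0, 1) u g01)
    (h02 : HasWeakDerivOn (strip κ) (0, 2) u g02) :
    ∫ x in strip κ, u x * (w x * hv (pk δ) δ (pd1 (pd2 g)) x) =
      ((∫ x in strip κ, g20 x * (w x * H1 δ g x)) + 2 * (∫ x in strip κ, g10 x * (pd1 w x * H1 δ g x)) +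
        (∫ x in strip κ, u x * (pd1 (pd1 w) x * H1 δ g x))) +
      ((∫ x in strip κ, g02 x * (w x * H2 δ g x)) + 2 * (∫ x in strip κ, g01 x * (pd2 w x * H2 δ g x)) +
        (∫ x in strip κ, u x * (pd2 (pd2 w) x * H2 δ g x))) := by
  have z1 : ∀ x : ℝ × ℝ, x.2 < φ0 → H1 δ g x = 0 := fun x hx => (kK_supp hδ hz hx).1
  have z2 : ∀ x : ℝ × ℝ, x.2 < φ0 → H2 δ g x = 0 := fun x hx => (kK_supp hδ hz hx).2
  have s1 := H1_sm hδ hg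
  have s2 := H2_sm hδ hg
  have op : IsOpen {x : ℝ × ℝ | x.2 < φ0} := isOpen_lt (by fun_prop) continuous_const
  have z1' : ∀ x : ℝ × ℝ, x.2 < φ0 → pd1 (pd1 (H1 δ g)) x = 0 := fun x hx =>
    (pd_zero_of_open (sm_pd1 s1) op (fun y hy => (pd_zero_of_open s1 op z1 hy).1) hx).1
  have z2' : ∀ x : ℝ × ℝ, x.2 < φ0 → pd2 (pd2 (H2 δ g)) x = 0 := fun x hx =>
    (pd_zero_of_open (sm_pd2 s2) op (fun y hy => (pd_zero_of_open s2 op z2 hy).2) hx).2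
  rw [← weak_z h s1 z1 h0 hb hu h10 h20, ← weak_p h s2 z2 h0 hb hu h01 h02,
    ← integral_add ((h.tt (sm_pd1 (sm_pd1 s1)) z1' h0 hb).integ hu) ((h.tt (sm_pd2 (sm_pd2 s2)) z2' h0 hb).integ hu)]
  refine integral_congr_ae (Filter.Eventually.of_forall fun x => ?_)
  simp only
  rw [← H_id hδ hg x]
  ring

lemma rp_le {c x y : ℝ} (a : ℝ) (hc : 1 ≤ c) (hx : 0 < x) (hy : 0 < y) (h1 : x ≤ c * y) (h2 : y ≤ c * x) :
    x ^ a ≤ c ^ |a| * y ^ a := by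
  have c0 : 0 < c := by linarith
  rcases le_total 0 a with ha | ha
  · rw [abs_of_nonneg ha, ← Real.mul_rpow c0.le hy.le]
    exact Real.rpow_le_rpow hx.le h1 ha
  · rw [abs_of_nonpos ha, Real.rpow_neg c0.le, ← Real.inv_rpow c0.le, ← Real.mul_rpow (by positivity) hy.le]
    refine Real.rpow_le_rpow_of_nonpos (by positivity) ?_ ha
    rw [inv_mul_le_iff₀ c0]; exact h2

def dd (κ : ℝ) (x : ℝ × ℝ) : ℝ := min x.2 (κ - x.2)

lemma dd_pos {κ : ℝ} {x : ℝ × ℝ} (h : x ∈ strip κ) : 0 < dd κ x := lt_min h.1 (sub_pos.2 h.2)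

lemma dd_meas (κ : ℝ) : Measurable (dd κ) := measurable_snd.min (measurable_const.sub measurable_snd)

lemma stripNorm_eq {κ p γ : ℝ} (hp : 1 < p) (f : ℝ × ℝ → ℂ) :
    stripNorm κ p γ f = (∫⁻ x in strip κ, (ENNReal.ofReal (‖f x‖ * dd κ x ^ (γ / p))) ^ p) ^ (1 / p) := by
  unfold stripNorm
  congr 1
  refine setLIntegral_congr_fun (strip_meas κ) fun x hx => ?_
  have hd := dd_pos hx
  rw [ENNReal.ofReal_rpow_of_nonneg (by positivity) (by linarith), Real.mul_rpow (by positivity) (by positivity),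
    ← Real.rpow_mul hd.le, div_mul_cancel₀ _ (by linarith)]
  rfl

lemma hold {κ p q γ M : ℝ} (hpq : p.HolderConjugate q) {f w H : ℝ × ℝ → ℂ}
    (hf : AEStronglyMeasurable f (volume.restrict (strip κ))) (hw : ∀ x ∈ strip κ, ‖w x‖ ≤ M)
    (hw0 : ∀ x : ℝ × ℝ, 2 * κ / 3 < x.2 → w x = 0) (hH : Measurable H) {B : ℝ≥0∞}
    (hB : ∫⁻ x in {x : ℝ × ℝ | 0 < x.2}, ‖(x.2 ^ (-γ / p) : ℝ) • H x‖ₑ ^ q ≤ B) :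
    ‖∫ x in strip κ, f x * (w x * H x)‖ₑ ≤
      stripNorm κ p γ f * (ENNReal.ofReal (M * 2 ^ |-γ / p|) * B ^ (1 / q)) := by
  set a := -γ / p with ha
  have hq := hpq.symm.lt
  have ea : γ / p = -a := by rw [ha]; ring
  set G : ℝ × ℝ → ℝ≥0∞ := fun x => ENNReal.ofReal (M * 2 ^ |a|) * ‖(x.2 ^ a : ℝ) • H x‖ₑ with hG
  have hG2 : (∫⁻ x in strip κ, G x ^ q) ^ (1 / q) ≤ ENNReal.ofReal (M * 2 ^ |a|) * B ^ (1 / q) := by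
    have e : ∀ x, G x ^ q = ENNReal.ofReal (M * 2 ^ |a|) ^ q * ‖(x.2 ^ a : ℝ) • H x‖ₑ ^ q := fun x =>
      ENNReal.mul_rpow_of_nonneg _ _ (by linarith)
    simp_rw [e]
    rw [lintegral_const_mul' _ _ (ENNReal.rpow_ne_top_of_nonneg (by linarith) ENNReal.ofReal_ne_top),
      ENNReal.mul_rpow_of_nonneg _ _ (by positivity), ← ENNReal.rpow_mul, mul_one_div_cancel (by linarith), ENNReal.rpow_one]
    gcongr
    exact (lintegral_mono_set fun x hx => hx.1).trans hB
  refine le_trans ?_ (mul_le_mul_right hG2 _)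
  rw [stripNorm_eq hpq.lt]
  have mF : AEMeasurable (fun x => ENNReal.ofReal (‖f x‖ * dd κ x ^ (γ / p))) (volume.restrict (strip κ)) :=
    (hf.norm.aemeasurable.mul ((dd_meas κ).pow_const _).aemeasurable).ennreal_ofReal
  have mG : Measurable G := (((measurable_snd.pow_const a).smul hH).enorm).const_mul _
  refine le_trans ?_ (ENNReal.lintegral_mul_le_Lp_mul_Lq _ hpq mF mG.aemeasurable)
  refine (enorm_integral_le_lintegral_enorm _).trans (setLIntegral_mono' (strip_meas κ) fun x hx => ?_)
  simp only [Pi.mul_apply]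
  by_cases hxb : 2 * κ / 3 < x.2
  · rw [hw0 x hxb]; simp
  push Not at hxb
  have hd := dd_pos hx
  have hM := (norm_nonneg _).trans (hw x hx)
  have hx0 : 0 < x.2 := hx.1
  have hle : dd κ x ^ a ≤ 2 ^ |a| * x.2 ^ a := by
    refine rp_le a (by norm_num) hd hx.1 ?_ ?_
    · exact (min_le_left _ _).trans (by linarith)
    · unfold dd
      rw [mul_min_of_nonneg _ _ (by norm_num)]
      exact le_min (by linarith) (by linarith)
  rw [hG]
  simp only
  rw [← ofReal_norm (f x * _), ← ofReal_norm ((x.2 ^ a : ℝ) • H x), ← ENNReal.ofReal_mul (by positivity), ← ENNReal.ofReal_mul (by positivity)]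
  refine ENNReal.ofReal_le_ofReal ?_
  rw [norm_mul, norm_mul, norm_smul, Real.norm_of_nonneg (by positivity), ea]
  have h1 : 1 ≤ dd κ x ^ (-a) * (2 ^ |a| * x.2 ^ a) := by
    rw [Real.rpow_neg hd.le, ← div_eq_inv_mul, one_le_div (by positivity)]; exact hle
  calc ‖f x‖ * (‖w x‖ * ‖H x‖) ≤ ‖f x‖ * (M * ‖H x‖) * 1 := by rw [mul_one]; gcongr; exact hw x hx
    _ ≤ ‖f x‖ * (M * ‖H x‖) * (dd κ x ^ (-a) * (2 ^ |a| * x.2 ^ a)) := by gcongr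
    _ = _ := by ring

lemma TT.low {κ : ℝ} {g : ℝ × ℝ → ℂ} (h : TT κ g) : ∃ φ0 > 0, ∀ x : ℝ × ℝ, x.2 < φ0 → g x = 0 := by
  rcases (tsupport g).eq_empty_or_nonempty with h0 | h0
  · exact ⟨1, one_pos, fun x _ => image_eq_zero_of_notMem_tsupport (by rw [h0]; exact notMem_empty _)⟩
  · obtain ⟨y, hy, hmin⟩ := IsCompact.exists_isMinOn (f := Prod.snd) h.cc.cs h0 continuous_snd.continuousOn
    refine ⟨y.2, (h.ss hy).1, fun x hx => ?_⟩
    by_contra hc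
    exact absurd (hmin (subset_tsupport _ hc)) (not_le.2 hx)

lemma Wt.bdd {b R : ℝ} {w : ℝ × ℝ → ℂ} (h : Wt b R w) (κ : ℝ) : ∃ M, ∀ x ∈ strip κ, ‖w x‖ ≤ M := by
  obtain ⟨M, hM⟩ := ((isCompact_Icc (a := -R) (b := R)).prod (isCompact_Icc (a := 0) (b := κ))).exists_bound_of_continuousOn
    h.sm.continuous.continuousOn
  refine ⟨max M 0, fun x hx => ?_⟩
  by_cases hR : R < |x.1|
  · rw [h.z x (Or.inl hR), norm_zero]; exact le_max_right _ _
  · exact (hM x ⟨abs_le.1 (not_lt.1 hR), hx.1.le, hx.2.le⟩).trans (le_max_left _ _)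

def sc (R : ℝ) (F : ℝ × ℝ → ℂ) (x : ℝ × ℝ) : ℂ := F (x.1 / R, x.2)

lemma sc_wt {b R0 R : ℝ} (hR : 0 < R) {w : ℝ × ℝ → ℂ} (h : Wt b R0 w) : Wt b (R0 * R) (sc R w) := by
  refine ⟨h.sm.comp (by fun_prop), fun x hx => h.z _ ?_⟩
  rcases hx with hx | hx
  · left
    simp only
    rw [abs_div, abs_of_pos hR, lt_div_iff₀ hR]; exact hx
  · exact Or.inr hx

lemma sc_pd1 (R : ℝ) {w : ℝ × ℝ → ℂ} (h : ContDiff ℝ (⊤ : ℕ∞) w) : pd1 (sc R w) = fun x => (1 / R : ℝ) • sc R (pd1 w) x := by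
  ext x
  have := (sm_hd1 h (x.1 / R) x.2).scomp x.1 ((hasDerivAt_id x.1).div_const R)
  exact this.deriv

lemma sc_pd2 (R : ℝ) (w : ℝ × ℝ → ℂ) : pd2 (sc R w) = sc R (pd2 w) := rfl

lemma smul_pd1 (c : ℝ) {w : ℝ × ℝ → ℂ} (h : ContDiff ℝ (⊤ : ℕ∞) w) : pd1 (fun x => c • w x) = fun x => c • pd1 w x := by
  ext x
  exact HasDerivAt.deriv ((sm_hd1 h x.1 x.2).const_smul c)

lemma sc_bdd {κ M R : ℝ} {w : ℝ × ℝ → ℂ} (h : ∀ x ∈ strip κ, ‖w x‖ ≤ M) : ∀ x ∈ strip κ, ‖sc R w x‖ ≤ M :=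
  fun x hx => h (x.1 / R, x.2) hx

lemma inv_smul_bdd {κ M R : ℝ} (hR : 1 ≤ R) {w : ℝ × ℝ → ℂ} (h : ∀ x ∈ strip κ, ‖w x‖ ≤ M) :
    ∀ x ∈ strip κ, ‖(1 / R : ℝ) • w x‖ ≤ M := fun x hx => by
  rw [norm_smul, Real.norm_of_nonneg (by positivity)]
  refine le_trans (mul_le_of_le_one_left (norm_nonneg _) ?_) (h x hx)
  rw [div_le_one (by linarith)]; exact hR

def chi0 (κ y : ℝ) : ℝ := smoothTransition (2 - 3 * y / κ)

def Om (κ : ℝ) (x : ℝ × ℝ) : ℂ := ((chi0 κ x.2 * (smoothTransition (2 - x.1) * smoothTransition (2 + x.1)) : ℝ) : ℂ)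

lemma chi0_zero {κ y : ℝ} (hκ : 0 < κ) (h : 2 * κ / 3 ≤ y) : chi0 κ y = 0 := by
  refine smoothTransition.zero_of_nonpos ?_
  rw [sub_nonpos, le_div_iff₀ hκ]; linarith

lemma chi0_sm (κ : ℝ) : ContDiff ℝ (⊤ : ℕ∞) (chi0 κ) := smoothTransition.contDiff.comp (by fun_prop)

lemma Om_wt {κ : ℝ} (hκ : 0 < κ) : Wt (2 * κ / 3) 2 (Om κ) := by
  refine ⟨?_, fun x hx => ?_⟩
  · refine Complex.ofRealCLM.contDiff.comp (((chi0_sm κ).comp contDiff_snd).mul ((smoothTransition.contDiff.comp ?_).mul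
      (smoothTransition.contDiff.comp ?_))) <;> fun_prop
  · unfold Om
    rcases hx with hx | hx
    · rcases lt_abs.1 hx with h | h
      · rw [smoothTransition.zero_of_nonpos (x := 2 - x.1) (by linarith)]; simp
      · rw [smoothTransition.zero_of_nonpos (x := 2 + x.1) (by linarith)]; simp
    · rw [chi0_zero hκ hx.le]; simp

lemma Om_sc {κ R : ℝ} (hR : 0 < R) {x : ℝ × ℝ} (hx : |x.1| ≤ R) : sc R (Om κ) x = (chi0 κ x.2 : ℂ) := by
  have h : |x.1 / R| ≤ 1 := by rw [abs_div, abs_of_pos hR, div_le_one hR]; exact hx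
  rw [abs_le] at h
  unfold sc Om
  simp only
  rw [smoothTransition.one_of_one_le (by linarith), smoothTransition.one_of_one_le (by linarith)]
  simp

def gt (κ : ℝ) (g : ℝ × ℝ → ℂ) (x : ℝ × ℝ) : ℂ := ((smoothTransition (9 - 12 * x.2 / κ) : ℝ) : ℂ) * g x

lemma gt_tt {κ : ℝ} {g : ℝ × ℝ → ℂ} (h : TT κ g) : TT κ (gt κ g) := by
  refine ⟨⟨?_, h.cc.cs.mul_left⟩, (tsupport_mul_subset_right).trans h.ss⟩
  exact (Complex.ofRealCLM.contDiff.comp (smoothTransition.contDiff.comp (by fun_prop))).mul h.cc.sm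

lemma pd_congr_open {f g : ℝ × ℝ → ℂ} (hf : ContDiff ℝ (⊤ : ℕ∞) f) (hg : ContDiff ℝ (⊤ : ℕ∞) g) {U : Set (ℝ × ℝ)} (hU : IsOpen U)
    (h : ∀ x ∈ U, f x = g x) {x : ℝ × ℝ} (hx : x ∈ U) : pd1 f x = pd1 g x ∧ pd2 f x = pd2 g x := by
  rw [pd1_eq hf, pd2_eq hf, pd1_eq hg, pd2_eq hg]
  have : f =ᶠ[nhds x] g := Filter.eventually_of_mem (hU.mem_nhds hx) h
  simp [this.fderiv_eq]

lemma gt_pd {κ : ℝ} (hκ : 0 < κ) {g : ℝ × ℝ → ℂ} (h : TT κ g) {x : ℝ × ℝ} (hx : x.2 < 2 * κ / 3) :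
    pd1 (pd2 (gt κ g)) x = pd1 (pd2 g) x := by
  have op : IsOpen {x : ℝ × ℝ | x.2 < 2 * κ / 3} := isOpen_lt (by fun_prop) continuous_const
  have h' := gt_tt h
  refine (pd_congr_open h'.pd2.cc.sm h.pd2.cc.sm op (fun y hy =>
    (pd_congr_open h'.cc.sm h.cc.sm op (fun y hy => ?_) hy).2) hx).1
  unfold gt
  rw [smoothTransition.one_of_one_le]
  · simp
  · rw [le_sub_comm, div_le_iff₀ hκ]
    have : y.2 < 2 * κ / 3 := hy
    linarith

lemma gt_norm {κ a q : ℝ} (hκ : 0 < κ) (hq : 1 < q) {g : ℝ × ℝ → ℂ} (h : TT κ g) :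
    ∫⁻ x, ‖(x.2 ^ a : ℝ) • gt κ g x‖ₑ ^ q ≤
      ENNReal.ofReal (3 ^ |a|) ^ q * ∫⁻ x in strip κ, ‖(dd κ x ^ a : ℝ) • g x‖ₑ ^ q := by
  rw [← lintegral_const_mul' _ _ (ENNReal.rpow_ne_top_of_nonneg (by linarith) ENNReal.ofReal_ne_top),
    ← lintegral_indicator (strip_meas κ)]
  refine lintegral_mono fun x => ?_
  by_cases hx : x ∈ strip κ
  · rw [indicator_of_mem hx, ← ENNReal.mul_rpow_of_nonneg _ _ (by linarith)]
    refine ENNReal.rpow_le_rpow ?_ (by linarith)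
    by_cases h3 : 3 * κ / 4 ≤ x.2
    · have : gt κ g x = 0 := by
        unfold gt
        rw [smoothTransition.zero_of_nonpos]
        · simp
        · rw [sub_nonpos, le_div_iff₀ hκ]; linarith
      simp [this]
    · push Not at h3
      have hd := dd_pos hx
      have hx0 := hx.1
      have hle : x.2 ^ a ≤ 3 ^ |a| * dd κ x ^ a := by
        refine rp_le a (by norm_num) hx.1 hd ?_ ?_
        · unfold dd
          rw [mul_min_of_nonneg _ _ (by norm_num)]
          exact le_min (by linarith) (by linarith)
        · exact (min_le_left _ _).trans (by linarith)
      rw [← ofReal_norm, ← ofReal_norm, ← ENNReal.ofReal_mul (by positivity)]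
      refine ENNReal.ofReal_le_ofReal ?_
      rw [norm_smul, norm_smul, Real.norm_of_nonneg (by positivity), Real.norm_of_nonneg (by positivity), ← mul_assoc]
      refine mul_le_mul hle ?_ (norm_nonneg _) (by positivity)
      unfold gt
      rw [norm_mul, Complex.norm_real, Real.norm_of_nonneg (smoothTransition.nonneg _)]
      exact mul_le_of_le_one_left (norm_nonneg _) (smoothTransition.le_one _)
  · have : g x = 0 := image_eq_zero_of_notMem_tsupport fun hc => hx (h.ss hc)
    have hq0 : 0 < q := by linarith
    simp [gt, this, hq0]

lemma hv_pk_eq {δ : ℝ} (hδ : 0 < δ) (G : ℝ × ℝ → ℂ) (x : ℝ × ℝ) :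
    hv (pk δ) δ G x = ∫ s, pk 1 s • G (x.1 - δ * s, x.2 - δ) := by
  have h := Measure.integral_comp_mul_left (fun t => pk δ t • G (x.1 - t, x.2 - δ)) δ
  unfold hv
  rw [abs_of_pos (inv_pos.2 hδ)] at h
  have h2 : ∫ t, pk δ t • G (x.1 - t, x.2 - δ) = δ • ∫ s, pk δ (δ * s) • G (x.1 - δ * s, x.2 - δ) := by
    rw [h, smul_smul, mul_inv_cancel₀ hδ.ne', one_smul]
  rw [h2, ← integral_smul]
  congr 1; ext s
  rw [smul_smul]
  congr 1
  unfold pk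
  have : s ^ 2 + 1 ^ 2 ≠ 0 := by positivity
  have : (δ * s) ^ 2 + δ ^ 2 ≠ 0 := by positivity
  field_simp

lemma hv_pk_le {δ M : ℝ} (hδ : 0 < δ) {G : ℝ × ℝ → ℂ} (hM : ∀ x, ‖G x‖ ≤ M) (x : ℝ × ℝ) : ‖hv (pk δ) δ G x‖ ≤ π * M := by
  rw [hv_pk_eq hδ]
  have i : Integrable fun s => pk 1 s * M := (pk_integrable one_pos).mul_const M
  refine (norm_integral_le_of_norm_le i (Filter.Eventually.of_forall fun s => ?_)).trans (le_of_eq ?_)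
  · rw [norm_smul, Real.norm_of_nonneg (pk_nonneg one_pos s)]
    exact mul_le_mul_of_nonneg_left (hM _) (pk_nonneg one_pos s)
  · rw [integral_mul_const, pk_integral one_pos]

lemma hv_pk_lim {G : ℝ × ℝ → ℂ} (hG : Cc G) (x : ℝ × ℝ) :
    Filter.Tendsto (fun δ => hv (pk δ) δ G x) (nhdsWithin 0 (Ioi 0)) (nhds (π * G x)) := by
  obtain ⟨M, hM⟩ := hG.bc2.bdd
  have hc := hG.sm.continuous
  have e : (π : ℂ) * G x = ∫ s, pk 1 s • G x := by
    rw [integral_smul_const, pk_integral one_pos]; simp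
  rw [e]
  have key : Filter.Tendsto (fun δ => ∫ s, pk 1 s • G (x.1 - δ * s, x.2 - δ)) (nhdsWithin 0 (Ioi 0)) (nhds (∫ s, pk 1 s • G x)) := by
    refine tendsto_integral_filter_of_dominated_convergence (fun s => pk 1 s * M) ?_ ?_ ((pk_integrable one_pos).mul_const M) ?_
    · refine Filter.Eventually.of_forall fun δ => Continuous.aestronglyMeasurable ?_
      exact (pk_cont one_pos).smul (hc.comp (by fun_prop))
    · refine Filter.Eventually.of_forall fun δ => Filter.Eventually.of_forall fun s => ?_
      rw [norm_smul, Real.norm_of_nonneg (pk_nonneg one_pos s)]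
      exact mul_le_mul_of_nonneg_left (hM _) (pk_nonneg one_pos s)
    · refine Filter.Eventually.of_forall fun s => ?_
      have : Continuous fun δ : ℝ => pk 1 s • G (x.1 - δ * s, x.2 - δ) :=
        by fun_prop
      have h0 := (this.tendsto 0).mono_left (nhdsWithin_le_nhds (s := Ioi 0))
      simpa using h0
  refine key.congr' ?_
  filter_upwards [self_mem_nhdsWithin] with δ hδ
  rw [hv_pk_eq hδ]

lemma lim_int {b R κ φ0 : ℝ} {w G u : ℝ × ℝ → ℂ} (h : Wt b R w) (hG : Cc G)
    (hz : ∀ x : ℝ × ℝ, x.2 < φ0 → G x = 0) (h0 : 0 < φ0) (hb : b < κ) (hu : LocallyIntegrableOn u (strip κ)) :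
    Filter.Tendsto (fun δ => ∫ x in strip κ, u x * (w x * hv (pk δ) δ G x)) (nhdsWithin 0 (Ioi 0))
      (nhds (∫ x in strip κ, u x * (w x * (π * G x)))) := by
  obtain ⟨M, hM⟩ := hG.bc2.bdd
  obtain ⟨W, hW⟩ := h.bdd κ
  set K : Set (ℝ × ℝ) := Icc (-R) R ×ˢ Icc φ0 b with hK
  have hKc : IsCompact K := isCompact_Icc.prod isCompact_Icc
  have hKs : K ⊆ strip κ := fun x hx => ⟨h0.trans_le hx.2.1, hx.2.2.trans_lt hb⟩
  have hi : Integrable (K.indicator fun x => ‖u x‖ * (W * (π * M))) (volume.restrict (strip κ)) := by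
    have := ((hu.integrableOn_compact_subset hKs hKc).norm.mul_const (W * (π * M)))
    exact (IntegrableOn.integrable_indicator this hKc.measurableSet).integrableOn
  have hum := hu.aestronglyMeasurable
  refine tendsto_integral_filter_of_dominated_convergence _ ?_ ?_ hi ?_
  · filter_upwards [self_mem_nhdsWithin] with δ hδ
    exact hum.mul (h.sm.continuous.aestronglyMeasurable.mul
      (hv_meas (pk_cont hδ).measurable δ hG.bc2.meas).aestronglyMeasurable)
  · filter_upwards [self_mem_nhdsWithin] with δ hδ
    filter_upwards [ae_restrict_mem (strip_meas κ)] with x hx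
    by_cases hxK : x ∈ K
    · rw [indicator_of_mem hxK, norm_mul, norm_mul]
      have := hW x hx
      have := hv_pk_le hδ hM x
      gcongr
      exact (norm_nonneg _).trans (hW x hx)
    · rw [indicator_of_notMem hxK]
      refine le_of_eq (norm_eq_zero.2 ?_)
      by_cases h1 : R < |x.1| ∨ b < x.2
      · rw [h.z x h1]; simp
      · push Not at h1
        have hx2 : x.2 < φ0 := by
          by_contra h2
          exact hxK ⟨abs_le.1 h1.1, not_lt.1 h2, h1.2⟩
        have hδ0 : 0 < δ := hδ
        have : hv (pk δ) δ G x = 0 := by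
          unfold hv
          refine integral_eq_zero_of_ae (Filter.Eventually.of_forall fun t => ?_)
          simp only [Pi.zero_apply]
          rw [hz _ (by simp only; linarith), smul_zero]
        rw [this]; simp
  · refine Filter.Eventually.of_forall fun x => ?_
    exact ((hv_pk_lim hG x).const_mul _).const_mul _

structure WD (κ : ℝ) (u g10 g20 g01 g02 : ℝ × ℝ → ℂ) : Prop where
  hu : LocallyIntegrableOn u (strip κ)
  h10 : HasWeakDerivOn (strip κ) (1, 0) u g10
  l10 : LocallyIntegrableOn g10 (strip κ)
  h20 : HasWeakDerivOn (strip κ) (2, 0) u g20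
  l20 : LocallyIntegrableOn g20 (strip κ)
  h01 : HasWeakDerivOn (strip κ) (0, 1) u g01
  l01 : LocallyIntegrableOn g01 (strip κ)
  h02 : HasWeakDerivOn (strip κ) (0, 2) u g02
  l02 : LocallyIntegrableOn g02 (strip κ)

def NN (κ p γ : ℝ) (u g10 g20 g01 g02 : ℝ × ℝ → ℂ) : ℝ≥0∞ :=
  stripNorm κ p γ u + stripNorm κ p γ g10 + stripNorm κ p γ g20 + stripNorm κ p γ g01 + stripNorm κ p γ g02

def wn (κ a q : ℝ) (g : ℝ × ℝ → ℂ) : ℝ≥0∞ := (∫⁻ x in strip κ, ‖(dd κ x ^ a : ℝ) • g x‖ₑ ^ q) ^ (1 / q)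

lemma six_le (A B C D E F : ℂ) {n0 n1 n2 n3 n4 K : ℝ≥0∞} (hA : ‖A‖ₑ ≤ n2 * K) (hB : ‖B‖ₑ ≤ n1 * K) (hC : ‖C‖ₑ ≤ n0 * K)
    (hD : ‖D‖ₑ ≤ n4 * K) (hE : ‖E‖ₑ ≤ n3 * K) (hF : ‖F‖ₑ ≤ n0 * K) :
    ‖(A + 2 * B + C) + (D + 2 * E + F)‖ₑ ≤ 2 * (n0 + n1 + n2 + n3 + n4) * K := by
  have e2 : ‖(2 : ℂ)‖ₑ = 2 := by
    rw [← ofReal_norm]; simp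
  have t3 : ∀ X Y Z : ℂ, ‖X + 2 * Y + Z‖ₑ ≤ ‖X‖ₑ + 2 * ‖Y‖ₑ + ‖Z‖ₑ := fun X Y Z => by
    refine (enorm_add_le _ _).trans (add_le_add_left ((enorm_add_le _ _).trans ?_) _)
    rw [enorm_mul, e2]
  calc _ ≤ (‖A‖ₑ + 2 * ‖B‖ₑ + ‖C‖ₑ) + (‖D‖ₑ + 2 * ‖E‖ₑ + ‖F‖ₑ) := (enorm_add_le _ _).trans (add_le_add (t3 _ _ _) (t3 _ _ _))
    _ ≤ (n2 * K + 2 * (n1 * K) + n0 * K) + (n4 * K + 2 * (n3 * K) + n0 * K) := by gcongr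
    _ = (2 * n0 + 2 * n1 + n2 + 2 * n3 + n4) * K := by ring
    _ ≤ (2 * n0 + 2 * n1 + 2 * n2 + 2 * n3 + 2 * n4) * K := by
      gcongr <;> exact le_mul_of_one_le_left zero_le (by norm_num)
    _ = _ := by ring

lemma main_half {κ p q γ : ℝ} (hκ : 0 < κ) (hpq : p.HolderConjugate q) (hγ : -1 < γ) : ∃ C : ℝ≥0∞, C ≠ ⊤ ∧
    ∀ u g10 g20 g01 g02 : ℝ × ℝ → ℂ, WD κ u g10 g20 g01 g02 → ∀ g, TT κ g →
      ‖∫ x in strip κ, u x * ((chi0 κ x.2 : ℂ) * pd1 (pd2 g) x)‖ₑ ≤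
        C * NN κ p γ u g10 g20 g01 g02 * wn κ (-γ / p) q g := by
  have hq := hpq.symm.lt
  have hp := hpq.lt
  set a := -γ / p with ha
  have ha1 : a + 1 / q < 1 := by
    have h1 : 1 / p + 1 / q = 1 := by simpa using hpq.inv_add_inv_eq_one
    have h2 : a < 1 / p := by rw [ha]; gcongr; linarith
    linarith
  obtain ⟨C, hC, hH⟩ := H_bound hq ha1
  have w0 := Om_wt hκ
  obtain ⟨M0, hM0⟩ := w0.bdd κ
  obtain ⟨M1, hM1⟩ := w0.pd1.bdd κ
  obtain ⟨M2, hM2⟩ := w0.pd1.pd1.bdd κ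
  obtain ⟨M3, hM3⟩ := w0.pd2.bdd κ
  obtain ⟨M4, hM4⟩ := w0.pd2.pd2.bdd κ
  obtain ⟨M, m0, m1, m2, m3, m4⟩ : ∃ M, M0 ≤ M ∧ M1 ≤ M ∧ M2 ≤ M ∧ M3 ≤ M ∧ M4 ≤ M :=
    ⟨max M0 (max M1 (max M2 (max M3 M4))), by simp⟩
  have up : ∀ {w : ℝ × ℝ → ℂ} {N}, N ≤ M → (∀ x ∈ strip κ, ‖w x‖ ≤ N) → ∀ x ∈ strip κ, ‖w x‖ ≤ M :=
    fun h1 h2 x hx => (h2 x hx).trans h1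
  have hC3 : ENNReal.ofReal (3 ^ |a|) ≠ ⊤ := ENNReal.ofReal_ne_top
  refine ⟨2 * (ENNReal.ofReal (M * 2 ^ |a|) * (C ^ (1 / q) * ENNReal.ofReal (3 ^ |a|))), ?_, fun u g10 g20 g01 g02 hW g hg => ?_⟩
  · have : C ^ (1 / q) ≠ ⊤ := ENNReal.rpow_ne_top_of_nonneg (by positivity) hC
    finiteness
  have hgt := gt_tt hg
  obtain ⟨φ0, hφ, hz⟩ := hgt.low
  obtain ⟨R0, hR0⟩ := hg.cc.bc2.supp
  set R := max R0 1 with hR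
  have R1 : 1 ≤ R := le_max_right _ _
  have Rp : 0 < R := by linarith
  have hb : 2 * κ / 3 < κ := by linarith
  set w := sc R (Om κ) with hw
  have W := sc_wt Rp w0
  set B : ℝ≥0∞ := C * ∫⁻ x, ‖(x.2 ^ a : ℝ) • gt κ g x‖ₑ ^ q with hB
  have e1 : pd1 w = fun x => (1 / R : ℝ) • sc R (pd1 (Om κ)) x := sc_pd1 R w0.sm
  have e11 : pd1 (pd1 w) = fun x => (1 / R : ℝ) • (1 / R : ℝ) • sc R (pd1 (pd1 (Om κ))) x := by
    rw [e1, smul_pd1 _ (sc_wt Rp w0.pd1).sm, sc_pd1 R w0.pd1.sm]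
  have b0 := sc_bdd (R := R) (up m0 hM0)
  have b1 : ∀ x ∈ strip κ, ‖pd1 w x‖ ≤ M := by
    rw [e1]; exact inv_smul_bdd R1 (sc_bdd (up m1 hM1))
  have b2 : ∀ x ∈ strip κ, ‖pd1 (pd1 w) x‖ ≤ M := by
    rw [e11]; exact inv_smul_bdd R1 (inv_smul_bdd R1 (sc_bdd (up m2 hM2)))
  have b3 : ∀ x ∈ strip κ, ‖pd2 w x‖ ≤ M := sc_bdd (R := R) (up m3 hM3)
  have b4 : ∀ x ∈ strip κ, ‖pd2 (pd2 w) x‖ ≤ M := sc_bdd (R := R) (up m4 hM4)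
  set K := ENNReal.ofReal (M * 2 ^ |a|) * B ^ (1 / q) with hK
  have main : ∀ δ, 0 < δ → δ ≤ φ0 → ‖∫ x in strip κ, u x * (w x * hv (pk δ) δ (pd1 (pd2 (gt κ g))) x)‖ₑ ≤
      2 * NN κ p γ u g10 g20 g01 g02 * K := by
    intro δ hδ hδφ
    rw [key_id hδ W hgt.cc hz hφ hb hW.hu hW.h10 hW.h20 hW.h01 hW.h02]
    obtain ⟨q1, q2⟩ := hH δ hδ φ0 hδφ _ hgt.cc.bc2 hz
    have s1 := (H1_sm hδ hgt.cc).continuous.measurable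
    have s2 := (H2_sm hδ hgt.cc).continuous.measurable
    exact six_le _ _ _ _ _ _
      (hold hpq hW.l20.aestronglyMeasurable b0 (fun x hx => W.z x (Or.inr hx)) s1 q1)
      (hold hpq hW.l10.aestronglyMeasurable b1 (fun x hx => W.pd1.z x (Or.inr hx)) s1 q1)
      (hold hpq hW.hu.aestronglyMeasurable b2 (fun x hx => W.pd1.pd1.z x (Or.inr hx)) s1 q1)
      (hold hpq hW.l02.aestronglyMeasurable b0 (fun x hx => W.z x (Or.inr hx)) s2 q2)
      (hold hpq hW.l01.aestronglyMeasurable b3 (fun x hx => W.pd2.z x (Or.inr hx)) s2 q2)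
      (hold hpq hW.hu.aestronglyMeasurable b4 (fun x hx => W.pd2.pd2.z x (Or.inr hx)) s2 q2)
  have op : IsOpen {x : ℝ × ℝ | x.2 < φ0} := isOpen_lt (by fun_prop) continuous_const
  have hz2 : ∀ x : ℝ × ℝ, x.2 < φ0 → pd1 (pd2 (gt κ g)) x = 0 := fun x hx =>
    (pd_zero_of_open hgt.pd2.cc.sm op (fun y hy => (pd_zero_of_open hgt.cc.sm op hz hy).2) hx).1
  have lim := (lim_int W hgt.pd2.pd1.cc hz2 hφ hb hW.hu).enorm
  have hle : ‖∫ x in strip κ, u x * (w x * (π * pd1 (pd2 (gt κ g)) x))‖ₑ ≤ 2 * NN κ p γ u g10 g20 g01 g02 * K := by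
    refine le_of_tendsto lim ?_
    filter_upwards [Ioc_mem_nhdsGT hφ] with δ hδ
    exact main δ hδ.1 hδ.2
  have eq : ∫ x in strip κ, u x * (w x * (π * pd1 (pd2 (gt κ g)) x)) =
      π * ∫ x in strip κ, u x * ((chi0 κ x.2 : ℂ) * pd1 (pd2 g) x) := by
    rw [← integral_const_mul]
    refine integral_congr_ae (Filter.Eventually.of_forall fun x => ?_)
    simp only
    have opR : IsOpen {x : ℝ × ℝ | R < |x.1|} := isOpen_lt continuous_const (by fun_prop)
    by_cases hx : R < |x.1|
    · have z1 : ∀ {G : ℝ × ℝ → ℂ}, TT κ G → (∀ x : ℝ × ℝ, R < |x.1| → G x = 0) → pd1 (pd2 G) x = 0 := fun hG h0 =>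
        (pd_zero_of_open hG.pd2.cc.sm opR (fun y hy => (pd_zero_of_open hG.cc.sm opR h0 hy).2) hx).1
      have hg0 : ∀ x : ℝ × ℝ, R < |x.1| → g x = 0 := fun x hx => hR0 x (Or.inl ((le_max_left _ _).trans_lt hx))
      rw [z1 hg hg0, z1 hgt fun x hx => by unfold gt; rw [hg0 x hx, mul_zero]]
      simp
    · rw [hw, Om_sc Rp (not_lt.1 hx)]
      by_cases h2 : x.2 < 2 * κ / 3
      · rw [gt_pd hκ hg h2]; ring
      · rw [chi0_zero hκ (not_lt.1 h2)]; simp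
  rw [eq, enorm_mul] at hle
  have hπ : (1 : ℝ≥0∞) ≤ ‖(π : ℂ)‖ₑ := by
    rw [← ofReal_norm, Complex.norm_real, Real.norm_of_nonneg pi_pos.le, ENNReal.one_le_ofReal]
    linarith [Real.pi_gt_three]
  refine (le_mul_of_one_le_left zero_le hπ).trans (hle.trans ?_)
  have hBle : B ^ (1 / q) ≤ C ^ (1 / q) * ENNReal.ofReal (3 ^ |a|) * wn κ a q g := by
    have : B ≤ C * (ENNReal.ofReal (3 ^ |a|) ^ q * ∫⁻ x in strip κ, ‖(dd κ x ^ a : ℝ) • g x‖ₑ ^ q) := by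
      rw [hB]; gcongr; exact gt_norm hκ hq hg
    refine (ENNReal.rpow_le_rpow this (by positivity)).trans (le_of_eq ?_)
    rw [ENNReal.mul_rpow_of_nonneg _ _ (by positivity), ENNReal.mul_rpow_of_nonneg _ _ (by positivity), ← ENNReal.rpow_mul,
      mul_one_div_cancel (by linarith), ENNReal.rpow_one, wn, mul_assoc]
  calc _ ≤ 2 * NN κ p γ u g10 g20 g01 g02 * (ENNReal.ofReal (M * 2 ^ |a|) * (C ^ (1 / q) * ENNReal.ofReal (3 ^ |a|) * wn κ a q g)) := by
        rw [hK]; gcongr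
    _ = _ := by ring

def rf (κ : ℝ) (f : ℝ × ℝ → ℂ) (x : ℝ × ℝ) : ℂ := f (x.1, κ - x.2)

def rho (κ : ℝ) (x : ℝ × ℝ) : ℝ × ℝ := (x.1, κ - x.2)

lemma rho_rho (κ : ℝ) (x : ℝ × ℝ) : rho κ (rho κ x) = x := by simp [rho]

lemma rho_meas (κ : ℝ) : Measurable (rho κ) := measurable_fst.prodMk (measurable_const.sub measurable_snd)

lemma rho_emb (κ : ℝ) : MeasurableEmbedding (rho κ) :=
  MeasurableEquiv.measurableEmbedding ⟨⟨rho κ, rho κ, rho_rho κ, rho_rho κ⟩, rho_meas κ, rho_meas κ⟩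

lemma rho_mp (κ : ℝ) : MeasurePreserving (rho κ) :=
  (MeasurePreserving.id (volume : Measure ℝ)).prod (Measure.measurePreserving_sub_left volume κ)

lemma rho_strip (κ : ℝ) : rho κ ⁻¹' strip κ = strip κ := by
  ext x
  simp only [rho, strip, mem_preimage, mem_setOf_eq]
  constructor <;> rintro ⟨h1, h2⟩ <;> constructor <;> linarith

lemma rf_int (κ : ℝ) (f : ℝ × ℝ → ℂ) : ∫ x in strip κ, f (rho κ x) = ∫ x in strip κ, f x := by
  have := (rho_mp κ).setIntegral_preimage_emb (rho_emb κ) f (strip κ)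
  rwa [rho_strip] at this

lemma rf_lint (κ : ℝ) (f : ℝ × ℝ → ℝ≥0∞) : ∫⁻ x in strip κ, f (rho κ x) = ∫⁻ x in strip κ, f x := by
  have := (rho_mp κ).setLIntegral_comp_preimage_emb (rho_emb κ) f (strip κ)
  rwa [rho_strip] at this

lemma rf_pd2 (κ : ℝ) (f : ℝ × ℝ → ℂ) : pd2 (rf κ f) = fun x => -rf κ (pd2 f) x := by
  ext x
  exact deriv_comp_const_sub (f := fun s => f (x.1, s)) κ x.2

lemma neg_pd1 (f : ℝ × ℝ → ℂ) : pd1 (fun x => -f x) = fun x => -pd1 f x := by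
  ext x
  exact deriv.fun_neg (f := fun s => f (s, x.2))

lemma neg_pd2 (f : ℝ × ℝ → ℂ) : pd2 (fun x => -f x) = fun x => -pd2 f x := by
  ext x
  exact deriv.fun_neg (f := fun s => f (x.1, s))

lemma rho_cont (κ : ℝ) : Continuous (rho κ) := by unfold rho; fun_prop

lemma rf_rf (κ : ℝ) (f : ℝ × ℝ → ℂ) : rf κ (rf κ f) = f := by ext x; simp [rf]

lemma rf_tt {κ : ℝ} {f : ℝ × ℝ → ℂ} (h : TT κ f) : TT κ (rf κ f) := by
  have hK : IsCompact (rho κ '' tsupport f) := IsCompact.image h.cc.cs (rho_cont κ)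
  have hsub : tsupport (rf κ f) ⊆ rho κ '' tsupport f := by
    refine closure_minimal (fun x hx => ⟨rho κ x, subset_tsupport _ hx, rho_rho κ x⟩) hK.isClosed
  refine ⟨⟨h.cc.sm.comp (by fun_prop), hK.of_isClosed_subset (isClosed_tsupport _) hsub⟩, fun x hx => ?_⟩
  obtain ⟨y, hy, rfl⟩ := hsub hx
  have := h.ss hy
  rwa [← rho_strip κ] at this

lemma rf_weak {κ : ℝ} {α : ℕ × ℕ} {u g : ℝ × ℝ → ℂ} {c : ℂ} (h : HasWeakDerivOn (strip κ) α u g) (hc : c * c = 1)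
    (hα : ∀ f, pdMix α (rf κ f) = fun x => c * rf κ (pdMix α f) x) :
    HasWeakDerivOn (strip κ) α (rf κ u) (fun x => c * rf κ g x) := by
  intro φ h1 h2 h3
  have T := rf_tt ⟨⟨h1, h2⟩, h3⟩
  have := h _ T.cc.sm T.cc.cs T.ss
  rw [hα φ, ← rf_int, ← rf_int κ fun x => g x * rf κ φ x] at this
  have e1 : ∀ x, rf κ u x * pdMix α φ x = c * (u (rho κ x) * (c * rf κ (pdMix α φ) (rho κ x))) := by
    intro x
    have : rf κ (pdMix α φ) (rho κ x) = pdMix α φ x := by simp [rf, rho]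
    rw [this]
    have e : rf κ u x = u (rho κ x) := rfl
    rw [e]
    linear_combination (-(u (rho κ x) * pdMix α φ x)) * hc
  have e2 : ∀ x, c * rf κ g x * φ x = c * (g (rho κ x) * rf κ φ (rho κ x)) := by
    intro x
    have : rf κ φ (rho κ x) = φ x := by simp [rf, rho]
    rw [this, mul_assoc]; rfl
  simp_rw [e1, e2]
  rw [integral_const_mul, integral_const_mul, this]
  ring

lemma rf_loc {κ : ℝ} {f : ℝ × ℝ → ℂ} (h : LocallyIntegrableOn f (strip κ)) : LocallyIntegrableOn (rf κ f) (strip κ) := by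
  have op : IsOpen (strip κ) := (isOpen_lt continuous_const continuous_snd).inter (isOpen_lt continuous_snd continuous_const)
  rw [locallyIntegrableOn_iff op.isLocallyClosed] at h ⊢
  intro K hK hc
  have hc' : IsCompact (rho κ '' K) := hc.image (rho_cont κ)
  have e : rho κ ⁻¹' (rho κ '' K) = K := preimage_image_eq _ (rho_emb κ).injective
  have hs : rho κ '' K ⊆ strip κ := by
    rintro _ ⟨y, hy, rfl⟩
    have := hK hy
    rwa [← rho_strip κ] at this
  have := ((rho_mp κ).integrableOn_comp_preimage (rho_emb κ)).2 (h _ hs hc')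
  rwa [e] at this

lemma dd_rho (κ : ℝ) (x : ℝ × ℝ) : dd κ (rho κ x) = dd κ x := by
  simp [dd, rho, min_comm]

lemma rf_norm {κ p γ : ℝ} {c : ℂ} (hc : ‖c‖ = 1) (f : ℝ × ℝ → ℂ) : stripNorm κ p γ (fun x => c * rf κ f x) = stripNorm κ p γ f := by
  unfold stripNorm
  congr 1
  rw [← rf_lint κ fun q => ENNReal.ofReal (‖f q‖ ^ p * min q.2 (κ - q.2) ^ γ)]
  refine lintegral_congr fun x => ?_
  have := dd_rho κ x
  unfold dd at this
  rw [this, norm_mul, hc, one_mul]; rfl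

lemma rf_wn (κ a q : ℝ) (g : ℝ × ℝ → ℂ) : wn κ a q (rf κ g) = wn κ a q g := by
  unfold wn
  congr 1
  rw [← rf_lint κ fun x => ‖(dd κ x ^ a : ℝ) • g x‖ₑ ^ q]
  refine lintegral_congr fun x => ?_
  rw [dd_rho]; rfl

lemma WD.rf {κ : ℝ} {u g10 g20 g01 g02 : ℝ × ℝ → ℂ} (h : WD κ u g10 g20 g01 g02) :
    WD κ (rf κ u) (fun x => 1 * rf κ g10 x) (fun x => 1 * rf κ g20 x) (fun x => -1 * rf κ g01 x) (fun x => 1 * rf κ g02 x) := by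
  have l : ∀ (c : ℂ) {f : ℝ × ℝ → ℂ}, LocallyIntegrableOn f (strip κ) → LocallyIntegrableOn (fun x => c * _root_.rf κ f x) (strip κ) :=
    fun c f hf x hx => by
      obtain ⟨s, hs, hi⟩ := rf_loc hf x hx
      exact ⟨s, hs, hi.const_mul c⟩
  refine ⟨rf_loc h.hu, rf_weak h.h10 (by norm_num) ?_, l _ h.l10, rf_weak h.h20 (by norm_num) ?_, l _ h.l20,
    rf_weak h.h01 (by norm_num) ?_, l _ h.l01, rf_weak h.h02 (by norm_num) ?_, l _ h.l02⟩
  · intro f; ext x; rw [one_mul]; rfl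
  · intro f; ext x; rw [one_mul]; rfl
  · intro f; ext x
    simp only [pdMix, Function.iterate_succ, Function.iterate_zero, Function.comp, id]
    rw [rf_pd2]; simp
  · intro f; ext x
    simp only [pdMix, Function.iterate_succ, Function.iterate_zero, Function.comp, id]
    rw [rf_pd2, neg_pd2, rf_pd2]; simp

lemma chi0_add {κ : ℝ} (hκ : 0 < κ) (y : ℝ) : chi0 κ y + chi0 κ (κ - y) = 1 := by
  have e : 2 - 3 * (κ - y) / κ = 1 - (2 - 3 * y / κ) := by field_simp; ring
  unfold chi0
  rw [e]
  generalize 2 - 3 * y / κ = t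
  have := smoothTransition.pos_denom t
  unfold smoothTransition
  rw [sub_sub_cancel, add_comm (expNegInvGlue (1 - t)), ← add_div, div_self this.ne']

lemma main_full {κ p q γ : ℝ} (hκ : 0 < κ) (hpq : p.HolderConjugate q) (hγ : -1 < γ) : ∃ C : ℝ≥0∞, C ≠ ⊤ ∧
    ∀ u g10 g20 g01 g02 : ℝ × ℝ → ℂ, WD κ u g10 g20 g01 g02 → ∀ g, TT κ g →
      ‖∫ x in strip κ, u x * pd1 (pd2 g) x‖ₑ ≤ C * NN κ p γ u g10 g20 g01 g02 * wn κ (-γ / p) q g := by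
  obtain ⟨C, hC, hm⟩ := main_half hκ hpq hγ
  refine ⟨2 * C, by finiteness, fun u g10 g20 g01 g02 hW g hg => ?_⟩
  have A := hm _ _ _ _ _ hW g hg
  have B := hm _ _ _ _ _ hW.rf _ (rf_tt hg)
  have eN : NN κ p γ (rf κ u) (fun x => 1 * rf κ g10 x) (fun x => 1 * rf κ g20 x) (fun x => -1 * rf κ g01 x) (fun x => 1 * rf κ g02 x) =
      NN κ p γ u g10 g20 g01 g02 := by
    unfold NN
    have := rf_norm (κ := κ) (p := p) (γ := γ) (c := 1) (by simp) u
    simp only [one_mul] at this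
    rw [this, rf_norm (by simp), rf_norm (by simp), rf_norm (by simp), rf_norm (by simp)]
  rw [eN, rf_wn] at B
  set T := pd1 (pd2 g) with hT
  have hTT : TT κ T := hg.pd2.pd1
  have eB : ∫ x in strip κ, rf κ u x * ((chi0 κ x.2 : ℂ) * pd1 (pd2 (rf κ g)) x) =
      -∫ x in strip κ, u x * ((chi0 κ (κ - x.2) : ℂ) * T x) := by
    rw [rf_pd2, neg_pd1, ← integral_neg, ← rf_int κ]
    refine integral_congr_ae (Filter.Eventually.of_forall fun x => ?_)
    simp only
    have e1 : rf κ u (rho κ x) = u x := by simp [rf, rho]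
    have e2 : pd1 (rf κ (pd2 g)) (rho κ x) = T x := by
      change rf κ T (rho κ x) = T x
      simp [rf, rho]
    rw [e1, e2]
    simp only [rho]
    ring
  rw [eB, enorm_neg] at B
  have tm : ∀ c : ℝ → ℝ, ContDiff ℝ (⊤ : ℕ∞) c → TT κ fun x => (c x.2 : ℂ) * T x := fun c hc =>
    ⟨⟨(Complex.ofRealCLM.contDiff.comp (hc.comp contDiff_snd)).mul hTT.cc.sm, hTT.cc.cs.mul_left⟩, tsupport_mul_subset_right.trans hTT.ss⟩
  have i1 := (tm _ (chi0_sm κ)).integ hW.hu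
  have i2 := (tm (fun y => chi0 κ (κ - y)) ((chi0_sm κ).comp (by fun_prop))).integ hW.hu
  have e : ∫ x in strip κ, u x * T x = (∫ x in strip κ, u x * ((chi0 κ x.2 : ℂ) * T x)) +
      ∫ x in strip κ, u x * ((chi0 κ (κ - x.2) : ℂ) * T x) := by
    rw [← integral_add i1 i2]
    refine integral_congr_ae (Filter.Eventually.of_forall fun x => ?_)
    have : (chi0 κ x.2 : ℂ) + (chi0 κ (κ - x.2) : ℂ) = 1 := by
      rw [← Complex.ofReal_add, chi0_add hκ]; simp
    simp only
    linear_combination (-(u x * T x)) * this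
  rw [e]
  refine (enorm_add_le _ _).trans ((add_le_add A B).trans (le_of_eq ?_))
  ring

section dual
variable {α : Type*} [MeasurableSpace α] {ν : Measure α} [IsFiniteMeasure ν] {Q : ℝ≥0∞} [Fact (1 ≤ Q)]

def ic (ν : Measure α) [IsFiniteMeasure ν] (Q : ℝ≥0∞) {A : Set α} (hA : MeasurableSet A) : Lp ℂ Q ν :=
  indicatorConstLp Q hA (measure_ne_top ν A) (1 : ℂ)

lemma ic_finset (Q : ℝ≥0∞) (f : ℕ → Set α) (hf : ∀ i, MeasurableSet (f i)) (hd : Pairwise (Function.onFun Disjoint f)) (s : Finset ℕ) :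
    ∑ i ∈ s, ic ν Q (hf i) = ic ν Q (s.measurableSet_biUnion fun i _ => hf i) := by
  classical
  induction s using Finset.induction_on with
  | empty => simp [ic]
  | insert a s ha ih =>
    rw [Finset.sum_insert ha, ih]
    have hdis : Disjoint (f a) (⋃ i ∈ s, f i) := by
      rw [Set.disjoint_iUnion₂_right]
      exact fun i hi => hd (fun h => ha (h ▸ hi))
    have := indicatorConstLp_disjoint_union (p := Q) (hf a) (s.measurableSet_biUnion fun i _ => hf i)
      (measure_ne_top ν _) (measure_ne_top ν _) hdis (1 : ℂ)
    unfold ic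
    rw [← this]
    congr 1
    simp

lemma rn_real (hQ : Q ≠ ⊤) (l : Lp ℂ Q ν →L[ℝ] ℝ) :
    ∃ h : α → ℝ, Measurable h ∧ Integrable h ν ∧ ∀ A (hA : MeasurableSet A), l (ic ν Q hA) = ∫ x in A, h x ∂ν := by
  classical
  let s : SignedMeasure α :=
    { measureOf' := fun A => if hA : MeasurableSet A then l (ic ν Q hA) else 0
      empty' := by simp [ic]
      not_measurable' := fun A hA => by simp [hA]
      m_iUnion' := by
        intro f hf hd
        have hU : MeasurableSet (⋃ i, f i) := MeasurableSet.iUnion hf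
        simp only [hf, hU, dite_true]
        unfold HasSum
        have h1 : ∀ t : Finset ℕ, ∑ i ∈ t, l (ic ν Q (hf i)) = l (ic ν Q (t.measurableSet_biUnion fun i _ => hf i)) := by
          intro t
          rw [← ic_finset Q f hf hd, map_sum]
        simp_rw [h1]
        refine (l.continuous.tendsto _).comp ?_
        refine tendsto_indicatorConstLp_set hQ ?_
        have h2 := (summable_measure_toReal hf hd (μ := ν)).hasSum
        have h3 : HasSum (fun i => ν (f i)) (ν (⋃ i, f i)) := by
          rw [measure_iUnion hd hf]; exact ENNReal.summable.hasSum
        have h4 := ENNReal.Tendsto.sub (tendsto_const_nhds (x := ν (⋃ i, f i)) (f := SummationFilter.unconditional ℕ |>.filter)) h3 (Or.inl (measure_ne_top ν _))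
        rw [tsub_self] at h4
        refine h4.congr fun t => ?_
        have hsub : (⋃ i ∈ t, f i) ⊆ ⋃ i, f i := iUnion₂_subset fun i _ => subset_iUnion f i
        rw [Set.symmDiff_def, Set.diff_eq_empty.2 hsub, empty_union, measure_diff hsub
          (t.measurableSet_biUnion fun i _ => hf i).nullMeasurableSet (measure_ne_top ν _),
          measure_biUnion_finset (fun i _ j _ h => hd h) (fun i _ => hf i)] }
  have hs : ∀ A (hA : MeasurableSet A), s A = l (ic ν Q hA) := fun A hA => dif_pos hA
  have hac : s ≪ᵥ ν.toENNRealVectorMeasure := by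
    refine VectorMeasure.AbsolutelyContinuous.mk fun A hA h0 => ?_
    rw [Measure.toENNRealVectorMeasure_apply_measurable hA] at h0
    rw [hs A hA]
    have hQ0 : Q ≠ 0 := (zero_lt_one.trans_le (Fact.out : 1 ≤ Q)).ne'
    have : ic ν Q hA = 0 := by
      rw [← norm_eq_zero, ic, norm_indicatorConstLp hQ0 hQ]
      have : 0 < Q.toReal := ENNReal.toReal_pos hQ0 hQ
      simp [Measure.real, h0, this.ne']
    rw [this, map_zero]
  refine ⟨s.rnDeriv ν, s.measurable_rnDeriv ν, s.integrable_rnDeriv ν, fun A hA => ?_⟩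
  rw [← withDensityᵥ_apply (s.integrable_rnDeriv ν) hA, s.withDensityᵥ_rnDeriv_eq ν hac, hs]

lemma rn_cplx (hQ : Q ≠ ⊤) (L : Lp ℂ Q ν →L[ℂ] ℂ) :
    ∃ h : α → ℂ, Measurable h ∧ Integrable h ν ∧ ∀ A (hA : MeasurableSet A), L (ic ν Q hA) = ∫ x in A, h x ∂ν := by
  obtain ⟨a, a1, a2, a3⟩ := rn_real hQ (Complex.reCLM.comp (L.restrictScalars ℝ))
  obtain ⟨b, b1, b2, b3⟩ := rn_real hQ (Complex.imCLM.comp (L.restrictScalars ℝ))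
  have ha := a2.ofReal (𝕜 := ℂ)
  have hb := b2.ofReal (𝕜 := ℂ)
  refine ⟨fun x => (a x : ℂ) + (b x : ℂ) * Complex.I, by fun_prop, ha.add (hb.mul_const _), fun A hA => ?_⟩
  have h1 := integral_add (μ := ν.restrict A) (f := fun x => (a x : ℂ)) (g := fun x => (b x : ℂ) * Complex.I) ha.integrableOn (hb.mul_const _).integrableOn
  have e1 : (∫ x in A, ((a x : ℝ) : ℂ) ∂ν) = ((∫ x in A, a x ∂ν : ℝ) : ℂ) := integral_ofReal
  have e2 : (∫ x in A, ((b x : ℝ) : ℂ) ∂ν) = ((∫ x in A, b x ∂ν : ℝ) : ℂ) := integral_ofReal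
  rw [h1, integral_mul_const, e1, e2, ← a3 A hA, ← b3 A hA]
  exact (Complex.re_add_im _).symm

lemma rn_simple (hQ : Q ≠ ⊤) (L : Lp ℂ Q ν →L[ℂ] ℂ) {h : α → ℂ} (hi : Integrable h ν)
    (hA : ∀ A (hA : MeasurableSet A), L (ic ν Q hA) = ∫ x in A, h x ∂ν) (f : SimpleFunc α ℂ) (hm : MemLp f Q ν) :
    L (hm.toLp f) = ∫ x, h x * f x ∂ν := by
  have hI : ∀ f : SimpleFunc α ℂ, Integrable (fun x => h x * f x) ν := by
    intro f
    obtain ⟨C, hC⟩ := f.exists_forall_norm_le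
    exact hi.mul_bdd (c := C) f.aestronglyMeasurable (Filter.Eventually.of_forall hC)
  induction f using SimpleFunc.induction with
  | const c hs =>
    rename_i s
    have e : hm.toLp _ = c • ic ν Q hs := by
      refine Lp.ext ?_
      filter_upwards [hm.coeFn_toLp, Lp.coeFn_smul c (ic ν Q hs), indicatorConstLp_coeFn (p := Q) (hs := hs)
        (hμs := measure_ne_top ν s) (c := (1 : ℂ))] with x h1 h2 h3
      rw [h1, h2, Pi.smul_apply]
      unfold ic
      rw [h3]
      by_cases hx : x ∈ s <;> simp [hx]
    rw [e, map_smul, hA, smul_eq_mul, ← integral_const_mul, ← integral_indicator hs]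
    congr 1
    ext x
    by_cases hx : x ∈ s <;> simp [hx, mul_comm]
  | add hd hf hg =>
    rename_i f g
    have mf : MemLp f Q ν := f.memLp_of_isFiniteMeasure Q ν
    have mg : MemLp g Q ν := g.memLp_of_isFiniteMeasure Q ν
    have : hm.toLp (f + g) = mf.toLp f + mg.toLp g := rfl
    rw [this, map_add, hf, hg, ← integral_add (hI f) (hI g)]
    congr 1; ext x; simp [mul_add]

lemma rn_bdd (hQ : Q ≠ ⊤) (L : Lp ℂ Q ν →L[ℂ] ℂ) {h : α → ℂ} (hi : Integrable h ν)
    (hA : ∀ A (hA : MeasurableSet A), L (ic ν Q hA) = ∫ x in A, h x ∂ν) {f : α → ℂ} (hf : Measurable f) {C : ℝ}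
    (hC : ∀ x, ‖f x‖ ≤ C) (hm : MemLp f Q ν) :
    L (hm.toLp f) = ∫ x, h x * f x ∂ν := by
  have h1 := (L.continuous.tendsto _).comp (SimpleFunc.tendsto_approxOn_range_Lp hQ hf hm)
  refine tendsto_nhds_unique h1 ?_
  simp only [Function.comp_def]
  simp_rw [rn_simple hQ L hi hA]
  refine tendsto_integral_of_dominated_convergence (fun x => ‖h x‖ * (C + C)) ?_ (hi.norm.mul_const _) ?_ ?_
  · exact fun n => hi.aestronglyMeasurable.mul (SimpleFunc.aestronglyMeasurable _)
  · refine fun n => Filter.Eventually.of_forall fun x => ?_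
    rw [norm_mul]
    gcongr
    exact (SimpleFunc.norm_approxOn_zero_le hf _ x n).trans (add_le_add (hC x) (hC x))
  · refine Filter.Eventually.of_forall fun x => ?_
    exact (SimpleFunc.tendsto_approxOn hf _ (subset_closure (by simp))).const_mul _

lemma cancel_pow {p q : ℝ} (hpq : p.HolderConjugate q) {J K : ℝ≥0∞} (hJ : J ≠ ⊤) (h : J ≤ K * J ^ (1 / q)) : J ≤ K ^ p := by
  rcases eq_or_ne J 0 with rfl | h0
  · exact zero_le
  have e : J = J ^ (1 / p) * J ^ (1 / q) := by
    rw [← ENNReal.rpow_add _ _ h0 hJ, hpq.one_div_add_one_div, div_one, ENNReal.rpow_one]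
  have h1 : J ^ (1 / p) ≤ K := by
    nth_rw 1 [e] at h
    refine (ENNReal.mul_le_mul_iff_left ?_ ?_).1 h
    · simp [h0, hJ]
    · exact ENNReal.rpow_ne_top_of_nonneg (by have := hpq.symm.pos; positivity) hJ
  calc J = (J ^ (1 / p)) ^ p := by rw [← ENNReal.rpow_mul, one_div_mul_cancel hpq.pos.ne', ENNReal.rpow_one]
    _ ≤ K ^ p := ENNReal.rpow_le_rpow h1 hpq.pos.le

lemma rn_norm {p q : ℝ} (hpq : p.HolderConjugate q) (hQ : Q = ENNReal.ofReal q) (L : Lp ℂ Q ν →L[ℂ] ℂ) {h : α → ℂ}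
    (hh : Measurable h) (hi : Integrable h ν)
    (hA : ∀ A (hA : MeasurableSet A), L (ic ν Q hA) = ∫ x in A, h x ∂ν) :
    ∫⁻ x, ‖h x‖ₑ ^ p ∂ν ≤ ‖L‖ₑ ^ p := by
  have hp := hpq.lt
  have hq := hpq.symm.lt
  let A : ℕ → Set α := fun n => {x | ‖h x‖ ≤ n}
  have mA : ∀ n, MeasurableSet (A n) := fun n => measurableSet_le hh.norm measurable_const
  have monoA : Monotone A := fun m n hmn x hx => le_trans (show ‖h x‖ ≤ m from hx) (by exact_mod_cast hmn)
  have uA : ⋃ n, A n = univ := by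
    refine eq_univ_of_forall fun x => mem_iUnion.2 ?_
    obtain ⟨n, hn⟩ := exists_nat_ge ‖h x‖
    exact ⟨n, hn⟩
  suffices ∀ n, ∫⁻ x in A n, ‖h x‖ₑ ^ p ∂ν ≤ ‖L‖ₑ ^ p by
    rw [← setLIntegral_univ, ← uA, setLIntegral_iUnion_of_directed _ monoA.directed_le]
    exact iSup_le this
  intro n
  let f : α → ℂ := (A n).indicator fun x => (starRingEnd ℂ) (h x) * ((‖h x‖ ^ (p - 2) : ℝ) : ℂ)
  have fm : Measurable f := by
    refine Measurable.indicator ?_ (mA n)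
    have := (hh.norm.pow_const (p - 2))
    exact (Complex.continuous_conj.measurable.comp hh).mul (Complex.measurable_ofReal.comp this)
  have nf : ∀ x ∈ A n, ‖f x‖ = ‖h x‖ ^ (p - 1) := by
    intro x hx
    simp only [f, indicator_of_mem hx, norm_mul, RCLike.norm_conj, Complex.norm_real]
    rw [norm_of_nonneg (by positivity)]
    rcases eq_or_ne (‖h x‖) 0 with h0 | h0
    · rw [h0, zero_mul, zero_rpow (by linarith)]
    · nth_rw 1 [← rpow_one ‖h x‖]
      rw [← rpow_add (by positivity)]; ring_nf
  have hf : ∀ x ∈ A n, h x * f x = ((‖h x‖ ^ p : ℝ) : ℂ) := by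
    intro x hx
    simp only [f, indicator_of_mem hx]
    rw [← mul_assoc, Complex.mul_conj, Complex.normSq_eq_norm_sq, ← Complex.ofReal_mul]
    congr 1
    rcases eq_or_ne (‖h x‖) 0 with h0 | h0
    · rw [h0, zero_rpow (x := p) (by linarith)]; simp
    · rw [← rpow_natCast, ← rpow_add (by positivity)]; norm_num
  have bf : ∀ x, ‖f x‖ ≤ (n : ℝ) ^ (p - 1) := by
    intro x
    by_cases hx : x ∈ A n
    · rw [nf x hx]; exact rpow_le_rpow (norm_nonneg _) hx (by linarith)
    · simp only [f, indicator_of_notMem hx, norm_zero]; positivity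
  have Mf : MemLp f Q ν := MemLp.of_bound fm.aestronglyMeasurable _ (Filter.Eventually.of_forall bf)
  have key := rn_bdd (by simp [hQ]) L hi hA fm bf Mf
  set J := ∫⁻ x in A n, ‖h x‖ₑ ^ p ∂ν with hJ
  have eJ : J = ∫⁻ x in A n, ENNReal.ofReal (‖h x‖ ^ p) ∂ν := by
    refine lintegral_congr fun x => ?_
    rw [← ENNReal.ofReal_rpow_of_nonneg (norm_nonneg _) (by linarith), ofReal_norm]
  have Jt : J ≠ ⊤ := by
    rw [eJ]
    refine (setLIntegral_lt_top_of_le_nnreal (measure_ne_top ν _) ⟨Real.toNNReal ((n : ℝ) ^ p), fun x hx => ?_⟩).ne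
    exact ENNReal.ofReal_le_ofReal (rpow_le_rpow (norm_nonneg _) hx (by linarith))
  have e1 : (∫ x, h x * f x ∂ν) = ((∫ x in A n, ‖h x‖ ^ p ∂ν : ℝ) : ℂ) := by
    rw [← integral_complex_ofReal, ← integral_indicator (mA n)]
    congr 1; ext x
    by_cases hx : x ∈ A n
    · rw [hf x hx, indicator_of_mem hx]
    · simp [f, hx]
  have e2 : ‖L (Mf.toLp f)‖ₑ = J := by
    rw [key, e1, eJ]
    rw [← ofReal_norm, Complex.norm_real, norm_of_nonneg (integral_nonneg fun x => by positivity),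
      integral_eq_lintegral_of_nonneg_ae (Filter.Eventually.of_forall fun x => by positivity)
        (hh.norm.pow_const p).aestronglyMeasurable, ENNReal.ofReal_toReal (eJ ▸ Jt)]
  have e3 : ‖Mf.toLp f‖ₑ = J ^ (1 / q) := by
    rw [Lp.enorm_toLp, hQ, eLpNorm_eq_lintegral_rpow_enorm_toReal (by simp; linarith) (by simp),
      ENNReal.toReal_ofReal (by linarith), hJ, ← lintegral_indicator (mA n)]
    congr 1
    refine lintegral_congr fun x => ?_
    by_cases hx : x ∈ A n
    · rw [indicator_of_mem hx, ← ofReal_norm, nf x hx, ← ofReal_norm, ENNReal.ofReal_rpow_of_nonneg (by positivity) (by linarith),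
        ENNReal.ofReal_rpow_of_nonneg (by positivity) (by linarith), ← rpow_mul (by positivity), hpq.sub_one_mul_conj]
    · have : 0 < q := by linarith
      simp [f, hx, this]
  refine cancel_pow hpq Jt ?_
  rw [← e3]
  nth_rw 1 [← e2]
  exact L.le_opENorm _

lemma hb_ext {S E : Type*} [AddCommGroup S] [Module ℂ S] [NormedAddCommGroup E] [NormedSpace ℂ E] (Λ : S →ₗ[ℂ] ℂ)
    (T : S →ₗ[ℂ] E) {K : ℝ} (hK : 0 ≤ K) (h : ∀ g, ‖Λ g‖ ≤ K * ‖T g‖) : ∃ L : E →L[ℂ] ℂ, (∀ g, L (T g) = Λ g) ∧ ‖L‖ ≤ K := by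
  obtain ⟨r, hr⟩ := LinearMap.exists_rightInverse_of_surjective T.rangeRestrict T.range_rangeRestrict
  have hr1 : ∀ y : T.range, T (r y) = y := fun y => congrArg Subtype.val (LinearMap.congr_fun hr y)
  let l : T.range →L[ℂ] ℂ := (Λ ∘ₗ r).mkContinuous K fun y => by
    have := h (r y)
    rwa [hr1] at this
  obtain ⟨L, h1, h2⟩ := exists_extension_norm_eq T.range l
  refine ⟨L, fun g => ?_, h2 ▸ LinearMap.mkContinuous_norm_le _ hK _⟩
  have e := h1 (T.rangeRestrict g)
  have e2 := h (r (T.rangeRestrict g) - g)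
  have e3 : T (r (T.rangeRestrict g) - g) = 0 := by rw [map_sub, hr1]; simp
  rw [e3, norm_zero, mul_zero, norm_le_zero_iff, map_sub, sub_eq_zero] at e2
  exact e.trans e2

end dual

def zw (x : ℝ × ℝ) : ℝ := (1 + x.1 ^ 2)⁻¹

lemma zw_pos (x : ℝ × ℝ) : 0 < zw x := by unfold zw; positivity

lemma zw_cont : Continuous zw := by
  unfold zw
  exact Continuous.inv₀ (by fun_prop) fun x => by positivity

def nu (κ : ℝ) : Measure (ℝ × ℝ) := (volume.restrict (strip κ)).withDensity fun x => ENNReal.ofReal (zw x)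

lemma zw_m : Measurable fun x => ENNReal.ofReal (zw x) := zw_cont.measurable.ennreal_ofReal

instance nu_fin (κ : ℝ) : IsFiniteMeasure (nu κ) := by
  refine isFiniteMeasure_withDensity ?_
  have h1 : Integrable (fun x : ℝ × ℝ => zw x) (volume.restrict (strip κ)) := by
    have e : strip κ = univ ×ˢ Ioo 0 κ := by ext x; simp [strip]
    rw [e, Measure.volume_eq_prod, ← Measure.prod_restrict, Measure.restrict_univ]
    have : Integrable (fun _ : ℝ => (1 : ℝ)) (volume.restrict (Ioo 0 κ)) := integrable_const _
    simpa [zw] using integrable_inv_one_add_sq.mul_prod this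
  have h2 := h1.hasFiniteIntegral
  rw [hasFiniteIntegral_iff_ofReal (Filter.Eventually.of_forall fun x => (zw_pos x).le)] at h2
  exact h2.ne

lemma nu_lint (κ : ℝ) {F : ℝ × ℝ → ℝ≥0∞} (hF : Measurable F) :
    ∫⁻ x, F x ∂nu κ = ∫⁻ x in strip κ, ENNReal.ofReal (zw x) * F x :=
  lintegral_withDensity_eq_lintegral_mul _ zw_m hF

lemma nu_int (κ : ℝ) (F : ℝ × ℝ → ℂ) : ∫ x, F x ∂nu κ = ∫ x in strip κ, (zw x : ℂ) * F x := by
  unfold nu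
  rw [integral_withDensity_eq_integral_toReal_smul zw_m (Filter.Eventually.of_forall fun x => by simp)]
  refine integral_congr_ae (Filter.Eventually.of_forall fun x => ?_)
  simp [ENNReal.toReal_ofReal (zw_pos x).le]

lemma nu_integ {κ : ℝ} {F : ℝ × ℝ → ℂ} (h : Integrable F (nu κ)) : IntegrableOn (fun x => (zw x : ℂ) * F x) (strip κ) := by
  unfold nu at h
  rw [integrable_withDensity_iff_integrable_smul' zw_m (Filter.Eventually.of_forall fun x => by simp)] at h
  refine h.congr (Filter.Eventually.of_forall fun x => ?_)
  simp [ENNReal.toReal_ofReal (zw_pos x).le]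

def ww (κ a b : ℝ) (x : ℝ × ℝ) : ℝ := dd κ x ^ a * zw x ^ b

lemma ww_meas (κ a b : ℝ) : Measurable (ww κ a b) := ((dd_meas κ).pow_const _).mul (zw_cont.measurable.pow_const _)

lemma ww_cont (κ a b : ℝ) : ContinuousOn (fun x => (ww κ a b x : ℂ)) (strip κ) := by
  refine Complex.continuous_ofReal.comp_continuousOn (ContinuousOn.mul ?_ ?_)
  · refine ContinuousOn.rpow_const ?_ fun x hx => Or.inl (dd_pos hx).ne'
    exact (continuous_snd.min (continuous_const.sub continuous_snd)).continuousOn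
  · exact zw_cont.continuousOn.rpow_const fun x _ => Or.inl (zw_pos x).ne'

def JJ (κ a q : ℝ) (g : ℝ × ℝ → ℂ) (x : ℝ × ℝ) : ℂ := (ww κ a (-1 / q) x : ℂ) * g x

lemma JJ_meas {κ a q : ℝ} {g : ℝ × ℝ → ℂ} (h : TT κ g) : Measurable (JJ κ a q g) :=
  (Complex.measurable_ofReal.comp (ww_meas κ a _)).mul h.cc.sm.continuous.measurable

lemma JJ_bdd {κ a q : ℝ} {g : ℝ × ℝ → ℂ} (h : TT κ g) : ∃ M, ∀ x, ‖JJ κ a q g x‖ ≤ M := by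
  obtain ⟨M, hM⟩ := IsCompact.exists_bound_of_continuousOn (s := tsupport g) h.cc.cs
    (((ww_cont κ a (-1 / q)).mono h.ss).mul h.cc.sm.continuous.continuousOn)
  refine ⟨max M 0, fun x => ?_⟩
  by_cases hx : x ∈ tsupport g
  · exact (hM x hx).trans (le_max_left _ _)
  · simp [JJ, image_eq_zero_of_notMem_tsupport hx]

lemma JJ_mem {κ a q : ℝ} {g : ℝ × ℝ → ℂ} (Q : ℝ≥0∞) (h : TT κ g) : MemLp (JJ κ a q g) Q (nu κ) := by
  obtain ⟨M, hM⟩ := JJ_bdd (a := a) (q := q) h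
  exact MemLp.of_bound (JJ_meas h).aestronglyMeasurable M (Filter.Eventually.of_forall hM)

lemma JJ_norm {κ a q : ℝ} (hq : 1 < q) {g : ℝ × ℝ → ℂ} (h : TT κ g) :
    eLpNorm (JJ κ a q g) (ENNReal.ofReal q) (nu κ) = wn κ a q g := by
  rw [eLpNorm_eq_lintegral_rpow_enorm_toReal (by simp; linarith) (by simp), ENNReal.toReal_ofReal (by linarith),
    nu_lint κ ((JJ_meas h).enorm.pow_const q), wn]
  congr 1
  refine setLIntegral_congr_fun (strip_meas κ) fun x hx => ?_
  have hz := zw_pos x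
  have hd := dd_pos hx
  have e : JJ κ a q g x = ((zw x ^ (-1 / q) : ℝ)) • ((dd κ x ^ a : ℝ) • g x) := by
    simp only [JJ, ww, Complex.real_smul, Complex.ofReal_mul]; ring
  simp only [e]
  rw [enorm_smul (zw x ^ (-1 / q)), ENNReal.mul_rpow_of_nonneg _ _ (by linarith), ← mul_assoc, ← ofReal_norm (zw x ^ (-1 / q)),
    norm_of_nonneg (by positivity), ENNReal.ofReal_rpow_of_nonneg (by positivity) (by linarith), ← rpow_mul hz.le,
    div_mul_cancel₀ _ (by linarith), rpow_neg_one, ← ENNReal.ofReal_mul hz.le, mul_inv_cancel₀ hz.ne', ENNReal.ofReal_one, one_mul]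

def TS (κ : ℝ) : Submodule ℂ (ℝ × ℝ → ℂ) where
  carrier := {g | TT κ g}
  zero_mem' := ⟨⟨contDiff_const, HasCompactSupport.zero⟩, by simp [tsupport_zero]⟩
  add_mem' := fun {f g} hf hg => ⟨⟨hf.cc.sm.add hg.cc.sm, hf.cc.cs.add hg.cc.cs⟩,
    (tsupport_add f g).trans (union_subset hf.ss hg.ss)⟩
  smul_mem' := fun c g hg => ⟨⟨contDiff_const.smul hg.cc.sm, hg.cc.cs.smul_left (f := fun _ => c)⟩,
    (tsupport_smul_subset_right (fun _ => c) g).trans hg.ss⟩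

lemma pd1_add {f g : ℝ × ℝ → ℂ} (hf : Cc f) (hg : Cc g) : pd1 (f + g) = pd1 f + pd1 g := by
  rw [pd1_eq (show ContDiff ℝ (⊤ : ℕ∞) (f + g) from hf.sm.add hg.sm), pd1_eq hf.sm, pd1_eq hg.sm]
  ext x
  rw [fderiv_add (hf.sm.differentiable (by simp) x) (hg.sm.differentiable (by simp) x)]; rfl

lemma pd2_add {f g : ℝ × ℝ → ℂ} (hf : Cc f) (hg : Cc g) : pd2 (f + g) = pd2 f + pd2 g := by
  rw [pd2_eq (show ContDiff ℝ (⊤ : ℕ∞) (f + g) from hf.sm.add hg.sm), pd2_eq hf.sm, pd2_eq hg.sm]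
  ext x
  rw [fderiv_add (hf.sm.differentiable (by simp) x) (hg.sm.differentiable (by simp) x)]; rfl

lemma pd1_smul (c : ℂ) (f : ℝ × ℝ → ℂ) : pd1 (c • f) = c • pd1 f := by
  ext x; exact deriv_const_smul_field c (fun s => f (s, x.2))

lemma pd2_smul (c : ℂ) (f : ℝ × ℝ → ℂ) : pd2 (c • f) = c • pd2 f := by
  ext x; exact deriv_const_smul_field c (fun s => f (x.1, s))

def Lam {κ : ℝ} {u : ℝ × ℝ → ℂ} (hu : LocallyIntegrableOn u (strip κ)) : TS κ →ₗ[ℂ] ℂ where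
  toFun g := ∫ x in strip κ, u x * pd1 (pd2 g.1) x
  map_add' f g := by
    have hf : TT κ f.1 := f.2
    have hg : TT κ g.1 := g.2
    rw [← integral_add (hf.pd2.pd1.integ hu) (hg.pd2.pd1.integ hu)]
    simp only [Submodule.coe_add]
    rw [pd2_add hf.cc hg.cc, pd1_add hf.pd2.cc hg.pd2.cc]
    simp only [Pi.add_apply, mul_add]
  map_smul' c f := by
    simp only [Submodule.coe_smul, pd2_smul, pd1_smul, RingHom.id_apply, smul_eq_mul]
    rw [← integral_const_mul]
    congr 1; ext x; simp only [Pi.smul_apply, smul_eq_mul]; ring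

def Jm (κ a q : ℝ) (Q : ℝ≥0∞) : TS κ →ₗ[ℂ] Lp ℂ Q (nu κ) where
  toFun g := (JJ_mem (a := a) (q := q) Q g.2).toLp _
  map_add' f g := by
    rw [← MemLp.toLp_add]
    congr 1; ext x; simp [JJ, mul_add]
  map_smul' c f := by
    rw [RingHom.id_apply, ← MemLp.toLp_const_smul]
    congr 1; ext x; simp [JJ]; ring

lemma dual_strip {κ p q γ : ℝ} (hpq : p.HolderConjugate q) {u : ℝ × ℝ → ℂ} (hu : LocallyIntegrableOn u (strip κ))
    {K : ℝ≥0∞} (hK : K ≠ ⊤) (hb : ∀ g, TT κ g → ‖∫ x in strip κ, u x * pd1 (pd2 g) x‖ₑ ≤ K * wn κ (-γ / p) q g) :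
    ∃ G : ℝ × ℝ → ℂ, HasWeakDerivOn (strip κ) (1, 1) u G ∧ LocallyIntegrableOn G (strip κ) ∧ stripNorm κ p γ G ≤ K := by
  have hp := hpq.lt
  have hq := hpq.symm.lt
  set a := -γ / p with ha
  set Q := ENNReal.ofReal q with hQ
  have : Fact (1 ≤ Q) := ⟨by rw [hQ]; exact ENNReal.one_le_ofReal.2 hq.le⟩
  have hQt : Q ≠ ⊤ := by simp [hQ]
  have nJ : ∀ g : TS κ, ‖Jm κ a q Q g‖ₑ = wn κ a q g.1 := fun g => by
    rw [← JJ_norm hq g.2]; exact Lp.enorm_toLp (JJ_mem Q g.2)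
  obtain ⟨L, hL, hLK⟩ := hb_ext (Lam hu) (Jm κ a q Q) (K := K.toReal) ENNReal.toReal_nonneg fun g => by
    have h1 := hb g.1 g.2
    rw [← nJ g] at h1
    have h2 := ENNReal.toReal_mono (by finiteness) h1
    rwa [ENNReal.toReal_mul, toReal_enorm, toReal_enorm] at h2
  obtain ⟨h, hm, hi, hA⟩ := rn_cplx hQt L
  have hn := rn_norm hpq hQ L hm hi hA
  have hLK' : ‖L‖ₑ ≤ K := by
    rw [← ofReal_norm, ← ENNReal.ofReal_toReal hK]; exact ENNReal.ofReal_le_ofReal hLK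
  refine ⟨fun x => (ww κ a (1 / p) x : ℂ) * h x, ?_, ?_, ?_⟩
  · intro φ h1 h2 h3
    have hT : TT κ φ := ⟨⟨h1, h2⟩, h3⟩
    have e1 := hL ⟨φ, hT⟩
    obtain ⟨M, hM⟩ := JJ_bdd (a := a) (q := q) hT
    have e2 := rn_bdd hQt L hi hA (JJ_meas hT) hM (JJ_mem Q hT)
    have e3 : (∫ x in strip κ, u x * pdMix (1, 1) φ x) = ∫ x, h x * JJ κ a q φ x ∂nu κ := e1.symm.trans e2
    rw [e3, nu_int]
    norm_num
    refine setIntegral_congr_fun (strip_meas κ) fun x hx => ?_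
    have hz := zw_pos x
    have e4 : zw x * zw x ^ (-1 / q) = zw x ^ (1 / p) := by
      nth_rw 1 [← rpow_one (zw x)]
      rw [← rpow_add hz]
      congr 1
      have := hpq.one_div_add_one_div
      rw [neg_div]; linarith
    simp only [JJ, ww]
    rw [← one_div, ← e4]
    push_cast
    ring
  · have op : IsOpen (strip κ) := (isOpen_lt continuous_const continuous_snd).inter (isOpen_lt continuous_snd continuous_const)
    refine (locallyIntegrableOn_iff op.isLocallyClosed).2 fun k hk ck => ?_
    have h1 := IntegrableOn.continuousOn_mul ((ww_cont κ a (1 / p - 1)).mono hk) ((nu_integ hi).mono_set hk) ck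
    refine h1.congr_fun (fun x _ => ?_) ck.measurableSet
    have hz := zw_pos x
    have e4 : zw x ^ (1 / p - 1) * zw x = zw x ^ (1 / p) := by
      rw [rpow_sub_one hz.ne']; field_simp
    simp only [ww]
    rw [← e4]
    push_cast
    ring
  · rw [stripNorm_eq hp]
    rw [nu_lint κ (hm.enorm.pow_const p)] at hn
    have e : (∫⁻ x in strip κ, (ENNReal.ofReal (‖(ww κ a (1 / p) x : ℂ) * h x‖ * dd κ x ^ (γ / p))) ^ p) =
        ∫⁻ x in strip κ, ENNReal.ofReal (zw x) * ‖h x‖ₑ ^ p := by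
      refine setLIntegral_congr_fun (strip_meas κ) fun x hx => ?_
      have hz := zw_pos x
      have hd := dd_pos hx
      have e5 : ‖(ww κ a (1 / p) x : ℂ) * h x‖ * dd κ x ^ (γ / p) = zw x ^ (1 / p) * ‖h x‖ := by
        rw [norm_mul, Complex.norm_real, ww, norm_of_nonneg (by positivity)]
        have : dd κ x ^ a * dd κ x ^ (γ / p) = 1 := by
          rw [← rpow_add hd, ha, neg_div, neg_add_cancel, rpow_zero]
        linear_combination (zw x ^ (1 / p) * ‖h x‖) * this
      simp only [e5]
      rw [ENNReal.ofReal_mul (by positivity), ENNReal.mul_rpow_of_nonneg _ _ (by linarith), ofReal_norm,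
        ENNReal.ofReal_rpow_of_nonneg (by positivity) (by linarith), ← rpow_mul hz.le, one_div_mul_cancel (by linarith), rpow_one]
    rw [e]
    calc _ ≤ (‖L‖ₑ ^ p) ^ (1 / p) := ENNReal.rpow_le_rpow hn (by positivity)
      _ = ‖L‖ₑ := by rw [← ENNReal.rpow_mul, mul_one_div_cancel (by linarith), ENNReal.rpow_one]
      _ ≤ K := hLK'

theorem stmt18 (κ : ℝ) (hκ : 0 < κ) (hκ' : κ < 2 * π)
    (p γ : ℝ) (hp : 1 < p)
    (hγ1 : -1 < γ) (hγ2 : γ < 2 * p - 1) (hγ3 : γ ≠ p - 1) :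
    ∃ C : ℝ, 0 < C ∧
      ∀ u g10 g20 g01 g02 : ℝ × ℝ → ℂ,
        LocallyIntegrableOn u (strip κ) →
        HasWeakDerivOn (strip κ) (1, 0) u g10 → LocallyIntegrableOn g10 (strip κ) →
        HasWeakDerivOn (strip κ) (2, 0) u g20 → LocallyIntegrableOn g20 (strip κ) →
        HasWeakDerivOn (strip κ) (0, 1) u g01 → LocallyIntegrableOn g01 (strip κ) →
        HasWeakDerivOn (strip κ) (0, 2) u g02 → LocallyIntegrableOn g02 (strip κ) →
        stripNorm κ p γ u < ⊤ → stripNorm κ p γ g10 < ⊤ → stripNorm κ p γ g20 < ⊤ →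
        stripNorm κ p γ g01 < ⊤ → stripNorm κ p γ g02 < ⊤ →
        ∃ g11 : ℝ × ℝ → ℂ,
          HasWeakDerivOn (strip κ) (1, 1) u g11 ∧ LocallyIntegrableOn g11 (strip κ) ∧
          stripNorm κ p γ g11 < ⊤ ∧
          stripNorm κ p γ g11 ≤ ENNReal.ofReal C *
            (stripNorm κ p γ u + stripNorm κ p γ g10 + stripNorm κ p γ g20 +
              stripNorm κ p γ g01 + stripNorm κ p γ g02) := by
  have hpq := Real.HolderConjugate.conjExponent hp
  obtain ⟨C, hC, hm⟩ := main_full (γ := γ) hκ hpq hγ1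
  refine ⟨C.toReal + 1, by positivity, fun u g10 g20 g01 g02 hu h10 l10 h20 l20 h01 l01 h02 l02 n0 n1 n2 n3 n4 => ?_⟩
  have hW : WD κ u g10 g20 g01 g02 := ⟨hu, h10, l10, h20, l20, h01, l01, h02, l02⟩
  have hN : NN κ p γ u g10 g20 g01 g02 ≠ ⊤ := by
    unfold NN
    exact ENNReal.add_ne_top.2 ⟨ENNReal.add_ne_top.2 ⟨ENNReal.add_ne_top.2 ⟨ENNReal.add_ne_top.2 ⟨n0.ne, n1.ne⟩, n2.ne⟩, n3.ne⟩, n4.ne⟩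
  have hK : C * NN κ p γ u g10 g20 g01 g02 ≠ ⊤ := ENNReal.mul_ne_top hC hN
  obtain ⟨G, h1, h2, h3⟩ := dual_strip hpq hu hK (hm u g10 g20 g01 g02 hW)
  refine ⟨G, h1, h2, h3.trans_lt hK.lt_top, h3.trans ?_⟩
  refine mul_le_mul' ?_ le_rfl
  calc C = ENNReal.ofReal C.toReal := (ENNReal.ofReal_toReal hC).symm
    _ ≤ _ := ENNReal.ofReal_le_ofReal (by linarith)
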